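/- arXiv:1610.05457 — 6 statements merged into one kernel-verified Lean document; each statement's English description precedes it below -/
import Mathlib

section
/- The special tame automorphism group STame(k^3) is not simple. Precisely: there exists a subgroup N of Aut(R) such that (i) every element of N belongs to Tame(k^3) and has Jacobian determinant equal to the constant polynomial 1; (ii) N contains a non-identity element; (iii) there exists σ ∈ Tame(k^3) with Jacobian determinant 1 such that σ ∉ N; and (iv) for every σ ∈ Tame(k^3) with Jacobian determinant 1 and every τ ∈ N, the conjugate σ∘τ∘σ⁻¹ lies in N. -/
open MvPolynomial

/-- The group of `k`-algebra automorphisms of `k[x1,x2,x3]`. -/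
abbrev Aut3 (k : Type) [Field k] := MvPolynomial (Fin 3) k ≃ₐ[k] MvPolynomial (Fin 3) k

/-- `σ` is an affine automorphism: `σ(x_i) = Σ_j a_{ij}·x_j + b_i` with `(a_{ij}) ∈ GL_3(k)`. -/
def IsAffine (k : Type) [Field k] (σ : Aut3 k) : Prop :=
  ∃ (A : Matrix (Fin 3) (Fin 3) k) (b : Fin 3 → k), IsUnit A ∧
    ∀ i, σ (X i) = (∑ j, C (A i j) * X j) + C (b i)

/-- `σ` is an elementary automorphism: `σ(x1) = x1 + P(x2,x3)`, `σ(x2) = x2`, `σ(x3) = x3`. -/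
def IsElementary (k : Type) [Field k] (σ : Aut3 k) : Prop :=
  ∃ P ∈ supported k ({1, 2} : Set (Fin 3)),
    σ (X 0) = X 0 + P ∧ σ (X 1) = X 1 ∧ σ (X 2) = X 2

/-- The tame automorphism group `Tame(k^3)`: the subgroup generated by affine and
elementary automorphisms. -/
noncomputable def Tame (k : Type) [Field k] : Subgroup (Aut3 k) :=
  Subgroup.closure {σ | IsAffine k σ ∨ IsElementary k σ}

/-- The Jacobian determinant `det(∂σ(x_i)/∂x_j)` of an automorphism. -/
noncomputable def jacDet (k : Type) [Field k] (σ : Aut3 k) : MvPolynomial (Fin 3) k :=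
  (Matrix.of fun i j => pderiv j (σ (X i))).det

/-- A group acting on the cosets `Y⟨g⟩` ("axes"), with a coordinate `c (x⁻¹ * Y)` of the projection
of `x` to the axis of `Y` and a complexity `μ (x⁻¹ * Y)` which controls these projections. -/
structure AxisSystem (G Ω : Type*) [Group G] [LinearOrder Ω] where
  g : G
  c : G → ℤ
  μ : G → Ω
  θ : ℕ
  c_mul : ∀ φ, c (φ * g) = c φ - 1
  μ_mul : ∀ φ, μ (φ * g) = μ φ
  lt_of_far : ∀ φ φ', φ⁻¹ * φ' ∉ Subgroup.zpowers g →
    θ < (c φ - c (φ'⁻¹ * φ)).natAbs → μ φ < μ φ'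

namespace AxisSystem

variable {G Ω : Type*} [Group G] [LinearOrder Ω] (S : AxisSystem G Ω)

/-- Coordinate of the projection of `x` to the axis of `Y`. -/
def proj (Y x : G) : ℤ := S.c (x⁻¹ * Y)

/-- Two elements have the same axis. -/
def Par (Y A : G) : Prop := Y⁻¹ * A ∈ Subgroup.zpowers S.g

/-- The translation length of the rotations. -/
def len : ℕ := 20 * S.θ + 1

/-- The rotation around the axis of `Y`. -/
def rot (Y : G) : G := Y * S.g ^ S.len * Y⁻¹

lemma c_mul_zpow (φ : G) (n : ℤ) : S.c (φ * S.g ^ n) = S.c φ - n := by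
  induction n with
  | zero => simp
  | succ n ih => rw [zpow_add_one, ← mul_assoc, S.c_mul, ih]; ring
  | pred n ih =>
    have h := S.c_mul (φ * S.g ^ (-(n : ℤ) - 1))
    rw [mul_assoc, ← zpow_add_one, sub_add_cancel, ih] at h
    linarith

lemma μ_mul_zpow (φ : G) (n : ℤ) : S.μ (φ * S.g ^ n) = S.μ φ := by
  induction n with
  | zero => simp
  | succ n ih => rw [zpow_add_one, ← mul_assoc, S.μ_mul, ih]
  | pred n ih =>
    have h := S.μ_mul (φ * S.g ^ (-(n : ℤ) - 1))
    rw [mul_assoc, ← zpow_add_one, sub_add_cancel, ih] at h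
    exact h.symm

lemma proj_mul (h Y x : G) : S.proj (h * Y) (h * x) = S.proj Y x := by
  simp [proj, mul_assoc]

lemma proj_mul_left (h Y x : G) : S.proj (h * Y) x = S.proj Y (h⁻¹ * x) := by
  simp [proj, mul_assoc]

lemma proj_zpow_left (Y x : G) (n : ℤ) : S.proj (Y * S.g ^ n) x = S.proj Y x - n := by
  rw [proj, ← mul_assoc, c_mul_zpow, proj]

lemma rot_zpow (Y : G) (e : ℤ) : S.rot Y ^ e = Y * S.g ^ (S.len * e) * Y⁻¹ := by
  rw [rot, conj_zpow, zpow_mul, zpow_natCast]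

lemma rot_zpow_mul (Y : G) (e : ℤ) : S.rot Y ^ e * Y = Y * S.g ^ (S.len * e) := by
  simp [rot_zpow]

lemma proj_rot (Y x : G) (e : ℤ) : S.proj Y (S.rot Y ^ e * x) = S.proj Y x + S.len * e := by
  have : S.proj Y (S.rot Y ^ e * x) = S.proj (Y * S.g ^ (-(S.len * e : ℤ))) x := by
    simp [proj, rot_zpow, mul_assoc]
  rw [this, proj_zpow_left]; ring

lemma rot_mul (h Y : G) : S.rot (h * Y) = h * S.rot Y * h⁻¹ := by
  simp [rot, mul_assoc]

lemma Par.rot_eq {S : AxisSystem G Ω} {Y A : G} (h : S.Par Y A) : S.rot A = S.rot Y := by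
  obtain ⟨n, hn⟩ := Subgroup.mem_zpowers_iff.1 h
  have : A = Y * S.g ^ n := by rw [hn]; group
  rw [this, rot, rot]
  have hc : S.g ^ n * S.g ^ S.len = S.g ^ S.len * S.g ^ n :=
    ((Commute.refl S.g).zpow_left n).pow_right S.len
  rw [mul_inv_rev, mul_assoc Y, hc]
  group

lemma Par.symm {S : AxisSystem G Ω} {Y A : G} (h : S.Par Y A) : S.Par A Y := by
  have := (Subgroup.zpowers S.g).inv_mem h
  simpa [Par] using this

lemma par_mul_zpow (Y : G) (n : ℤ) : S.Par Y (Y * S.g ^ n) := by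
  simp only [Par, inv_mul_cancel_left]
  exact Subgroup.zpow_mem_zpowers _ _

lemma Par.trans {S : AxisSystem G Ω} {Y A B : G} (h : S.Par Y A) (h' : S.Par A B) :
    S.Par Y B := by
  have := (Subgroup.zpowers S.g).mul_mem h h'
  simpa [Par, mul_assoc] using this

lemma par_mul (h Y A : G) : S.Par (h * Y) (h * A) ↔ S.Par Y A := by
  simp [Par, mul_assoc]

lemma μ_lt {Y A : G} (x : G) (h : ¬ S.Par Y A)
    (hd : S.θ < (S.proj Y x - S.proj Y A).natAbs) : S.μ (x⁻¹ * Y) < S.μ (x⁻¹ * A) := by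
  apply S.lt_of_far
  · simpa [Par, mul_assoc] using h
  · simpa [proj, mul_assoc] using hd

lemma behrstock {Y A : G} (x : G) (h : ¬ S.Par Y A)
    (hd : S.θ < (S.proj Y x - S.proj Y A).natAbs) :
    (S.proj A x - S.proj A Y).natAbs ≤ S.θ := by
  by_contra hA
  exact lt_asymm (S.μ_lt x h hd) (S.μ_lt x (fun h' => h h'.symm) (not_le.1 hA))

/-- Subgroups moving no axis centre much, except along rotations they contain. -/
structure Good (H : Subgroup G) : Prop where
  exists_ne : ∀ h ∈ H, h ≠ 1 → ∃ Z, S.proj Z 1 ≠ S.proj Z h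
  bdd : ∀ Y, S.rot Y ∉ H → ∀ h ∈ H, (S.proj Y 1 - S.proj Y h).natAbs ≤ 6 * S.θ

/-- A family of axes around which the rotations can be adjoined to a good subgroup. -/
structure Adjoinable (H : Subgroup G) (T : Set G) : Prop where
  mul_mem : ∀ h ∈ H, ∀ Y ∈ T, h * Y ∈ T
  zpow_mem : ∀ Y ∈ T, ∀ n : ℤ, Y * S.g ^ n ∈ T
  rot_notMem : ∀ Y ∈ T, S.rot Y ∉ H
  near : ∀ A ∈ T, ∀ Y, S.rot Y ∉ H → ¬ S.Par Y A →
    ∃ h ∈ H, (S.proj Y A - S.proj Y h).natAbs ≤ S.θ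
  gap : ∀ Y, S.rot Y ∉ H → Y ∉ T → ∀ h ∈ H, ∀ h' ∈ H,
    (S.proj Y h - S.proj Y h').natAbs ≤ 2 * S.θ

lemma exists_adjoinable [WellFoundedLT Ω] {H : Subgroup G} (hH : ∃ Y, S.rot Y ∉ H) :
    ∃ T : Set G, T.Nonempty ∧ S.Adjoinable H T := by
  have hrot : ∀ h ∈ H, ∀ Y, S.rot Y ∉ H → S.rot (h * Y) ∉ H := fun h hh Y hY hY' => hY <| by
    rw [rot_mul] at hY'
    have := H.mul_mem (H.mul_mem (H.inv_mem hh) hY') hh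
    simpa [mul_assoc] using this
  by_cases hc : ∃ Y, S.rot Y ∉ H ∧ ∃ h ∈ H, ∃ h' ∈ H,
      2 * S.θ < (S.proj Y h - S.proj Y h').natAbs
  · refine ⟨{Y | S.rot Y ∉ H ∧ ∃ h ∈ H, ∃ h' ∈ H,
      2 * S.θ < (S.proj Y h - S.proj Y h').natAbs}, hc, ⟨?_, ?_, ?_, ?_, ?_⟩⟩
    · rintro q hq Y ⟨hY, h, hh, h', hh', hl⟩
      refine ⟨hrot q hq Y hY, q * h, H.mul_mem hq hh, q * h', H.mul_mem hq hh', ?_⟩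
      simpa [proj_mul] using hl
    · rintro Y ⟨hY, h, hh, h', hh', hl⟩ n
      refine ⟨by rwa [(S.par_mul_zpow Y n).rot_eq], h, hh, h', hh', ?_⟩
      rw [proj_zpow_left, proj_zpow_left]
      omega
    · rintro Y ⟨hY, -⟩
      exact hY
    · rintro A ⟨hA, h, hh, h', hh', hl⟩ Y hY hYA
      have hAY : ¬ S.Par A Y := fun h => hYA h.symm
      by_cases h1 : S.θ < (S.proj A h - S.proj A Y).natAbs
      · have := S.behrstock h hAY h1
        exact ⟨h, hh, by omega⟩
      · have := S.behrstock h' hAY (by omega)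
        exact ⟨h', hh', by omega⟩
    · intro Y hY hYT h hh h' hh'
      by_contra hl
      exact hYT ⟨hY, h, hh, h', hh', not_le.1 hl⟩
  · push Not at hc
    obtain ⟨Y₁, hY₁, hmin⟩ : ∃ Y₁, S.rot Y₁ ∉ H ∧ ∀ Y, S.rot Y ∉ H → S.μ Y₁ ≤ S.μ Y := by
      obtain ⟨y, hy, h⟩ := (InvImage.wf S.μ (wellFounded_lt (α := Ω))).has_min
        {Y | S.rot Y ∉ H} hH
      exact ⟨y, hy, fun Y hY => not_lt.1 (h Y hY)⟩
    refine ⟨{A | ∃ q ∈ H, ∃ n : ℤ, A = q * Y₁ * S.g ^ n}, ⟨Y₁, 1, H.one_mem, 0, by simp⟩,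
      ⟨?_, ?_, ?_, ?_, ?_⟩⟩
    · rintro h hh _ ⟨q, hq, n, rfl⟩
      exact ⟨h * q, H.mul_mem hh hq, n, by simp [mul_assoc]⟩
    · rintro _ ⟨q, hq, n, rfl⟩ n'
      exact ⟨q, hq, n + n', by simp [mul_assoc, zpow_add]⟩
    · rintro _ ⟨q, hq, n, rfl⟩
      rw [(S.par_mul_zpow _ n).rot_eq]
      exact hrot q hq _ hY₁
    · rintro _ ⟨q, hq, n, rfl⟩ Y hY hYA
      refine ⟨q, hq, ?_⟩
      by_contra hl
      have h1 := S.μ_lt q hYA (by omega)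
      have h2 := hmin (q⁻¹ * Y) (hrot _ (H.inv_mem hq) _ hY)
      have h3 : q⁻¹ * (q * Y₁ * S.g ^ n) = Y₁ * S.g ^ n := by simp [mul_assoc]
      rw [h3, μ_mul_zpow] at h1
      exact absurd h1 (not_lt.2 h2)
    · intro Y hY _ h hh h' hh'
      exact hc Y hY h hh h' hh'

/-- Points beyond the axis of `Z` are seen near `1` or near `Z` from every other axis. -/
def Shadow (H' : Subgroup G) (Z : G) : Prop :=
  ∀ Y, S.rot Y ∉ H' → ∀ x, 2 * S.θ < (S.proj Z 1 - S.proj Z x).natAbs →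
    (S.proj Y 1 - S.proj Y x).natAbs ≤ 6 * S.θ ∨ (S.proj Y 1 - S.proj Y Z).natAbs ≤ S.θ

/-- Elements of the windmill spanned by `H` and the rotations around `T`. -/
inductive Windmill (H : Subgroup G) (T : Set G) (H' : Subgroup G) : G → Prop
  | base (h : G) (hh : h ∈ H) : Windmill H T H' h
  | step (q Y h : G) (e : ℤ) (hq : Windmill H T H' q) (hY : Y ∈ T)
      (hz : (S.proj (q * Y) 1 - S.proj Y 1).natAbs ≤ 8 * S.θ)
      (hs : S.Shadow H' (q * Y)) (he : e ≠ 0) (hh : h ∈ H) :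
      Windmill H T H' (q * S.rot Y ^ e * h)

variable {S} {H H' : Subgroup G} {T : Set G}

lemma Windmill.mul_mem {w h : G} (hw : S.Windmill H T H' w) (hh : h ∈ H) :
    S.Windmill H T H' (w * h) := by
  cases hw with
  | base _ h' => exact .base _ (H.mul_mem h' hh)
  | step q Y h' e hq hY hz hs he hh' =>
    rw [mul_assoc]
    exact .step q Y _ e hq hY hz hs he (H.mul_mem hh' hh)

lemma Windmill.mem {w : G} (hw : S.Windmill H T H' w) (hle : H ≤ H')
    (hT : ∀ Y ∈ T, S.rot Y ∈ H') : w ∈ H' := by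
  induction hw with
  | base h hh => exact hle hh
  | step q Y h e hq hY hz hs he hh ih =>
    exact H'.mul_mem (H'.mul_mem ih (H'.zpow_mem (hT Y hY) e)) (hle hh)

lemma rot_mul_notMem {w Y : G} (hw : w ∈ H') (hY : S.rot Y ∉ H') : S.rot (w * Y) ∉ H' := by
  intro h
  rw [rot_mul] at h
  apply hY
  have := H'.mul_mem (H'.mul_mem (H'.inv_mem hw) h) hw
  simpa [mul_assoc] using this

/-- Seen from a foreign axis, elements of `H` and axes of `T` are all close to each other. -/
lemma Adjoinable.near' (hA : S.Adjoinable H T) (hle : H ≤ H') (hT : ∀ Y ∈ T, S.rot Y ∈ H')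
    {Y A : G} (hY : S.rot Y ∉ H') (hAT : A ∈ T) :
    ∃ h ∈ H, (S.proj Y A - S.proj Y h).natAbs ≤ S.θ :=
  hA.near A hAT Y (fun h => hY (hle h)) fun h => hY (h.rot_eq ▸ hT A hAT)

lemma Adjoinable.gap' (hA : S.Adjoinable H T) (hle : H ≤ H') (hT : ∀ Y ∈ T, S.rot Y ∈ H')
    {Y h h' : G} (hY : S.rot Y ∉ H') (hh : h ∈ H) (hh' : h' ∈ H) :
    (S.proj Y h - S.proj Y h').natAbs ≤ 2 * S.θ :=
  hA.gap Y (fun h => hY (hle h)) (fun h => hY (hT Y h)) h hh h' hh'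

lemma Adjoinable.bdd_one (hA : S.Adjoinable H T) (hH : S.Good H) {Y A : G} (hY : Y ∈ T)
    (hAT : A ∈ T) (hYA : ¬ S.Par Y A) : (S.proj Y A - S.proj Y 1).natAbs ≤ 7 * S.θ := by
  obtain ⟨h, hh, hn⟩ := hA.near A hAT Y (hA.rot_notMem Y hY) hYA
  have := hH.bdd Y (hA.rot_notMem Y hY) h hh
  omega

lemma Windmill.mul_rot (hA : S.Adjoinable H T) (hH : S.Good H) (hle : H ≤ H')
    (hT : ∀ Y ∈ T, S.rot Y ∈ H') {w A : G} (hw : S.Windmill H T H' w) (hAT : A ∈ T) {e' : ℤ}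
    (he' : e' ≠ 0) : S.Windmill H T H' (w * S.rot A ^ e') := by
  have hwm := hw.mem hle hT
  have hrwA : S.rot (w * A) ∈ H' := by
    rw [rot_mul]; exact H'.mul_mem (H'.mul_mem hwm (hT A hAT)) (H'.inv_mem hwm)
  -- a foreign axis not seen near `1` from `w * A` sees `1` near `w * A`
  have hfar : ∀ Y, S.rot Y ∉ H' → S.θ < (S.proj (w * A) 1 - S.proj (w * A) Y).natAbs →
      (S.proj Y 1 - S.proj Y (w * A)).natAbs ≤ S.θ := fun Y hY hd =>
    S.behrstock 1 (fun h => hY (h.rot_eq ▸ hrwA)) hd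
  have hfar' : ∀ Y, S.rot Y ∉ H' → ∀ x, S.θ < (S.proj (w * A) x - S.proj (w * A) Y).natAbs →
      (S.proj Y x - S.proj Y (w * A)).natAbs ≤ S.θ := fun Y hY x hd =>
    S.behrstock x (fun h => hY (h.rot_eq ▸ hrwA)) hd
  rw [← mul_one (w * S.rot A ^ e')]
  have hw' := hw
  cases hw with
  | base _ hh =>
    refine .step w A 1 e' hw' hAT ?_ ?_ he' H.one_mem
    · have := hH.bdd A (hA.rot_notMem A hAT) w⁻¹ (H.inv_mem hh)
      rw [proj_mul_left, mul_one]
      omega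
    · intro Y hY x hx
      by_cases h1 : S.θ < (S.proj (w * A) 1 - S.proj (w * A) Y).natAbs
      · exact Or.inr (hfar Y hY h1)
      · have h2 := hfar' Y hY x (by omega)
        obtain ⟨h', hh', h3⟩ := hA.near' hle hT hY (hA.mul_mem w hh A hAT)
        have h4 := hA.gap' hle hT hY hh' H.one_mem
        left; omega
  | step q Y h e hq hY hz hs he hh =>
    have hqm := hq.mem hle hT
    have hhA := hA.mul_mem h hh A hAT
    by_cases hp : S.Par Y (h * A)
    · have h1 : q * S.rot Y ^ e * h * S.rot A ^ e' * 1 = q * S.rot Y ^ (e + e') * h := by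
        have h2 := hp.rot_eq
        rw [rot_mul] at h2
        have h3 : S.rot Y ^ e' = h * S.rot A ^ e' * h⁻¹ := by rw [← h2, conj_zpow]
        rw [zpow_add, h3]
        simp [mul_assoc]
      rw [h1]
      by_cases h0 : e + e' = 0
      · simpa [h0] using hq.mul_mem hh
      · exact .step q Y h _ hq hY hz hs h0 hh
    · set Z := q * Y with hZ
      set γ := q * S.rot Y ^ e with hγ
      set Z' := γ * h * A with hZ'
      have hγm : γ ∈ H' := H'.mul_mem hqm (H'.zpow_mem (hT Y hY) e)
      have eZ' : Z' = γ * (h * A) := by simp [hZ', mul_assoc]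
      have eZ : Z = γ * (Y * S.g ^ (-(S.len * e : ℤ))) := by
        have := S.rot_zpow_mul Y (-e)
        rw [mul_neg] at this
        rw [← this, hγ, hZ]
        simp [mul_assoc]
      have hYg := hA.zpow_mem Y hY (-(S.len * e : ℤ))
      have hpar : ¬ S.Par Z Z' := by
        rw [eZ, eZ', par_mul]
        exact fun h => hp ((S.par_mul_zpow Y _).trans h)
      have h1 : S.proj Z Z' = S.proj Y (h * A) + S.len * e := by
        rw [eZ', hγ, hZ, mul_assoc, proj_mul, proj_rot]
      have h2 := hA.bdd_one hH hY hhA hp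
      have h3 : 5 * S.θ < (S.proj Z 1 - S.proj Z Z').natAbs := by
        have h5 : (S.len : ℤ) ≤ (S.len * e).natAbs := by
          rw [Int.natAbs_mul]
          have : 1 ≤ e.natAbs := Int.natAbs_pos.2 he
          simp only [Int.natAbs_natCast]
          exact_mod_cast Nat.le_mul_of_pos_right _ this
        have h6 : S.len = 20 * S.θ + 1 := rfl
        rw [h1]
        generalize (S.len * e : ℤ) = t at *
        omega
      have h4 : (S.proj Z' 1 - S.proj Z' Z).natAbs ≤ S.θ := S.behrstock 1 hpar (by omega)
      refine .step _ A 1 e' hw' hAT ?_ ?_ he' H.one_mem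
      · have hmem := hA.mul_mem _ (H.inv_mem hh) _ hYg
        have h5 : S.proj Z' Z = S.proj A (h⁻¹ * (Y * S.g ^ (-(S.len * e : ℤ)))) := by
          rw [eZ', eZ, proj_mul, proj_mul_left]
        have h6 := hA.bdd_one hH hAT hmem (fun h' => hpar <| by
          rw [eZ, eZ', par_mul]
          have := ((S.par_mul h _ _).2 h').symm
          simpa [mul_assoc] using this)
        change (S.proj Z' 1 - S.proj A 1).natAbs ≤ 8 * S.θ
        omega
      · intro Y' hY' x hx
        change 2 * S.θ < (S.proj Z' 1 - S.proj Z' x).natAbs at hx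
        by_cases h5 : S.θ < (S.proj Z' 1 - S.proj Z' Y').natAbs
        · exact Or.inr (hfar Y' hY' h5)
        · have h6 : (S.proj Y' x - S.proj Y' Z').natAbs ≤ S.θ := hfar' Y' hY' x (by omega)
          have h7 := S.behrstock (Y := Z') (A := Z) x (fun h => hpar h.symm) (by omega)
          rcases hs Y' hY' x (by omega) with h8 | h8
          · exact Or.inl h8
          · have hY'' := rot_mul_notMem (H'.inv_mem hγm) hY'
            obtain ⟨a, ha, ha'⟩ := hA.near' hle hT hY'' hYg
            obtain ⟨b, hb, hb'⟩ := hA.near' hle hT hY'' hhA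
            have hab := hA.gap' hle hT hY'' ha hb
            have e1 : S.proj (γ⁻¹ * Y') (Y * S.g ^ (-(S.len * e : ℤ))) = S.proj Y' Z := by
              rw [proj_mul_left, inv_inv, ← eZ]
            have e2 : S.proj (γ⁻¹ * Y') (h * A) = S.proj Y' Z' := by
              rw [proj_mul_left, inv_inv, ← eZ']
            left; omega

lemma Adjoinable.good (hA : S.Adjoinable H T) (hH : S.Good H) :
    S.Good (H ⊔ Subgroup.closure (S.rot '' T)) := by
  set H' := H ⊔ Subgroup.closure (S.rot '' T) with hH'
  have hle : H ≤ H' := le_sup_left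
  have hT : ∀ Y ∈ T, S.rot Y ∈ H' := fun Y hY =>
    (le_sup_right : _ ≤ H') (Subgroup.subset_closure ⟨Y, hY, rfl⟩)
  have key : ∀ w ∈ H', S.Windmill H T H' w := by
    intro w hw
    have hcl : H' = Subgroup.closure (H ∪ S.rot '' T) := by
      rw [Subgroup.closure_union, Subgroup.closure_eq]
    have hw' := hcl ▸ hw
    induction hw' using Subgroup.closure_induction_right with
    | one => exact .base 1 H.one_mem
    | mul_right x hx y hy ih =>
      specialize ih (hcl ▸ hx)
      rcases hy with hy | ⟨Y, hY, rfl⟩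
      · exact ih.mul_mem hy
      · simpa using ih.mul_rot hA hH hle hT hY one_ne_zero
    | mul_inv_cancel x hx y hy ih =>
      specialize ih (hcl ▸ hx)
      rcases hy with hy | ⟨Y, hY, rfl⟩
      · exact ih.mul_mem (H.inv_mem hy)
      · simpa using ih.mul_rot hA hH hle hT hY (e' := -1) (by norm_num)
  have hfar : ∀ q Y h : G, ∀ e : ℤ, Y ∈ T → h ∈ H → e ≠ 0 →
      (S.proj (q * Y) 1 - S.proj Y 1).natAbs ≤ 8 * S.θ →
      2 * S.θ < (S.proj (q * Y) 1 - S.proj (q * Y) (q * S.rot Y ^ e * h)).natAbs := by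
    intro q Y h e hY hh he hz
    have h1 := hH.bdd Y (hA.rot_notMem Y hY) h hh
    rw [mul_assoc q, proj_mul, proj_rot]
    have h5 : (S.len : ℤ) ≤ (S.len * e).natAbs := by
      rw [Int.natAbs_mul]
      have : 1 ≤ e.natAbs := Int.natAbs_pos.2 he
      simp only [Int.natAbs_natCast]
      exact_mod_cast Nat.le_mul_of_pos_right _ this
    have h6 : S.len = 20 * S.θ + 1 := rfl
    generalize (S.len * e : ℤ) = t at *
    omega
  refine ⟨fun w hw hw1 => ?_, fun Y' hY' w hw => ?_⟩
  · cases key w hw with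
    | base _ hh => exact hH.exists_ne w hh hw1
    | step q Y h e hq hY hz hs he hh =>
      have := hfar q Y h e hY hh he hz
      exact ⟨q * Y, fun h => by omega⟩
  · cases key w hw with
    | base _ hh => exact hH.bdd Y' (fun h => hY' (hle h)) w hh
    | step q Y h e hq hY hz hs he hh =>
      rcases hs Y' hY' _ (hfar q Y h e hY hh he hz) with h1 | h1
      · exact h1
      · have hγm : q * S.rot Y ^ e ∈ H' :=
          H'.mul_mem (hq.mem hle hT) (H'.zpow_mem (hT Y hY) e)
        set γ := q * S.rot Y ^ e with hγ
        have eZ : q * Y = γ * (Y * S.g ^ (-(S.len * e : ℤ))) := by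
          have := S.rot_zpow_mul Y (-e)
          rw [mul_neg] at this
          rw [← this, hγ]
          simp [mul_assoc]
        have hYg := hA.zpow_mem Y hY (-(S.len * e : ℤ))
        have hY'' := rot_mul_notMem (H'.inv_mem hγm) hY'
        obtain ⟨a, ha, ha'⟩ := hA.near' hle hT hY'' hYg
        have hab := hA.gap' hle hT hY'' ha hh
        rw [proj_mul_left, inv_inv, ← eZ] at ha'
        rw [proj_mul_left, proj_mul_left, inv_inv] at hab
        rw [proj_mul_left, inv_inv] at ha'
        omega

variable (S)

lemma good_bot : S.Good ⊥ :=
  ⟨fun h hh h1 => absurd (Subgroup.mem_bot.1 hh) h1, fun Y _ h hh => by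
    rw [Subgroup.mem_bot.1 hh]; simp⟩

lemma exists_good_rot_mem [WellFoundedLT Ω] : ∃ H, S.Good H ∧ ∀ Y, S.rot Y ∈ H := by
  obtain ⟨H, -, hmax⟩ := zorn_le_nonempty₀ {H | S.Good H} (by
    intro C hC hchain y hy
    have hdir : DirectedOn (· ≤ ·) C := hchain.directedOn
    refine ⟨sSup C, ⟨?_, ?_⟩, fun z hz => le_sSup hz⟩
    · intro h hh h1
      obtain ⟨K, hK, hhK⟩ := (Subgroup.mem_sSup_of_directedOn ⟨y, hy⟩ hdir).1 hh
      exact (hC hK).exists_ne h hhK h1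
    · intro Y hY h hh
      obtain ⟨K, hK, hhK⟩ := (Subgroup.mem_sSup_of_directedOn ⟨y, hy⟩ hdir).1 hh
      exact (hC hK).bdd Y (fun h' => hY ((le_sSup hK : K ≤ _) h')) h hhK) ⊥ S.good_bot
  refine ⟨H, hmax.1, ?_⟩
  by_contra! hY
  obtain ⟨T, ⟨A, hAT⟩, hA⟩ := S.exists_adjoinable hY
  have := hmax.2 (hA.good hmax.1) le_sup_left
  exact hA.rot_notMem A hAT
    (this ((le_sup_right : _ ≤ H ⊔ _) (Subgroup.subset_closure ⟨A, hAT, rfl⟩)))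

theorem exists_ne_of_mem_normalClosure [WellFoundedLT Ω] {h : G}
    (hh : h ∈ Subgroup.normalClosure {S.g ^ S.len}) (h1 : h ≠ 1) :
    ∃ Z, S.c Z ≠ S.c (h⁻¹ * Z) := by
  obtain ⟨H, hH, hrot⟩ := S.exists_good_rot_mem
  have hle : Subgroup.normalClosure {S.g ^ S.len} ≤ H := by
    rw [Subgroup.normalClosure, Subgroup.closure_le]
    intro x hx
    obtain ⟨a, ha, hc⟩ := Group.mem_conjugatesOfSet_iff.1 hx
    obtain ⟨Y, rfl⟩ := isConj_iff.1 hc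
    rw [Set.mem_singleton_iff.1 ha]
    exact hrot Y
  obtain ⟨Z, hZ⟩ := hH.exists_ne h (hle hh) h1
  exact ⟨Z, by simpa [proj] using hZ⟩

end AxisSystem

namespace SpecialTame

section Degree

variable {k : Type} [Field k]

/-- Degree functions on `k[x₁,x₂,x₃]`. -/
structure IsDegree (D : MvPolynomial (Fin 3) k → ℕ) : Prop where
  add_le : ∀ p q, D (p + q) ≤ max (D p) (D q)
  mul : ∀ {p q}, p ≠ 0 → q ≠ 0 → D (p * q) = D p + D q
  C : ∀ a, D (C a) = 0

lemma isDegree_totalDegree : IsDegree (totalDegree : MvPolynomial (Fin 3) k → ℕ) :=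
  ⟨totalDegree_add, totalDegree_mul_of_isDomain, totalDegree_C⟩

lemma isDegree_degreeOf (i : Fin 3) : IsDegree (degreeOf i : MvPolynomial (Fin 3) k → ℕ) :=
  ⟨degreeOf_add_le i, degreeOf_mul_eq, fun a => degreeOf_C a i⟩

namespace IsDegree

variable {D : MvPolynomial (Fin 3) k → ℕ} (hD : IsDegree D)

include hD

lemma comp (φ : Aut3 k) : IsDegree fun p => D (φ p) where
  add_le p q := by simpa using hD.add_le (φ p) (φ q)
  mul hp hq := by
    simpa using hD.mul (φ.map_ne_zero_iff.2 hp) (φ.map_ne_zero_iff.2 hq)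
  C a := by
    have : φ (MvPolynomial.C a) = MvPolynomial.C a := φ.commutes a
    rw [this, hD.C]

lemma zero : D 0 = 0 := by simpa using hD.C 0

lemma one : D 1 = 0 := by simpa using hD.C 1

lemma mul_le (p q) : D (p * q) ≤ D p + D q := by
  by_cases hp : p = 0
  · simp [hp, hD.zero]
  by_cases hq : q = 0
  · simp [hq, hD.zero]
  exact (hD.mul hp hq).le

lemma neg (p) : D (-p) = D p := by
  by_cases hp : p = 0
  · simp [hp]
  have h := hD.mul (p := MvPolynomial.C (-1)) (q := p) (by simp) hp
  rwa [hD.C, zero_add, map_neg, map_one, neg_one_mul] at h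

lemma sub_le (p q) : D (p - q) ≤ max (D p) (D q) := by
  rw [sub_eq_add_neg, ← hD.neg q]; exact hD.add_le _ _

lemma C_mul {a : k} (ha : a ≠ 0) (p) : D (MvPolynomial.C a * p) = D p := by
  by_cases hp : p = 0
  · simp [hp]
  rw [hD.mul (by simpa using ha) hp, hD.C, zero_add]

lemma C_mul_le (a : k) (p) : D (MvPolynomial.C a * p) ≤ D p := by
  simpa [hD.C] using hD.mul_le (MvPolynomial.C a) p

lemma pow (p) (n : ℕ) : D (p ^ n) = n * D p := by
  by_cases hp : p = 0
  · cases n <;> simp [hp, hD.zero, hD.one]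
  induction n with
  | zero => simp [hD.one]
  | succ n ih => rw [pow_succ, hD.mul (pow_ne_zero _ hp) hp, ih]; ring

lemma sum_le {ι : Type*} (s : Finset ι) (f : ι → MvPolynomial (Fin 3) k) {b : ℕ}
    (h : ∀ i ∈ s, D (f i) ≤ b) : D (∑ i ∈ s, f i) ≤ b := by
  classical
  induction s using Finset.induction_on with
  | empty => simp [hD.zero]
  | insert a s ha ih =>
    rw [Finset.sum_insert ha]
    exact (hD.add_le _ _).trans (max_le (h a (by simp)) (ih fun i hi => h i (by simp [hi])))

lemma add_eq_of_lt {p q} (h : D p < D q) : D (p + q) = D q := by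
  apply le_antisymm ((hD.add_le p q).trans (max_le h.le le_rfl))
  have := hD.sub_le (p + q) p
  rw [add_sub_cancel_left] at this
  rcases le_max_iff.1 this with h' | h'
  · exact h'
  · exact absurd h' (not_le.2 h)

lemma add_C (p) (a : k) : D (p + MvPolynomial.C a) = D p := by
  apply le_antisymm
  · simpa [hD.C] using hD.add_le p (MvPolynomial.C a)
  · have := hD.sub_le (p + MvPolynomial.C a) (MvPolynomial.C a)
    simpa [hD.C] using this

/-- The degree of `a y + b`, `a ≠ 0`. -/
lemma affine {a : k} (ha : a ≠ 0) (b : k) (p) :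
    D (MvPolynomial.C a * p + MvPolynomial.C b) = D p := by
  rw [hD.add_C, hD.C_mul ha]

lemma unit_mul {u} (hu : IsUnit u) (p) : D (u * p) = D p := by
  obtain ⟨r, hr, rfl⟩ := isUnit_iff_eq_C_of_isReduced.1 hu
  exact hD.C_mul hr.ne_zero p

end IsDegree

lemma degreeOf_pderiv_le (i j : Fin 3) (f : MvPolynomial (Fin 3) k) :
    degreeOf i (pderiv j f) ≤ degreeOf i f := by
  rw [degreeOf_le_iff]
  intro m hm
  have h : coeff (m + Finsupp.single j 1) f ≠ 0 := by
    intro h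
    rw [mem_support_iff, coeff_pderiv, h, zero_mul] at hm
    exact hm rfl
  have := monomial_le_degreeOf i (mem_support_iff.2 h)
  simp only [Finsupp.add_apply] at this
  omega

lemma totalDegree_pderiv_le (j : Fin 3) (f : MvPolynomial (Fin 3) k) :
    totalDegree (pderiv j f) ≤ totalDegree f := by
  refine Finset.sup_le fun m hm => ?_
  have h : coeff (m + Finsupp.single j 1) f ≠ 0 := by
    intro h
    rw [mem_support_iff, coeff_pderiv, h, zero_mul] at hm
    exact hm rfl
  have := le_totalDegree (mem_support_iff.2 h)
  rw [Finsupp.sum_add_index' (by simp) (by simp)] at this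
  exact le_trans (Nat.le_add_right _ _) this

variable [CharZero k]

lemma pderiv_eq_zero_iff {i : Fin 3} {f : MvPolynomial (Fin 3) k} :
    pderiv i f = 0 ↔ degreeOf i f = 0 := by
  constructor
  · intro h
    rw [← Nat.le_zero, degreeOf_le_iff]
    intro m hm
    by_contra hmi
    have h1 := coeff_pderiv (i := i) f (m - Finsupp.single i 1)
    have h2 : m - Finsupp.single i 1 + Finsupp.single i 1 = m :=
      tsub_add_cancel_of_le (by simpa using by omega)
    rw [h, h2, coeff_zero, eq_comm, mul_eq_zero] at h1
    rcases h1 with h1 | h1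
    · exact (mem_support_iff.1 hm) h1
    · norm_cast at h1
  · intro h
    apply pderiv_eq_zero_of_notMem_vars
    intro hi
    classical
    rw [vars_def, Multiset.mem_toFinset, ← Multiset.one_le_count_iff_mem, ← degreeOf_def, h] at hi
    omega

lemma degreeOf_pderiv_self (i : Fin 3) (f : MvPolynomial (Fin 3) k) :
    degreeOf i (pderiv i f) = degreeOf i f - 1 := by
  by_cases h0 : degreeOf i f = 0
  · rw [pderiv_eq_zero_iff.2 h0, h0, degreeOf_zero]
  have hpos : 0 < degreeOf i f := Nat.pos_of_ne_zero h0
  apply le_antisymm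
  · rw [degreeOf_le_iff]
    intro m hm
    have h : coeff (m + Finsupp.single i 1) f ≠ 0 := by
      intro h
      rw [mem_support_iff, coeff_pderiv, h, zero_mul] at hm
      exact hm rfl
    have := monomial_le_degreeOf i (mem_support_iff.2 h)
    simp only [Finsupp.add_apply, Finsupp.single_eq_same] at this
    omega
  · obtain ⟨m, hm, hmi⟩ : ∃ m ∈ f.support, degreeOf i f ≤ m i := by
      by_contra! h
      exact lt_irrefl _ ((degreeOf_lt_iff hpos).2 h)
    have h2 : m - Finsupp.single i 1 + Finsupp.single i 1 = m :=
      tsub_add_cancel_of_le (by simpa using by omega)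
    have h1 : m - Finsupp.single i 1 ∈ (pderiv i f).support := by
      rw [mem_support_iff, coeff_pderiv, h2]
      refine mul_ne_zero (mem_support_iff.1 hm) ?_
      norm_cast
    have := monomial_le_degreeOf i h1
    simp only [Finsupp.tsub_apply, Finsupp.single_eq_same] at this
    omega

end Degree

section Jacobian

variable {k : Type} [Field k]

lemma map_C (φ : Aut3 k) (a : k) : φ (C a) = C a := φ.commutes a

/-- The chain rule. -/
lemma pderiv_map (φ : Aut3 k) (j : Fin 3) (f : MvPolynomial (Fin 3) k) :
    pderiv j (φ f) = ∑ i, φ (pderiv i f) * pderiv j (φ (X i)) := by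
  induction f using MvPolynomial.induction_on with
  | C a => simp [map_C]
  | add p q hp hq => simp [hp, hq, Finset.sum_add_distrib, add_mul]
  | mul_X p n hp =>
    simp only [map_mul, pderiv_mul, hp, pderiv_X, map_add, add_mul, Finset.sum_add_distrib]
    rw [Finset.sum_mul]
    congr 1
    · exact Finset.sum_congr rfl fun i _ => by ring
    · rw [Finset.sum_eq_single n]
      · simp
      · intro b _ hb
        simp [Pi.single_eq_of_ne hb.symm]
      · simp

lemma jacDet_mul (σ τ : Aut3 k) : jacDet k (σ * τ) = σ (jacDet k τ) * jacDet k σ := by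
  unfold jacDet
  have : (Matrix.of fun i j => pderiv j ((σ * τ) (X i))) =
      (σ : MvPolynomial (Fin 3) k →+* MvPolynomial (Fin 3) k).mapMatrix
        (Matrix.of fun i j => pderiv j (τ (X i))) * Matrix.of fun i j => pderiv j (σ (X i)) := by
    ext1 i j
    simp [Matrix.mul_apply, AlgEquiv.mul_apply, pderiv_map σ j (τ (X i))]
  rw [this, Matrix.det_mul, ← RingHom.map_det]
  rfl

lemma jacDet_one : jacDet k 1 = 1 := by
  unfold jacDet
  rw [← Matrix.det_one (n := Fin 3)]
  congr 1
  ext1 i j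
  simp [pderiv_X, Matrix.one_apply, Pi.single_apply]

lemma isUnit_jacDet (φ : Aut3 k) : IsUnit (jacDet k φ) := by
  have := jacDet_mul φ φ⁻¹
  rw [mul_inv_cancel, jacDet_one] at this
  exact .of_mul_eq_one _ (by rw [mul_comm]; exact this.symm)

/-- The `(a, b)` minor of the Jacobian matrix of `(p, q)`. -/
noncomputable def wedge (a b : Fin 3) (p q : MvPolynomial (Fin 3) k) : MvPolynomial (Fin 3) k :=
  pderiv a p * pderiv b q - pderiv b p * pderiv a q

lemma jacDet_eq (φ : Aut3 k) : jacDet k φ =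
    pderiv 0 (φ (X 0)) * wedge 1 2 (φ (X 1)) (φ (X 2)) -
    pderiv 1 (φ (X 0)) * wedge 0 2 (φ (X 1)) (φ (X 2)) +
    pderiv 2 (φ (X 0)) * wedge 0 1 (φ (X 1)) (φ (X 2)) := by
  simp only [jacDet, Matrix.det_fin_three, Matrix.of_apply, wedge]
  ring

/-- The derivative along `φ (X 1)` as a Jacobian determinant. -/
lemma jac_pderiv_one (φ : Aut3 k) (f : MvPolynomial (Fin 3) k) :
    jacDet k φ * φ (pderiv 1 f) =
    -(pderiv 0 (φ f) * wedge 1 2 (φ (X 0)) (φ (X 2)) -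
    pderiv 1 (φ f) * wedge 0 2 (φ (X 0)) (φ (X 2)) +
    pderiv 2 (φ f) * wedge 0 1 (φ (X 0)) (φ (X 2))) := by
  simp only [pderiv_map φ _ f, Fin.sum_univ_three, jacDet, Matrix.det_fin_three, Matrix.of_apply,
    wedge]
  ring

end Jacobian

section Automorphisms

variable {k : Type} [Field k]

lemma IsDegree.le_of_support {D : MvPolynomial (Fin 3) k → ℕ} (hD : IsDegree D)
    {f : MvPolynomial (Fin 3) k} {b : ℕ}
    (h : ∀ m ∈ f.support, m 0 * D (X 0) + m 1 * D (X 1) + m 2 * D (X 2) ≤ b) : D f ≤ b := by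
  rw [f.as_sum]
  refine hD.sum_le _ _ fun m hm => le_trans ?_ (h m hm)
  rw [monomial_eq]
  refine (hD.C_mul_le _ _).trans ?_
  rw [Finsupp.prod_fintype _ _ (by simp), Fin.prod_univ_three]
  refine (hD.mul_le _ _).trans (add_le_add ((hD.mul_le _ _).trans ?_) ?_) <;> simp [hD.pow]

/-- The automorphism exchanging `x₁` and `x₂`. -/
noncomputable def swapAut (k : Type) [Field k] : Aut3 k := renameEquiv k (Equiv.swap 0 1)

@[simp] lemma swapAut_X0 : swapAut k (X 0) = X 1 := by simp [swapAut]
@[simp] lemma swapAut_X1 : swapAut k (X 1) = X 0 := by simp [swapAut]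
@[simp] lemma swapAut_X2 : swapAut k (X 2) = X 2 := by
  simp [swapAut, Equiv.swap_apply_of_ne_of_ne]

lemma aut_ext {φ ψ : Aut3 k} (h0 : φ (X 0) = ψ (X 0)) (h1 : φ (X 1) = ψ (X 1))
    (h2 : φ (X 2) = ψ (X 2)) : φ = ψ := by
  apply AlgEquiv.coe_toAlgHom_injective
  apply MvPolynomial.algHom_ext
  intro i
  fin_cases i
  · exact h0
  · exact h1
  · exact h2

@[simp] lemma swapAut_mul_self : swapAut k * swapAut k = 1 := by
  apply aut_ext <;> simp

@[simp] lemma swapAut_inv : (swapAut k)⁻¹ = swapAut k :=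
  inv_eq_of_mul_eq_one_left swapAut_mul_self

@[simp] lemma swapAut_swapAut (f) : swapAut k (swapAut k f) = f := by
  rw [← AlgEquiv.mul_apply, swapAut_mul_self, AlgEquiv.one_apply]

@[simp] lemma degreeOf_zero_swapAut (f) : degreeOf 0 (swapAut k f) = degreeOf 1 f := by
  have := degreeOf_rename_of_injective (p := f) (Equiv.swap (0 : Fin 3) 1).injective 1
  rwa [Equiv.swap_apply_right] at this

@[simp] lemma degreeOf_one_swapAut (f) : degreeOf 1 (swapAut k f) = degreeOf 0 f := by
  have := degreeOf_rename_of_injective (p := f) (Equiv.swap (0 : Fin 3) 1).injective 0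
  rwa [Equiv.swap_apply_left] at this

/-- The right-hand side of the Hénon recursion. -/
noncomputable def henon (y t : MvPolynomial (Fin 3) k) : MvPolynomial (Fin 3) k :=
  t ^ 7 * (y ^ 4 + y ^ 3)

lemma map_henon (φ : Aut3 k) (y t) : φ (henon y t) = henon (φ y) (φ t) := by simp [henon]

/-- The involution `x₁ ↦ x₃⁷ (x₂⁴ + x₂³) - x₁`, as an algebra homomorphism. -/
noncomputable def flipHom (k : Type) [Field k] :
    MvPolynomial (Fin 3) k →ₐ[k] MvPolynomial (Fin 3) k :=
  aeval ![henon (X 1) (X 2) - X 0, X 1, X 2]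

lemma flipHom_comp : (flipHom k).comp (flipHom k) = AlgHom.id k _ := by
  apply MvPolynomial.algHom_ext
  intro i
  fin_cases i <;> simp [flipHom, henon]

/-- The involution `x₁ ↦ x₃⁷ (x₂⁴ + x₂³) - x₁`. -/
noncomputable def flipAut (k : Type) [Field k] : Aut3 k :=
  AlgEquiv.ofAlgHom (flipHom k) (flipHom k) flipHom_comp flipHom_comp

@[simp] lemma flipAut_X0 : flipAut k (X 0) = henon (X 1) (X 2) - X 0 := by
  simp [flipAut, flipHom]
@[simp] lemma flipAut_X1 : flipAut k (X 1) = X 1 := by simp [flipAut, flipHom]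
@[simp] lemma flipAut_X2 : flipAut k (X 2) = X 2 := by simp [flipAut, flipHom]

@[simp] lemma flipAut_mul_self : flipAut k * flipAut k = 1 := by
  apply aut_ext <;> simp [map_henon]

@[simp] lemma flipAut_inv : (flipAut k)⁻¹ = flipAut k :=
  inv_eq_of_mul_eq_one_left flipAut_mul_self

@[simp] lemma flipAut_flipAut (f) : flipAut k (flipAut k f) = f := by
  rw [← AlgEquiv.mul_apply, flipAut_mul_self, AlgEquiv.one_apply]

@[simp] lemma degreeOf_zero_flipAut (f) : degreeOf 0 (flipAut k f) = degreeOf 0 f := by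
  have key : ∀ f, degreeOf 0 (flipAut k f) ≤ degreeOf 0 f := by
    intro f
    have hD := isDegree_degreeOf (k := k) 0
    refine (hD.comp (flipAut k)).le_of_support fun m hm => ?_
    have h0 : degreeOf 0 (flipAut k (X 0)) ≤ 1 := by
      rw [flipAut_X0]
      refine (hD.sub_le _ _).trans (max_le ?_ (by simp))
      refine (hD.mul_le _ _).trans ?_
      have := hD.add_le (X 1 ^ 4 : MvPolynomial (Fin 3) k) (X 1 ^ 3)
      simp only [hD.pow, degreeOf_X_of_ne (show (0 : Fin 3) ≠ 1 by decide)] at this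
      rw [hD.pow, degreeOf_X_of_ne (show (0 : Fin 3) ≠ 2 by decide)]
      omega
    have h1 : degreeOf 0 (X 1 : MvPolynomial (Fin 3) k) = 0 := degreeOf_X_of_ne (by decide)
    have h2 : degreeOf 0 (X 2 : MvPolynomial (Fin 3) k) = 0 := degreeOf_X_of_ne (by decide)
    simp only [flipAut_X1, flipAut_X2, h1, h2]
    have := monomial_le_degreeOf 0 hm
    nlinarith
  apply le_antisymm (key f)
  simpa using key (flipAut k f)

/-- The Hénon automorphism `x₁ ↦ x₃⁷ (x₁⁴ + x₁³) - x₂`, `x₂ ↦ x₁`. -/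
noncomputable def henonAut (k : Type) [Field k] : Aut3 k := swapAut k * flipAut k

lemma henonAut_inv : (henonAut k)⁻¹ = flipAut k * swapAut k := by simp [henonAut]

@[simp] lemma henonAut_X1 : henonAut k (X 1) = X 0 := by simp [henonAut]
@[simp] lemma henonAut_X2 : henonAut k (X 2) = X 2 := by simp [henonAut]
@[simp] lemma henonAut_inv_X1 : (henonAut k)⁻¹ (X 1) = henon (X 1) (X 2) - X 0 := by
  simp [henonAut_inv]
@[simp] lemma henonAut_inv_X2 : (henonAut k)⁻¹ (X 2) = X 2 := by simp [henonAut_inv]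

lemma degreeOf_zero_henonAut_inv (f) : degreeOf 0 ((henonAut k)⁻¹ f) = degreeOf 1 f := by
  simp [henonAut_inv]

@[simp] lemma henonAut_zpow_X2 (i : ℤ) : (henonAut k ^ i) (X 2) = X 2 := by
  induction i with
  | zero => simp
  | succ n ih => rw [zpow_add_one, AlgEquiv.mul_apply, henonAut_X2, ih]
  | pred n ih => rw [zpow_sub_one, AlgEquiv.mul_apply, henonAut_inv_X2, ih]

lemma jacDet_swapAut : jacDet k (swapAut k) = -1 := by
  simp [jacDet, Matrix.det_fin_three, pderiv_X]

lemma jacDet_flipAut : jacDet k (flipAut k) = -1 := by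
  simp [jacDet, Matrix.det_fin_three, pderiv_X, henon]

lemma jacDet_henonAut : jacDet k (henonAut k) = 1 := by
  rw [henonAut, jacDet_mul, jacDet_swapAut, jacDet_flipAut]; simp

lemma jacDet_henonAut_zpow (i : ℤ) : jacDet k (henonAut k ^ i) = 1 := by
  have hinv : jacDet k (henonAut k)⁻¹ = 1 := by
    rw [henonAut_inv, jacDet_mul, jacDet_swapAut, jacDet_flipAut]; simp
  induction i with
  | zero => simp [jacDet_one]
  | succ n ih => rw [zpow_add_one, jacDet_mul, jacDet_henonAut, ih]; simp
  | pred n ih => rw [zpow_sub_one, jacDet_mul, hinv, ih]; simp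

end Automorphisms

section WedgeDegree

variable {k : Type} [Field k]

/-- The degree of `dp ∧ dq`. -/
noncomputable def wdeg (p q : MvPolynomial (Fin 3) k) : ℕ :=
  Finset.univ.sup fun ab : Fin 3 × Fin 3 => totalDegree (wedge ab.1 ab.2 p q)

lemma le_wdeg (a b : Fin 3) (p q : MvPolynomial (Fin 3) k) :
    totalDegree (wedge a b p q) ≤ wdeg p q := by
  have h := Finset.le_sup (f := fun ab : Fin 3 × Fin 3 => totalDegree (wedge ab.1 ab.2 p q))
    (Finset.mem_univ (a, b))
  rwa [← wdeg] at h

lemma totalDegree_wedge_le (a b : Fin 3) (p q : MvPolynomial (Fin 3) k) :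
    totalDegree (wedge a b p q) ≤ totalDegree p + totalDegree q := by
  have hD := isDegree_totalDegree (k := k)
  have key : ∀ a b : Fin 3, totalDegree (pderiv a p * pderiv b q) ≤
      totalDegree p + totalDegree q := fun a b =>
    (hD.mul_le _ _).trans (add_le_add (totalDegree_pderiv_le a p) (totalDegree_pderiv_le b q))
  exact (hD.sub_le _ _).trans (max_le (key a b) (key b a))

lemma exists_totalDegree_eq_wdeg {p q : MvPolynomial (Fin 3) k}
    (h : ∃ a b, wedge a b p q ≠ 0) :
    ∃ a b, wedge a b p q ≠ 0 ∧ totalDegree (wedge a b p q) = wdeg p q := by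
  obtain ⟨⟨a, b⟩, -, hab⟩ := Finset.exists_mem_eq_sup Finset.univ ⟨(0, 0), Finset.mem_univ _⟩
    fun ab : Fin 3 × Fin 3 => totalDegree (wedge ab.1 ab.2 p q)
  change wdeg p q = _ at hab
  by_cases h0 : wedge a b p q = 0
  · obtain ⟨a', b', h'⟩ := h
    refine ⟨a', b', h', le_antisymm (le_wdeg _ _ _ _) ?_⟩
    simp [hab, h0]
  · exact ⟨a, b, h0, hab.symm⟩

lemma exists_wedge_ne_zero (φ : Aut3 k) : ∃ a b, wedge a b (φ (X 2)) (φ (X 1)) ≠ 0 := by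
  by_contra! h
  have h' : ∀ a b, wedge a b (φ (X 1)) (φ (X 2)) = 0 := fun a b => by
    rw [← neg_eq_zero, ← h a b]; simp only [wedge]; ring
  have := (isUnit_jacDet φ).ne_zero
  rw [jacDet_eq, h', h', h'] at this
  simp at this

/-- The degree of `d(φ x₃) ∧ d(φ x₂)`. -/
noncomputable def kdeg (φ : Aut3 k) : ℕ := wdeg (φ (X 2)) (φ (X 1))

lemma totalDegree_map_X_pos (φ : Aut3 k) (i : Fin 3) : 0 < totalDegree (φ (X i)) := by
  by_contra h
  have h1 : φ (X i) = φ (MvPolynomial.C ((φ (X i)).coeff 0)) := by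
    rw [map_C]; exact totalDegree_eq_zero_iff_eq_C.1 (Nat.eq_zero_of_not_pos h)
  have h2 := congrArg totalDegree (φ.injective h1)
  simp at h2

variable [CharZero k]

lemma kdeg_rec (φ : Aut3 k) :
    7 * totalDegree (φ (X 2)) + 3 * totalDegree (φ (X 1)) + kdeg φ ≤
      max (kdeg (φ * henonAut k)) (kdeg (φ * (henonAut k)⁻¹)) := by
  have hD := (isDegree_totalDegree (k := k)).comp φ
  obtain ⟨a, b, hne, hab⟩ := exists_totalDegree_eq_wdeg (exists_wedge_ne_zero φ)
  have hY : (X 1 : MvPolynomial (Fin 3) k) ≠ 0 := X_ne_zero _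
  have hT : (X 2 : MvPolynomial (Fin 3) k) ≠ 0 := X_ne_zero _
  have h4 : (4 : k) ≠ 0 := by norm_num
  have hl : totalDegree (φ (C 4 * X 1 + C 3)) = totalDegree (φ (X 1)) := hD.affine h4 3 _
  have hpos := totalDegree_map_X_pos φ 1
  have hl0 : (C 4 * X 1 + C 3 : MvPolynomial (Fin 3) k) ≠ 0 := by
    intro h
    rw [h] at hl
    simp at hl
    omega
  set r : MvPolynomial (Fin 3) k := X 2 ^ 7 * (X 1 ^ 2 * (C 4 * X 1 + C 3)) with hr
  have hr0 : r ≠ 0 := mul_ne_zero (pow_ne_zero _ hT) (mul_ne_zero (pow_ne_zero _ hY) hl0)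
  have hrd : totalDegree (φ r) = 7 * totalDegree (φ (X 2)) + 3 * totalDegree (φ (X 1)) := by
    have e1 := hD.mul (pow_ne_zero 7 hT) (mul_ne_zero (pow_ne_zero 2 hY) hl0)
    have e2 := hD.mul (pow_ne_zero 2 hY) hl0
    have e3 := hD.pow (X 2) 7
    have e4 := hD.pow (X 1) 2
    rw [hr]
    omega
  have key : wedge a b (φ (X 2)) ((φ * henonAut k) (X 1)) +
      wedge a b (φ (X 2)) ((φ * (henonAut k)⁻¹) (X 1)) =
      φ r * wedge a b (φ (X 2)) (φ (X 1)) := by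
    simp only [AlgEquiv.mul_apply, henonAut_X1, henonAut_inv_X1, hr, map_sub, wedge,
      henon, map_mul, map_pow, map_add, Derivation.leibniz, Derivation.leibniz_pow,
      smul_eq_mul, nsmul_eq_mul, map_ofNat]
    norm_num
    ring
  have h1 : totalDegree (φ r * wedge a b (φ (X 2)) (φ (X 1))) =
      totalDegree (φ r) + kdeg φ := by
    rw [totalDegree_mul_of_isDomain ((map_ne_zero_iff φ φ.injective).2 hr0) hne, hab, kdeg]
  rw [← hrd, ← h1, ← key]
  refine (totalDegree_add _ _).trans (max_le_max ?_ ?_)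
  · have := le_wdeg a b (φ (X 2)) ((φ * henonAut k) (X 1))
    simpa [kdeg] using this
  · have := le_wdeg a b (φ (X 2)) ((φ * (henonAut k)⁻¹) (X 1))
    simpa [kdeg] using this

/-- The degree grows in the forward direction. -/
def Fwd (φ : Aut3 k) : Prop := kdeg (φ * (henonAut k)⁻¹) ≤ kdeg (φ * henonAut k)

lemma Fwd.rec' {φ : Aut3 k} (h : Fwd φ) :
    7 * totalDegree (φ (X 2)) + 3 * totalDegree (φ (X 1)) + kdeg φ ≤ kdeg (φ * henonAut k) := by
  have := kdeg_rec φ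
  rwa [max_eq_left h] at this

lemma kdeg_rec_of_not_fwd {φ : Aut3 k} (h : ¬ Fwd φ) :
    7 * totalDegree (φ (X 2)) + 3 * totalDegree (φ (X 1)) + kdeg φ ≤
      kdeg (φ * (henonAut k)⁻¹) := by
  have := kdeg_rec φ
  rwa [max_eq_right (not_le.1 h).le] at this

end WedgeDegree

lemma exists_threshold (K : ℤ → ℕ) (h1 : ∀ i, K (i - 1) ≤ K (i + 1) → K i < K (i + 1))
    (h2 : ∀ i, K (i + 1) < K (i - 1) → K i < K (i - 1)) :
    ∃ c : ℤ, ∀ i, K (i - 1) ≤ K (i + 1) ↔ c ≤ i := by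
  have step : ∀ i, K (i - 1) ≤ K (i + 1) → K (i + 1 - 1) ≤ K (i + 1 + 1) := by
    intro i hi
    by_contra h
    have a := h1 i hi
    have b := h2 (i + 1) (not_le.1 h)
    rw [add_sub_cancel_right] at b
    omega
  have mono : ∀ i j, i ≤ j → K (i - 1) ≤ K (i + 1) → K (j - 1) ≤ K (j + 1) := by
    intro i j hij hi
    induction j, hij using Int.leInduction with
    | base => exact hi
    | succ j _ ih => exact step j ih
  have hex : ∃ i, K (i - 1) ≤ K (i + 1) := by
    by_contra! h
    have : ∀ n : ℕ, K n + n ≤ K 0 := by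
      intro n
      induction n with
      | zero => simp
      | succ n ih =>
        have := h2 (n + 1) (h _)
        rw [add_sub_cancel_right] at this
        push_cast
        omega
    have := this (K 0 + 1)
    omega
  have hnex : ∃ i, ¬ K (i - 1) ≤ K (i + 1) := by
    by_contra! h
    have : ∀ n : ℕ, K (-n) + n ≤ K 0 := by
      intro n
      induction n with
      | zero => simp
      | succ n ih =>
        have := h1 (-n - 1) (h _)
        rw [sub_add_cancel] at this
        push_cast
        rw [neg_add, ← sub_eq_add_neg]
        omega
    have := this (K 0 + 1)
    omega
  obtain ⟨b, hb⟩ := hnex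
  obtain ⟨c, hc, hc'⟩ := Int.exists_least_of_bdd
    ⟨b, fun z hz => le_of_not_ge fun hzb => hb (mono z b hzb hz)⟩ hex
  exact ⟨c, fun i => ⟨hc' i, fun h => mono c i h hc⟩⟩

section Coordinate

variable {k : Type} [Field k] [CharZero k]

lemma exists_coord (φ : Aut3 k) : ∃ c : ℤ, ∀ i : ℤ, Fwd (φ * henonAut k ^ i) ↔ c ≤ i := by
  obtain ⟨c, hc⟩ := exists_threshold (fun i => kdeg (φ * henonAut k ^ i))
    (fun i h => by
      have h' : Fwd (φ * henonAut k ^ i) := by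
        simpa [Fwd, mul_assoc, ← zpow_add_one, ← zpow_sub_one] using h
      have := h'.rec'
      have := totalDegree_map_X_pos (φ * henonAut k ^ i) 2
      simp only [mul_assoc, ← zpow_add_one] at *
      omega)
    (fun i h => by
      have h' : ¬ Fwd (φ * henonAut k ^ i) := by
        simpa [Fwd, mul_assoc, ← zpow_add_one, ← zpow_sub_one] using h
      have := kdeg_rec_of_not_fwd h'
      have := totalDegree_map_X_pos (φ * henonAut k ^ i) 2
      simp only [mul_assoc, ← zpow_sub_one] at *
      omega)
  refine ⟨c, fun i => ?_⟩
  rw [← hc i]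
  simp [Fwd, mul_assoc, ← zpow_add_one, ← zpow_sub_one]

/-- The position of `1` relative to the axis of `φ`. -/
noncomputable def coord (φ : Aut3 k) : ℤ := (exists_coord φ).choose

lemma fwd_iff (φ : Aut3 k) (i : ℤ) : Fwd (φ * henonAut k ^ i) ↔ coord φ ≤ i :=
  (exists_coord φ).choose_spec i

lemma coord_eq_of {φ : Aut3 k} {c : ℤ} (h : ∀ i : ℤ, Fwd (φ * henonAut k ^ i) ↔ c ≤ i) :
    coord φ = c :=
  le_antisymm ((fwd_iff φ c).1 ((h c).2 le_rfl)) ((h _).1 ((fwd_iff φ _).2 le_rfl))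

lemma coord_mul (φ : Aut3 k) : coord (φ * henonAut k) = coord φ - 1 := by
  apply coord_eq_of
  intro i
  rw [mul_assoc, ← zpow_one_add, fwd_iff]
  omega

end Coordinate

section Taylor

variable {k : Type} [Field k]

/-- Taylor expansion at `x₂ = 0`, truncated. -/
noncomputable def constTerm (N : ℕ) (f : MvPolynomial (Fin 3) k) : MvPolynomial (Fin 3) k :=
  ∑ m ∈ Finset.range N, C ((-1) ^ m / (m.factorial : k)) * (X 1 ^ m * (pderiv 1)^[m] f)

lemma degreeOf_le_of_constTerm {N : ℕ} {b : ℕ} {n : ℕ} {f : MvPolynomial (Fin 3) k}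
    (hn : (pderiv 1)^[n] f = 0)
    (hb : ∀ j, degreeOf 0 (constTerm (N + 1) ((pderiv 1)^[j] f)) ≤ b) (m : ℕ) :
    degreeOf 0 ((pderiv 1)^[m] f) ≤ b := by
  induction n generalizing f m with
  | zero =>
    have hf : f = 0 := hn
    rw [hf, Function.iterate_fixed (map_zero _) m, degreeOf_zero]
    exact Nat.zero_le _
  | succ n ih =>
    have ih' := ih (f := pderiv 1 f) (by rwa [Function.iterate_succ_apply] at hn)
      (fun j => hb (j + 1))
    cases m with
    | succ m => exact ih' m
    | zero =>
      have hD := isDegree_degreeOf (k := k) 0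
      have h0 := hb 0
      rw [constTerm, Finset.sum_range_succ'] at h0
      simp only [Function.iterate_zero, id_eq, pow_zero, Nat.factorial_zero, Nat.cast_one,
        div_one, map_one, one_mul] at h0 ⊢
      set R := ∑ m ∈ Finset.range N, C ((-1) ^ (m + 1) / ((m + 1).factorial : k)) *
        (X 1 ^ (m + 1) * (pderiv 1)^[m + 1] f) with hR
      have hRb : degreeOf 0 R ≤ b := by
        refine hD.sum_le _ _ fun m _ => ?_
        refine (hD.C_mul_le _ _).trans ((hD.mul_le _ _).trans ?_)
        rw [hD.pow, degreeOf_X_of_ne (by decide), mul_zero, zero_add]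
        exact ih' m
      have := hD.sub_le (R + f) R
      rw [add_sub_cancel_left] at this
      omega

variable [CharZero k]

lemma iterate_pderiv_eq_zero {f : MvPolynomial (Fin 3) k} {n : ℕ} (hn : degreeOf 1 f < n) :
    (pderiv 1)^[n] f = 0 := by
  induction n generalizing f with
  | zero => omega
  | succ n ih =>
    rw [Function.iterate_succ_apply]
    by_cases h0 : degreeOf 1 f = 0
    · rw [pderiv_eq_zero_iff.2 h0]
      exact Function.iterate_fixed (map_zero _) n
    · exact ih (by rw [degreeOf_pderiv_self]; omega)

lemma pderiv_constTerm_succ (N : ℕ) (f : MvPolynomial (Fin 3) k) :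
    pderiv 1 (constTerm (N + 1) f) =
      C ((-1) ^ N / (N.factorial : k)) * (X 1 ^ N * (pderiv 1)^[N + 1] f) := by
  induction N with
  | zero => simp [constTerm]
  | succ N ih =>
    have h1 : constTerm (N + 1 + 1) f = constTerm (N + 1) f +
        C ((-1) ^ (N + 1) / ((N + 1).factorial : k)) * (X 1 ^ (N + 1) * (pderiv 1)^[N + 1] f) :=
      Finset.sum_range_succ _ _
    have h2 : C ((-1) ^ N / (N.factorial : k)) =
        -(C ((-1) ^ (N + 1) / ((N + 1).factorial : k)) * ((N + 1 : ℕ) : MvPolynomial (Fin 3) k)) := by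
      rw [← map_natCast (C : k →+* MvPolynomial (Fin 3) k), ← map_mul, ← map_neg]
      congr 1
      have := Nat.cast_ne_zero (R := k).2 N.factorial_ne_zero
      have := Nat.cast_ne_zero (R := k).2 N.succ_ne_zero
      rw [Nat.factorial_succ]
      push_cast at *
      field_simp
      ring
    rw [h1, map_add, ih, h2, Function.iterate_succ_apply' _ (N + 1)]
    simp only [pderiv_mul, pderiv_C, pderiv_pow, pderiv_X_self, Nat.add_sub_cancel]
    push_cast
    ring

lemma pderiv_constTerm {N : ℕ} {f : MvPolynomial (Fin 3) k} (h : degreeOf 1 f < N) :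
    pderiv 1 (constTerm N f) = 0 := by
  obtain ⟨N, rfl⟩ : ∃ M, N = M + 1 := ⟨N - 1, by omega⟩
  rw [pderiv_constTerm_succ, iterate_pderiv_eq_zero h]
  simp

variable {D : MvPolynomial (Fin 3) k → ℕ} {p r n K : ℕ}

lemma IsDegree.constTerm_le (hD : IsDegree D) (hp : ∀ f, D (pderiv 1 f) ≤ D f + p)
    (hr : D (X 1) ≤ r) (f : MvPolynomial (Fin 3) k) (N j : ℕ) :
    D (constTerm N ((pderiv 1)^[j] f)) ≤ D f + degreeOf 1 f * (p + r) := by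
  have hit : ∀ m, D ((pderiv 1)^[m] f) ≤ D f + m * p := by
    intro m
    induction m with
    | zero => simp
    | succ m ih =>
      rw [Function.iterate_succ_apply']
      have := hp ((pderiv 1)^[m] f)
      rw [add_mul]
      omega
  refine hD.sum_le _ _ fun m _ => ?_
  rw [← Function.iterate_add_apply]
  by_cases hm : degreeOf 1 f < m + j
  · rw [iterate_pderiv_eq_zero hm, mul_zero, mul_zero, hD.zero]
    exact Nat.zero_le _
  · refine (hD.C_mul_le _ _).trans ((hD.mul_le _ _).trans ?_)
    rw [hD.pow]
    have h1 := hit (m + j)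
    have h2 : m * D (X 1) ≤ degreeOf 1 f * r := Nat.mul_le_mul (by omega) hr
    have h3 : (m + j) * p ≤ degreeOf 1 f * p := Nat.mul_le_mul (by omega) le_rfl
    rw [mul_add]
    omega

lemma IsDegree.le_of_pderiv_one_eq_zero
    (hc : ∀ c, pderiv 1 c = 0 → pderiv 0 c ≠ 0 → D (pderiv 0 c) + K ≤ D c + n)
    {c : MvPolynomial (Fin 3) k} (h1 : pderiv 1 c = 0) :
    degreeOf 0 c * K ≤ degreeOf 0 c * n + D c := by
  induction hd : degreeOf 0 c generalizing c with
  | zero => simp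
  | succ d ih =>
    have h0 : pderiv 0 c ≠ 0 := fun h => by rw [pderiv_eq_zero_iff] at h; omega
    have h2 : pderiv 1 (pderiv 0 c) = 0 := by
      rw [pderiv_eq_zero_iff] at h1 ⊢
      have := degreeOf_pderiv_le 1 0 c
      omega
    have h3 := ih h2 (by rw [degreeOf_pderiv_self]; omega)
    have h4 := hc c h1 h0
    rw [add_mul, add_mul]
    omega

/-- A degree function which drops when differentiating along `x₁` but does not increase much when
differentiating along `x₂` controls `degreeOf 0` in terms of `degreeOf 1`. -/
lemma IsDegree.degreeOf_zero_mul_le (hD : IsDegree D) (hp : ∀ f, D (pderiv 1 f) ≤ D f + p)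
    (hr : D (X 1) ≤ r)
    (hc : ∀ c, pderiv 1 c = 0 → pderiv 0 c ≠ 0 → D (pderiv 0 c) + K ≤ D c + n)
    (f : MvPolynomial (Fin 3) k) :
    degreeOf 0 f * K ≤ degreeOf 0 f * n + D f + degreeOf 1 f * (p + r) := by
  rcases Nat.eq_zero_or_pos (degreeOf 0 f) with h0 | hpos
  · simp [h0]
  obtain ⟨j, hj⟩ : ∃ j, degreeOf 0 f ≤
      degreeOf 0 (constTerm (degreeOf 1 f + 1) ((pderiv 1)^[j] f)) := by
    by_contra! h
    have := degreeOf_le_of_constTerm (b := degreeOf 0 f - 1)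
      (iterate_pderiv_eq_zero (Nat.lt_succ_self (degreeOf 1 f)))
      (fun j => Nat.le_sub_one_of_lt (h j)) 0
    simp only [Function.iterate_zero, id_eq] at this
    omega
  have hdeg : ∀ j, degreeOf 1 ((pderiv 1)^[j] f) ≤ degreeOf 1 f := by
    intro j
    induction j with
    | zero => simp
    | succ j ih =>
      rw [Function.iterate_succ_apply']
      exact (degreeOf_pderiv_le _ _ _).trans ih
  have h1 := IsDegree.le_of_pderiv_one_eq_zero hc
    (pderiv_constTerm (N := degreeOf 1 f + 1) (Nat.lt_succ_of_le (hdeg j)))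
  have h2 := hD.constTerm_le hp hr f (degreeOf 1 f + 1) j
  rcases le_total K n with hKn | hKn
  · have := Nat.mul_le_mul_left (degreeOf 0 f) hKn
    omega
  · obtain ⟨e, rfl⟩ := Nat.exists_eq_add_of_le hKn
    have := Nat.mul_le_mul_right e hj
    rw [mul_add] at h1 ⊢
    omega

end Taylor

section Low

variable {k : Type} [Field k]

lemma totalDegree_map_pderiv_one_le (φ : Aut3 k) (f : MvPolynomial (Fin 3) k) :
    totalDegree (φ (pderiv 1 f)) ≤ totalDegree (φ f) + wdeg (φ (X 2)) (φ (X 0)) := by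
  have hD := isDegree_totalDegree (k := k)
  rw [← hD.unit_mul (isUnit_jacDet φ), jac_pderiv_one, hD.neg]
  have key : ∀ i a b, totalDegree (pderiv i (φ f) * wedge a b (φ (X 0)) (φ (X 2))) ≤
      totalDegree (φ f) + wdeg (φ (X 2)) (φ (X 0)) := by
    intro i a b
    refine (hD.mul_le _ _).trans (add_le_add (totalDegree_pderiv_le _ _) ?_)
    have h1 : wedge a b (φ (X 0)) (φ (X 2)) = -wedge a b (φ (X 2)) (φ (X 0)) := by
      simp only [wedge]; ring
    rw [h1, hD.neg]
    exact le_wdeg _ _ _ _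
  exact (hD.add_le _ _).trans (max_le ((hD.sub_le _ _).trans (max_le (key _ _ _) (key _ _ _)))
    (key _ _ _))

lemma kdeg_mul_henonAut (φ : Aut3 k) : kdeg (φ * henonAut k) = wdeg (φ (X 2)) (φ (X 0)) := by
  simp [kdeg]

/-- The degree of `f` in direction `i` of the axis. -/
noncomputable def dirDeg (i : ℤ) (f : MvPolynomial (Fin 3) k) : ℕ :=
  degreeOf 0 ((henonAut k ^ (-i)) f)

/-- Polynomials in `x₃` only. -/
def InBase (f : MvPolynomial (Fin 3) k) : Prop := pderiv 0 f = 0 ∧ pderiv 1 f = 0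

lemma InBase.of_map {φ : Aut3 k} (h0 : pderiv 0 (φ (X 2)) = 0) (h1 : pderiv 1 (φ (X 2)) = 0)
    {f : MvPolynomial (Fin 3) k} (hf : InBase f) : InBase (φ f) := by
  constructor
  · rw [pderiv_map]; simp [Fin.sum_univ_three, hf.1, hf.2, h0]
  · rw [pderiv_map]; simp [Fin.sum_univ_three, hf.1, hf.2, h1]

lemma dirDeg_add_one (i : ℤ) (f : MvPolynomial (Fin 3) k) :
    dirDeg (i + 1) f = degreeOf 1 ((henonAut k ^ (-i)) f) := by
  rw [dirDeg, ← degreeOf_zero_henonAut_inv, ← AlgEquiv.mul_apply, ← zpow_neg_one, ← zpow_add]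
  congr 3; ring

variable [CharZero k]

lemma Fwd.degreeOf_lt {φ : Aut3 k} (hF : Fwd φ) {f : MvPolynomial (Fin 3) k}
    (hf : totalDegree (φ f) ≤ totalDegree (φ (X 2))) :
    degreeOf 0 f < 2 * degreeOf 1 f ∨ (degreeOf 0 f = 0 ∧ degreeOf 1 f = 0) := by
  have hrec := hF.rec'
  rw [kdeg_mul_henonAut] at hrec
  have hD := isDegree_totalDegree (k := k)
  have hc : ∀ c : MvPolynomial (Fin 3) k, pderiv 1 c = 0 → pderiv 0 c ≠ 0 →
      totalDegree (φ (pderiv 0 c)) + wdeg (φ (X 2)) (φ (X 0)) ≤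
        totalDegree (φ c) + totalDegree (φ (X 2)) := by
    intro c h1 h0
    obtain ⟨a, b, hne, hab⟩ := exists_totalDegree_eq_wdeg
      (by simpa using exists_wedge_ne_zero (φ * swapAut k))
    have key : φ (pderiv 0 c) * wedge a b (φ (X 2)) (φ (X 0)) = wedge a b (φ (X 2)) (φ c) := by
      simp only [wedge, pderiv_map φ _ c, Fin.sum_univ_three, h1, map_zero]
      ring
    rw [← hab, ← hD.mul ((map_ne_zero_iff φ φ.injective).2 h0) hne, key, add_comm]
    exact totalDegree_wedge_le _ _ _ _
  have := (hD.comp φ).degreeOf_zero_mul_le (totalDegree_map_pderiv_one_le φ) le_rfl hc f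
  have hn := totalDegree_map_X_pos φ 2
  by_contra! hcon
  obtain ⟨h1, h2⟩ := hcon
  have hpos : 1 ≤ degreeOf 0 f := by
    by_contra h
    have := h2 (by omega)
    omega
  generalize degreeOf 0 f = B at *
  generalize degreeOf 1 f = α at *
  generalize wdeg (φ (X 2)) (φ (X 0)) = K at *
  generalize totalDegree (φ (X 2)) = n at *
  generalize totalDegree (φ (X 1)) = r at *
  generalize totalDegree (φ f) = d at *
  have h3 : 2 * α * (K + r) ≤ B * (K + r) := Nat.mul_le_mul_right _ h1
  have h4 : B * (7 * n + 3 * r) ≤ B * K := Nat.mul_le_mul_left _ (by omega)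
  have h5 : n ≤ B * n := Nat.le_mul_of_pos_left _ hpos
  have h6 : 0 ≤ B * r := Nat.zero_le _
  nlinarith

lemma degreeOf_lt_of_not_fwd {φ : Aut3 k} (hF : ¬ Fwd φ) {f : MvPolynomial (Fin 3) k}
    (hf : totalDegree (φ f) ≤ totalDegree (φ (X 2))) :
    degreeOf 0 f < 2 * degreeOf 0 (henonAut k f) ∨
      (degreeOf 0 f = 0 ∧ degreeOf 0 (henonAut k f) = 0) := by
  have hF' : Fwd (φ * flipAut k) := by
    have h1 : kdeg (φ * flipAut k * henonAut k) = kdeg (φ * (henonAut k)⁻¹) := by simp [kdeg]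
    have h2 : kdeg (φ * flipAut k * (henonAut k)⁻¹) = kdeg (φ * henonAut k) := by
      simp [kdeg, map_henon]
    rw [Fwd, h1, h2]
    exact (not_le.1 hF).le
  have := hF'.degreeOf_lt (f := flipAut k f) (by simpa using hf)
  simpa [henonAut] using this

lemma not_dirDeg_eq_zero {f : MvPolynomial (Fin 3) k} (hf : ¬ InBase f) (i : ℤ) :
    ¬ (dirDeg i f = 0 ∧ dirDeg (i + 1) f = 0) := by
  rw [dirDeg_add_one, dirDeg, ← pderiv_eq_zero_iff, ← pderiv_eq_zero_iff]
  intro h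
  apply hf
  have h' := InBase.of_map (φ := henonAut k ^ i) (by simp [pderiv_X]) (by simp [pderiv_X]) h
  rwa [← AlgEquiv.mul_apply, ← zpow_add, add_neg_cancel, zpow_zero, AlgEquiv.one_apply] at h'

lemma dirDeg_lt_of_coord_le {φ : Aut3 k} {f : MvPolynomial (Fin 3) k}
    (hf : totalDegree (φ f) ≤ totalDegree (φ (X 2))) (hf' : ¬ InBase f) {i : ℤ}
    (hi : coord φ ≤ i) : dirDeg i f < 2 * dirDeg (i + 1) f := by
  have h := ((fwd_iff φ i).2 hi).degreeOf_lt (f := (henonAut k ^ (-i)) f) (by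
    rw [← AlgEquiv.mul_apply, mul_assoc, ← zpow_add]
    simpa using hf)
  rw [← dirDeg_add_one] at h
  exact h.resolve_right (not_dirDeg_eq_zero hf' i)

lemma dirDeg_lt_of_lt_coord {φ : Aut3 k} {f : MvPolynomial (Fin 3) k}
    (hf : totalDegree (φ f) ≤ totalDegree (φ (X 2))) (hf' : ¬ InBase f) {i : ℤ}
    (hi : i < coord φ) : dirDeg i f < 2 * dirDeg (i - 1) f := by
  have h := degreeOf_lt_of_not_fwd (fun h => not_le.2 hi ((fwd_iff φ i).1 h))
    (f := (henonAut k ^ (-i)) f) (by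
      rw [← AlgEquiv.mul_apply, mul_assoc, ← zpow_add]
      simpa using hf)
  have h1 : degreeOf 0 (henonAut k ((henonAut k ^ (-i)) f)) = dirDeg (i - 1) f := by
    rw [dirDeg, ← AlgEquiv.mul_apply, ← zpow_one_add]
    congr 3; ring
  rw [h1] at h
  refine h.resolve_right fun h2 => not_dirDeg_eq_zero hf' (i - 1) ⟨h2.2, ?_⟩
  rw [sub_add_cancel]
  exact h2.1

end Low

section Convexity

variable {k : Type} [Field k]

/-- Homogenization for the weights `4, 1, 0`. -/
noncomputable def homog (k : Type) [Field k] :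
    MvPolynomial (Fin 3) k →ₐ[k] Polynomial (MvPolynomial (Fin 3) k) :=
  aeval ![Polynomial.C (X 0) * Polynomial.X ^ 4, Polynomial.C (X 1) * Polynomial.X,
    Polynomial.C (X 2)]

lemma monomial_eq_prod (m : Fin 3 →₀ ℕ) (a : k) :
    monomial m a = C a * (X 0 ^ m 0 * X 1 ^ m 1 * X 2 ^ m 2) := by
  rw [monomial_eq, Finsupp.prod_fintype _ _ (by simp), Fin.prod_univ_three]

lemma homog_monomial (m : Fin 3 →₀ ℕ) (a : k) :
    homog k (monomial m a) = Polynomial.C (monomial m a) * Polynomial.X ^ (4 * m 0 + m 1) := by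
  have hC : homog k (C a) = Polynomial.C (C a) := (homog k).commutes a
  rw [monomial_eq_prod, map_mul, hC]
  simp only [homog, map_mul, map_pow, aeval_X, Matrix.cons_val]
  ring

lemma coeff_homog (f : MvPolynomial (Fin 3) k) (j : ℕ) (m : Fin 3 →₀ ℕ) :
    coeff m ((homog k f).coeff j) = if 4 * m 0 + m 1 = j then coeff m f else 0 := by
  induction f using MvPolynomial.induction_on' with
  | monomial m' a =>
    rw [homog_monomial, Polynomial.coeff_C_mul, Polynomial.coeff_X_pow, mul_ite, mul_one, mul_zero,
      apply_ite (coeff m), coeff_monomial, coeff_zero]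
    by_cases hm : m' = m
    · subst hm
      simp only [eq_comm, if_true]
    · simp [hm]
  | add p q hp hq =>
    rw [map_add, Polynomial.coeff_add, coeff_add, coeff_add, hp, hq]
    split_ifs <;> simp

lemma weight_le_natDegree_homog {f : MvPolynomial (Fin 3) k} {m : Fin 3 →₀ ℕ}
    (hm : m ∈ f.support) : 4 * m 0 + m 1 ≤ (homog k f).natDegree := by
  apply Polynomial.le_natDegree_of_ne_zero
  intro h
  have := coeff_homog f (4 * m 0 + m 1) m
  rw [h, if_pos rfl, coeff_zero] at this
  exact (mem_support_iff.1 hm) this.symm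

lemma mem_support_coeff_homog {f : MvPolynomial (Fin 3) k} {j : ℕ} {m : Fin 3 →₀ ℕ}
    (hm : m ∈ ((homog k f).coeff j).support) : m ∈ f.support ∧ 4 * m 0 + m 1 = j := by
  rw [mem_support_iff, coeff_homog] at hm
  rw [mem_support_iff]
  by_cases h : 4 * m 0 + m 1 = j
  · rw [if_pos h] at hm
    exact ⟨hm, h⟩
  · simp [h] at hm

lemma X_zero_pow_dvd_coeff_homog {f : MvPolynomial (Fin 3) k} {j q : ℕ}
    (hq : 4 * q ≤ j - degreeOf 1 f + 3) : X 0 ^ q ∣ (homog k f).coeff j := by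
  rw [((homog k f).coeff j).as_sum]
  refine Finset.dvd_sum fun m hm => ?_
  obtain ⟨h1, h2⟩ := mem_support_coeff_homog hm
  have := monomial_le_degreeOf 1 h1
  rw [monomial_eq_prod, mul_assoc]
  exact Dvd.dvd.mul_left (Dvd.dvd.mul_right (pow_dvd_pow _ (by omega)) _) _

/-- The leading part of `flipAut` for the weights `4, 1, 0`. -/
noncomputable def flipTop (k : Type) [Field k] :
    MvPolynomial (Fin 3) k →ₐ[k] MvPolynomial (Fin 3) k :=
  aeval ![X 2 ^ 7 * X 1 ^ 4 - X 0, X 1, X 2]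

lemma homog_flipAut_X0 : homog k (flipAut k (X 0)) =
    Polynomial.C (X 2 ^ 7 * X 1 ^ 4 - X 0) * Polynomial.X ^ 4 +
      Polynomial.C (X 2 ^ 7 * X 1 ^ 3) * Polynomial.X ^ 3 := by
  simp only [flipAut_X0, henon, homog, map_sub, map_mul, map_add, map_pow, aeval_X, Matrix.cons_val]
  ring

lemma homog_flipAut_monomial (m : Fin 3 →₀ ℕ) (a : k) :
    (homog k (flipAut k (monomial m a))).natDegree ≤ 4 * m 0 + m 1 ∧
    (homog k (flipAut k (monomial m a))).coeff (4 * m 0 + m 1) = flipTop k (monomial m a) := by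
  have hC : homog k (C a) = Polynomial.C (C a) := (homog k).commutes a
  have hC' : flipTop k (C a) = C a := (flipTop k).commutes a
  have hP : (homog k (flipAut k (X 0))).natDegree ≤ 4 := by
    rw [homog_flipAut_X0]
    compute_degree
  have hP' : (homog k (flipAut k (X 0))).coeff 4 = flipTop k (X 0) := by
    rw [homog_flipAut_X0, Polynomial.coeff_add, Polynomial.coeff_C_mul, Polynomial.coeff_C_mul,
      Polynomial.coeff_X_pow, Polynomial.coeff_X_pow]
    simp [flipTop]
  have key : homog k (flipAut k (monomial m a)) = Polynomial.C (C a * X 1 ^ m 1 * X 2 ^ m 2) *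
      (homog k (flipAut k (X 0)) ^ m 0 * Polynomial.X ^ m 1) := by
    rw [monomial_eq_prod]
    simp only [map_mul, map_pow, map_C, hC, flipAut_X1, flipAut_X2]
    simp only [homog, aeval_X, Matrix.cons_val]
    ring
  have hpow : (homog k (flipAut k (X 0)) ^ m 0).coeff (4 * m 0) = flipTop k (X 0) ^ m 0 := by
    rw [mul_comm, Polynomial.coeff_pow_of_natDegree_le hP, hP']
  rw [key, Polynomial.coeff_C_mul, Polynomial.coeff_mul_X_pow, hpow, monomial_eq_prod]
  constructor
  · refine (Polynomial.natDegree_C_mul_le _ _).trans (Polynomial.natDegree_mul_le.trans ?_)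
    have := Polynomial.natDegree_pow_le (p := homog k (flipAut k (X 0))) (n := m 0)
    rw [Polynomial.natDegree_X_pow]
    nlinarith
  · simp only [map_mul, map_pow, hC']
    simp [flipTop]
    ring

lemma homog_flipAut {f : MvPolynomial (Fin 3) k} {W : ℕ} (hf : (homog k f).natDegree ≤ W) :
    (homog k (flipAut k f)).natDegree ≤ W ∧
    (homog k (flipAut k f)).coeff W = flipTop k ((homog k f).coeff W) := by
  have key : ∀ s : Finset (Fin 3 →₀ ℕ), s ⊆ f.support →
      (homog k (flipAut k (∑ m ∈ s, monomial m (coeff m f)))).natDegree ≤ W ∧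
      (homog k (flipAut k (∑ m ∈ s, monomial m (coeff m f)))).coeff W =
        flipTop k ((homog k (∑ m ∈ s, monomial m (coeff m f))).coeff W) := by
    intro s
    induction s using Finset.induction_on with
    | empty => simp
    | insert m s hm ih =>
      intro hs
      obtain ⟨h1, h2⟩ := ih ((Finset.subset_insert _ _).trans hs)
      obtain ⟨h3, h4⟩ := homog_flipAut_monomial m (coeff m f)
      have h5 := (weight_le_natDegree_homog (hs (Finset.mem_insert_self _ _))).trans hf
      simp only [Finset.sum_insert hm, map_add, Polynomial.coeff_add]
      refine ⟨Polynomial.natDegree_add_le_of_degree_le (h3.trans h5) h1, ?_⟩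
      rw [h2, add_left_inj, homog_monomial, Polynomial.coeff_C_mul, Polynomial.coeff_X_pow]
      rcases h5.eq_or_lt with h | h
      · rw [if_pos h.symm, mul_one, ← h4, h]
      · rw [if_neg h.ne', mul_zero, map_zero]
        exact Polynomial.coeff_eq_zero_of_natDegree_lt (h3.trans_lt h)
  have := key f.support subset_rfl
  rwa [← f.as_sum] at this

lemma degreeOf_convex (f : MvPolynomial (Fin 3) k) :
    4 * degreeOf 0 f ≤ degreeOf 1 f + degreeOf 1 (flipAut k f) := by
  by_cases hf : f = 0
  · simp [hf]
  obtain ⟨m, hm, hm0⟩ := Finset.exists_mem_eq_sup f.support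
    (support_nonempty.2 hf) fun m => m 0
  rw [← degreeOf_eq_sup] at hm0
  set W := (homog k f).natDegree with hW
  have hWm : 4 * m 0 + m 1 ≤ W := weight_le_natDegree_homog hm
  set H := (homog k f).coeff W with hH
  have hf0 : homog k f ≠ 0 := by
    intro h
    have := coeff_homog f (4 * m 0 + m 1) m
    rw [h, if_pos rfl, Polynomial.coeff_zero, coeff_zero] at this
    exact (mem_support_iff.1 hm) this.symm
  have hH0 : H ≠ 0 := Polynomial.leadingCoeff_ne_zero.2 hf0
  have hHd : degreeOf 0 H ≤ degreeOf 0 f := degreeOf_le_iff.2 fun m' hm' =>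
    monomial_le_degreeOf 0 (mem_support_coeff_homog hm').1
  set S : MvPolynomial (Fin 3) k := X 2 ^ 7 * X 1 ^ 4 - X 0 with hS
  have h1 : X 0 ^ ((W - degreeOf 1 f + 3) / 4) ∣ H :=
    X_zero_pow_dvd_coeff_homog (Nat.mul_div_le _ _)
  have h2 : S ^ ((W - degreeOf 1 (flipAut k f) + 3) / 4) ∣ H := by
    obtain ⟨h3, -⟩ := homog_flipAut (W := W) hW.ge
    obtain ⟨-, h4⟩ := homog_flipAut h3
    rw [flipAut_flipAut] at h4
    have h5 := map_dvd (flipTop k) (X_zero_pow_dvd_coeff_homog (f := flipAut k f) (j := W)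
      (Nat.mul_div_le (W - degreeOf 1 (flipAut k f) + 3) 4))
    rw [← h4, map_pow] at h5
    simpa [flipTop] using h5
  have hD := isDegree_degreeOf (k := k) 0
  have hS1 : degreeOf 0 S = 1 := by
    rw [hS, ← hD.neg, neg_sub, sub_eq_add_neg, add_comm]
    rw [hD.add_eq_of_lt] <;>
    simp [hD.neg, hD.mul, hD.pow, degreeOf_X_of_ne (show (0 : Fin 3) ≠ 1 by decide),
      degreeOf_X_of_ne (show (0 : Fin 3) ≠ 2 by decide)]
  have hS0 : S ≠ 0 := by
    intro h
    simp [h] at hS1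
  have hcop : IsRelPrime (X 0) S := by
    rw [X_prime.irreducible.isRelPrime_iff_not_dvd]
    intro h
    rw [hS, ← dvd_neg, neg_sub] at h
    have := (dvd_sub_right (dvd_refl (X (0 : Fin 3) : MvPolynomial (Fin 3) k))).1 h
    rcases X_prime.dvd_or_dvd this with h | h <;>
    · have := X_dvd_X.1 (X_prime.dvd_of_dvd_pow h)
      simp at this
  obtain ⟨c, hc⟩ := (hcop.pow (m := (W - degreeOf 1 f + 3) / 4)
    (n := (W - degreeOf 1 (flipAut k f) + 3) / 4)).mul_dvd h1 h2
  have hc0 : c ≠ 0 := by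
    rintro rfl
    simp [hH0] at hc
  rw [hc, hD.mul (mul_ne_zero (pow_ne_zero _ (X_ne_zero _)) (pow_ne_zero _ hS0)) hc0,
    hD.mul (pow_ne_zero _ (X_ne_zero _)) (pow_ne_zero _ hS0), hD.pow, hD.pow, hS1,
    degreeOf_X_self] at hHd
  omega

lemma degreeOf_one_flipAut_henonAut (f : MvPolynomial (Fin 3) k) :
    degreeOf 0 (henonAut k f) = degreeOf 1 (flipAut k f) := by
  simp [henonAut]

lemma dirDeg_convex (i : ℤ) (f : MvPolynomial (Fin 3) k) :
    4 * dirDeg i f ≤ dirDeg (i - 1) f + dirDeg (i + 1) f := by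
  have h := degreeOf_convex ((henonAut k ^ (-i)) f)
  rw [← dirDeg_add_one, ← degreeOf_one_flipAut_henonAut, ← AlgEquiv.mul_apply, ← zpow_one_add,
    show 1 + -i = -(i - 1) by ring] at h
  rw [add_comm]
  exact h

end Convexity

section LowCoordinates

variable {k : Type} [Field k] [CharZero k]

/-- Two automorphisms for which the same polynomial has small image have close coordinates. -/
lemma coord_le_coord_add_two {φ φ' : Aut3 k} {f : MvPolynomial (Fin 3) k} (hf : ¬ InBase f)
    (h : totalDegree (φ f) ≤ totalDegree (φ (X 2)))
    (h' : totalDegree (φ' f) ≤ totalDegree (φ' (X 2))) : coord φ ≤ coord φ' + 2 := by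
  by_contra! hlt
  have h1 := dirDeg_lt_of_coord_le h' hf (i := coord φ') le_rfl
  have h2 := dirDeg_lt_of_lt_coord h hf (i := coord φ' + 2) (by omega)
  have h3 := dirDeg_convex (coord φ' + 1) f
  rw [show coord φ' + 2 - 1 = coord φ' + 1 by ring] at h2
  rw [show coord φ' + 1 - 1 = coord φ' by ring, show coord φ' + 1 + 1 = coord φ' + 2 by ring] at h3
  omega

end LowCoordinates

section Symmetry

variable {k : Type} [Field k]

lemma natDegree_le_of_surjective {P Q : Polynomial k} (hQ : Q ≠ 0) {u : AdjoinRoot P}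
    (hu : Function.Surjective (Polynomial.aeval u : Polynomial k →ₐ[k] AdjoinRoot P))
    (h : Polynomial.aeval u Q = 0) : P.natDegree ≤ Q.natDegree := by
  have hfin : Module.Finite k (AdjoinRoot Q) := (AdjoinRoot.powerBasis hQ).finite
  have hsurj : Function.Surjective (AdjoinRoot.liftAlgHom Q (Algebra.ofId k (AdjoinRoot P)) u
      (by simpa [Polynomial.aeval_def] using h)) := by
    intro y
    obtain ⟨p, rfl⟩ := hu y
    exact ⟨AdjoinRoot.mk Q p, by simp [Polynomial.aeval_def]⟩
  have := LinearMap.finrank_le_finrank_of_surjective (f := (AdjoinRoot.liftAlgHom Q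
    (Algebra.ofId k (AdjoinRoot P)) u
      (by simpa [Polynomial.aeval_def] using h)).toLinearMap) hsurj
  exact finrank_quotient_span_eq_natDegree (f := P) ▸
    finrank_quotient_span_eq_natDegree (f := Q) ▸ this

/-- Restriction to the line `x₂ = c`, `x₃ = t`. -/
noncomputable def toLine (c t : k) : MvPolynomial (Fin 3) k →ₐ[k] Polynomial k :=
  aeval ![Polynomial.X, Polynomial.C c, Polynomial.C t]

lemma toLine_eq (s : Fin 2 → k) (f : MvPolynomial (Fin 3) k) :
    toLine (s 0) (s 1) f = (finSuccEquiv k 2 f).map (eval s) := by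
  have : toLine (s 0) (s 1) = (Polynomial.mapAlgHom (aeval s)).comp
      (finSuccEquiv k 2 : MvPolynomial (Fin 3) k →ₐ[k] _) := by
    apply MvPolynomial.algHom_ext
    intro i
    fin_cases i
    · simp [toLine, finSuccEquiv_X_zero]
    · simpa [toLine] using congrArg (Polynomial.mapAlgHom (aeval s))
        (finSuccEquiv_X_succ (R := k) (n := 2) (j := 0)).symm
    · simpa [toLine] using congrArg (Polynomial.mapAlgHom (aeval s))
        (finSuccEquiv_X_succ (R := k) (n := 2) (j := 1)).symm
  rw [this]
  simp [Polynomial.mapAlgHom, coe_aeval_eq_eval]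

lemma natDegree_toLine_le (c t : k) (f : MvPolynomial (Fin 3) k) :
    (toLine c t f).natDegree ≤ degreeOf 0 f := by
  have := toLine_eq ![c, t] f
  simp only [Matrix.cons_val] at this
  rw [this, ← natDegree_finSuccEquiv]
  exact Polynomial.natDegree_map_le

lemma exists_natDegree_toLine_eq [CharZero k] (f : MvPolynomial (Fin 3) k) :
    ∃ c t : k, (toLine c t f).natDegree = degreeOf 0 f := by
  by_cases hf : f = 0
  · exact ⟨0, 0, by simp [hf]⟩
  have hL : (finSuccEquiv k 2 f).leadingCoeff ≠ 0 := by simpa using hf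
  obtain ⟨s, hs⟩ : ∃ s, eval s (finSuccEquiv k 2 f).leadingCoeff ≠ 0 := by
    by_contra! h
    exact hL (MvPolynomial.funext fun s => by simpa using h s)
  refine ⟨s 0, s 1, ?_⟩
  rw [toLine_eq, Polynomial.natDegree_map_of_leadingCoeff_ne_zero _ hs, natDegree_finSuccEquiv]

lemma algHom_toLine {B : Type*} [CommRing B] [Algebra k B]
    (π : MvPolynomial (Fin 3) k →ₐ[k] B) {c t : k} (h1 : π (X 1) = algebraMap k B c)
    (h2 : π (X 2) = algebraMap k B t) (f : MvPolynomial (Fin 3) k) :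
    π f = Polynomial.aeval (π (X 0)) (toLine c t f) := by
  have : π = (Polynomial.aeval (π (X 0))).comp (toLine c t) := by
    apply MvPolynomial.algHom_ext
    intro i
    fin_cases i <;> simp [toLine, h1, h2]
  exact DFunLike.congr_fun this f

/-- Automorphisms preserving the fibration over the third coordinate. -/
def Fibred (χ : Aut3 k) : Prop := ∃ a b : k, a ≠ 0 ∧ χ (X 2) = C a * X 2 + C b

lemma Fibred.mul {χ χ' : Aut3 k} (h : Fibred χ) (h' : Fibred χ') : Fibred (χ * χ') := by
  obtain ⟨a, b, ha, h⟩ := h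
  obtain ⟨a', b', ha', h'⟩ := h'
  refine ⟨a' * a, a' * b + b', mul_ne_zero ha' ha, ?_⟩
  rw [AlgEquiv.mul_apply, h']
  simp only [map_add, map_mul, map_C, h]
  ring

lemma Fibred.inv {χ : Aut3 k} (h : Fibred χ) : Fibred χ⁻¹ := by
  obtain ⟨a, b, ha, h⟩ := h
  refine ⟨a⁻¹, -(a⁻¹ * b), inv_ne_zero ha, ?_⟩
  apply χ.injective
  rw [← AlgEquiv.mul_apply, mul_inv_cancel, AlgEquiv.one_apply]
  simp only [map_add, map_mul, map_C, h, map_neg]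
  have : (C a⁻¹ * C a : MvPolynomial (Fin 3) k) = 1 := by rw [← C_mul, inv_mul_cancel₀ ha, C_1]
  linear_combination (-X 2) * this

lemma fibred_of_X2 {χ : Aut3 k} (h : χ (X 2) = X 2) : Fibred χ := ⟨1, 0, by simp [h]⟩

lemma Fibred.degreeOf_X_one_le [CharZero k] {χ : Aut3 k} (h : Fibred χ) :
    degreeOf 0 (χ (X 1)) ≤ degreeOf 0 (χ⁻¹ (X 1)) := by
  obtain ⟨a, b, ha, h⟩ := h
  obtain ⟨c, t, hct⟩ := exists_natDegree_toLine_eq (χ (X 1))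
  have hχ : ∀ f, χ (χ⁻¹ f) = f := fun f => by
    rw [← AlgEquiv.mul_apply, mul_inv_cancel, AlgEquiv.one_apply]
  set ev : MvPolynomial (Fin 3) k →ₐ[k] k := aeval ![0, c + 1, t] with hev
  set c' := ev (χ (X 1)) with hc'
  set P := toLine c t (χ (X 1)) - Polynomial.C c' with hP
  set Q := toLine c' (a * t + b) (χ⁻¹ (X 1)) - Polynomial.C c with hQ
  have hQ0 : Q ≠ 0 := by
    intro h0
    have h3 := algHom_toLine (ev.comp (χ : MvPolynomial (Fin 3) k →ₐ[k] _)) (c := c')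
      (t := a * t + b) (by simp [hc']) (by simp [h, hev]) (χ⁻¹ (X 1))
    rw [sub_eq_zero.1 h0] at h3
    change ev (χ (χ⁻¹ (X 1))) = _ at h3
    rw [hχ] at h3
    simp [hev] at h3
  set π : MvPolynomial (Fin 3) k →ₐ[k] AdjoinRoot P :=
    ((AdjoinRoot.mkₐ P).comp (toLine c t)).comp (χ : MvPolynomial (Fin 3) k →ₐ[k] _) with hπ
  have hπ' : ∀ f, π f = AdjoinRoot.mk P (toLine c t (χ f)) := fun f => rfl
  have hline : ∀ f, π f = Polynomial.aeval (π (X 0)) (toLine c' (a * t + b) f) := by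
    apply algHom_toLine
    · rw [hπ', ← sub_add_cancel (toLine c t (χ (X 1))) (Polynomial.C c'), ← hP, map_add,
        AdjoinRoot.mk_self, zero_add, AdjoinRoot.mk_C, AdjoinRoot.algebraMap_eq]
    · rw [hπ', h, AdjoinRoot.algebraMap_eq, ← AdjoinRoot.mk_C]
      simp [toLine]
  have hsurj : Function.Surjective
      (Polynomial.aeval (π (X 0)) : Polynomial k →ₐ[k] AdjoinRoot P) := by
    intro y
    obtain ⟨p, rfl⟩ := AdjoinRoot.mk_surjective y
    refine ⟨toLine c' (a * t + b) (χ⁻¹ (Polynomial.aeval (X 0) p)), ?_⟩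
    rw [← hline, hπ', hχ, ← Polynomial.aeval_algHom_apply]
    simp [toLine]
  have hroot : Polynomial.aeval (π (X 0)) Q = 0 := by
    rw [hQ, map_sub, ← hline, hπ', hχ]
    simp [toLine]
  have := natDegree_le_of_surjective hQ0 hsurj hroot
  rw [hP, hQ, Polynomial.natDegree_sub_C, Polynomial.natDegree_sub_C, hct] at this
  exact this.trans (natDegree_toLine_le _ _ _)

end Symmetry

section Waves

/-- Sequences which at every index grow by a factor four in at least one direction. -/
structure Wave (u : ℤ → ℕ) : Prop where
  grow : ∀ i, 4 * u i ≤ u (i + 1) ∨ 4 * u i ≤ u (i - 1)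
  zero : ∀ i, u i = 0 → 1 ≤ u (i + 1) ∧ 1 ≤ u (i - 1)

/-- The sequence increases fast after `i`. -/
def Inc (u : ℤ → ℕ) (i : ℤ) : Prop := 4 * u i ≤ u (i + 1) ∧ 1 ≤ u (i + 1)

/-- The sequence decreases fast up to `i + 1`. -/
def Dec (u : ℤ → ℕ) (i : ℤ) : Prop := 4 * u (i + 1) ≤ u i ∧ 1 ≤ u i

variable {u : ℤ → ℕ}

lemma Inc.not_dec {i : ℤ} (h : Inc u i) : ¬ Dec u i := by
  rintro ⟨h1, h2⟩
  have := h.1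
  omega

namespace Wave

variable (hu : Wave u)

include hu

lemma inc_or_dec (i : ℤ) : Inc u (i + 1) ∨ Dec u i := by
  have h1 := hu.grow (i + 1)
  have h2 := hu.zero (i + 1)
  rw [add_sub_cancel_right] at h1 h2
  unfold Inc Dec
  omega

lemma inc_succ {i : ℤ} (h : Inc u i) : Inc u (i + 1) :=
  (hu.inc_or_dec i).resolve_right h.not_dec

lemma inc_add {i : ℤ} (h : Inc u i) (n : ℕ) : Inc u (i + n) := by
  induction n with
  | zero => simpa using h
  | succ n ih => simpa [add_assoc] using hu.inc_succ ih

lemma inc_of_le {i j : ℤ} (h : Inc u i) (hij : i ≤ j) : Inc u j := by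
  obtain ⟨n, rfl⟩ := Int.le.dest hij
  exact hu.inc_add h n

lemma dec_of_le {i j : ℤ} (h : Dec u j) (hij : i ≤ j) : Dec u i := by
  rcases hij.eq_or_lt with rfl | hlt
  · exact h
  · exact (hu.inc_or_dec i).resolve_left fun h' => (hu.inc_of_le h' hlt).not_dec h

lemma pow_mul_le {i : ℤ} (h : Inc u i) (n : ℕ) : 4 ^ n * u i ≤ u (i + n) := by
  induction n with
  | zero => simp
  | succ n ih =>
    have := (hu.inc_add h n).1
    rw [pow_succ, Nat.cast_succ, ← add_assoc]
    lia

lemma pow_le_of_zero {i : ℤ} (h : u i = 0) (n : ℕ) : 4 ^ n ≤ u (i + (n + 1 : ℕ)) := by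
  have hi : Inc u i := ⟨by omega, (hu.zero i h).1⟩
  have h1 := hu.pow_mul_le (hu.inc_succ hi) n
  have h2 := Nat.mul_le_mul_left (4 ^ n) hi.2
  rw [show i + 1 + n = i + (n + 1 : ℕ) by push_cast; ring] at h1
  omega

lemma comp_neg : Wave fun i => u (-i) where
  grow i := by
    have := hu.grow (-i)
    rw [show -(i + 1) = -i - 1 by ring, show -(i - 1) = -i + 1 by ring]
    exact this.symm
  zero i h := by
    have := hu.zero (-i) h
    rw [show -(i + 1) = -i - 1 by ring, show -(i - 1) = -i + 1 by ring]
    exact this.symm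

lemma pow_le_of_zero' {i j : ℤ} (h : u i = 0) (hj : j ≠ i) : 4 ^ ((j - i).natAbs - 1) ≤ u j := by
  rcases lt_or_gt_of_ne hj with hlt | hlt
  · have := hu.comp_neg.pow_le_of_zero (i := -i) (by simpa using h) ((j - i).natAbs - 1)
    rwa [show -(-i + ((j - i).natAbs - 1 + 1 : ℕ)) = j by omega] at this
  · have := hu.pow_le_of_zero h ((j - i).natAbs - 1)
    rwa [show i + ((j - i).natAbs - 1 + 1 : ℕ) = j by omega] at this

lemma pow_le_mul (h0 : ∀ i, u i ≠ 0) (i : ℤ) (n : ℕ) : 4 ^ n ≤ u i * u (i + (n + 1 : ℕ)) := by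
  induction n generalizing i with
  | zero => exact Nat.mul_pos (Nat.pos_of_ne_zero (h0 _)) (Nat.pos_of_ne_zero (h0 _))
  | succ n ih =>
    have e : i + (n + 1 + 1 : ℕ) = i + 1 + (n + 1 : ℕ) := by push_cast; ring
    have hi := Nat.pos_of_ne_zero (h0 i)
    have hi1 := Nat.pos_of_ne_zero (h0 (i + 1))
    rw [e]
    rcases hu.inc_or_dec i with h | h
    · have h1 := hu.pow_mul_le h (n + 1)
      have h2 := Nat.mul_le_mul_left (4 ^ (n + 1)) hi1
      have h3 := Nat.mul_le_mul_right (u (i + 1 + (n + 1 : ℕ))) hi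
      lia
    · have h1 := Nat.mul_le_mul_right (u (i + 1 + (n + 1 : ℕ))) h.1
      have h2 := ih (i + 1)
      rw [pow_succ]
      lia

lemma pow_le_mul' (h0 : ∀ i, u i ≠ 0) {i j : ℤ} (hij : i ≠ j) :
    4 ^ ((j - i).natAbs - 1) ≤ u i * u j := by
  rcases lt_or_gt_of_ne hij with hlt | hlt
  · have := hu.pow_le_mul h0 i ((j - i).natAbs - 1)
    rwa [show i + ((j - i).natAbs - 1 + 1 : ℕ) = j by omega] at this
  · have := hu.pow_le_mul h0 j ((j - i).natAbs - 1)
    rwa [show j + ((j - i).natAbs - 1 + 1 : ℕ) = i by omega, mul_comm] at this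

end Wave

end Waves

section FibreDegree

variable {k : Type} [Field k]

/-- The degree of an automorphism along the fibres. -/
noncomputable def fdeg (χ : Aut3 k) : ℕ := degreeOf 0 (χ (X 1))

lemma fdeg_mul_henonAut (χ : Aut3 k) : fdeg (χ * henonAut k) = degreeOf 0 (χ (X 0)) := by
  simp [fdeg]

lemma fdeg_mul_henonAut_inv (χ : Aut3 k) : fdeg (χ * (henonAut k)⁻¹) =
    degreeOf 0 (henon (χ (X 1)) (χ (X 2)) - χ (X 0)) := by
  simp [fdeg, map_henon]

lemma fibred_henonAut_zpow (i : ℤ) : Fibred (henonAut k ^ i) := fibred_of_X2 (by simp)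

lemma Fibred.shift {χ : Aut3 k} (h : Fibred χ) (i l : ℤ) :
    Fibred (henonAut k ^ (-i) * χ * henonAut k ^ l) :=
  ((fibred_henonAut_zpow _).mul h).mul (fibred_henonAut_zpow _)

lemma Fibred.degreeOf_X_two {χ : Aut3 k} (h : Fibred χ) : degreeOf 0 (χ (X 2)) = 0 := by
  obtain ⟨a, b, ha, h⟩ := h
  rw [h, (isDegree_degreeOf 0).affine ha, degreeOf_X_of_ne (by decide)]

lemma Fibred.degreeOf_henon {χ : Aut3 k} (h : Fibred χ) :
    degreeOf 0 (henon (χ (X 1)) (χ (X 2))) = 4 * fdeg χ := by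
  have hD := isDegree_degreeOf (k := k) 0
  have h1 : χ (X 1 + 1) ≠ 0 := (map_ne_zero_iff χ χ.injective).2 fun h => by
    simpa using congrArg (eval 0) h
  have h0 : χ (X 1) ≠ 0 := (map_ne_zero_iff χ χ.injective).2 (X_ne_zero _)
  have h2 : χ (X 2) ≠ 0 := (map_ne_zero_iff χ χ.injective).2 (X_ne_zero _)
  have e : henon (χ (X 1)) (χ (X 2)) = χ (X 2) ^ 7 * (χ (X 1) ^ 3 * χ (X 1 + 1)) := by
    rw [henon, map_add, map_one]; ring
  have h3 : degreeOf 0 (χ (X 1 + 1)) = fdeg χ := by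
    rw [map_add, map_one, ← C_1, hD.add_C, fdeg]
  rw [e, hD.mul (pow_ne_zero _ h2) (mul_ne_zero (pow_ne_zero _ h0) h1),
    hD.mul (pow_ne_zero _ h0) h1, hD.pow, hD.pow, h.degreeOf_X_two, h3, fdeg]
  ring

lemma Fibred.fdeg_grow {χ : Aut3 k} (h : Fibred χ) :
    4 * fdeg χ ≤ fdeg (χ * henonAut k) ∨ 4 * fdeg χ ≤ fdeg (χ * (henonAut k)⁻¹) := by
  have := (isDegree_degreeOf (k := k) 0).add_le (χ (X 0))
    (henon (χ (X 1)) (χ (X 2)) - χ (X 0))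
  rwa [add_sub_cancel, h.degreeOf_henon, ← fdeg_mul_henonAut, ← fdeg_mul_henonAut_inv,
    le_max_iff] at this

lemma Fibred.fdeg_mul_henonAut_le {χ : Aut3 k} (h : Fibred χ) :
    fdeg (χ * henonAut k) ≤ max (4 * fdeg χ) (fdeg (χ * (henonAut k)⁻¹)) := by
  have := (isDegree_degreeOf (k := k) 0).sub_le (henon (χ (X 1)) (χ (X 2)))
    (henon (χ (X 1)) (χ (X 2)) - χ (X 0))
  rwa [sub_sub_cancel, h.degreeOf_henon, ← fdeg_mul_henonAut, ← fdeg_mul_henonAut_inv] at this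

variable [CharZero k]

lemma Fibred.fdeg_pos_of_eq_zero {χ : Aut3 k} (h : Fibred χ) (h0 : fdeg χ = 0) :
    1 ≤ fdeg (χ * henonAut k) := by
  by_contra! hlt
  rw [Nat.lt_one_iff, fdeg_mul_henonAut, ← pderiv_eq_zero_iff] at hlt
  rw [fdeg, ← pderiv_eq_zero_iff] at h0
  have h2 := pderiv_eq_zero_iff.2 h.degreeOf_X_two
  have := isUnit_jacDet χ
  rw [jacDet_eq] at this
  simp [wedge, hlt, h0, h2] at this

lemma Fibred.wave {χ : Aut3 k} (h : Fibred χ) : Wave fun l : ℤ => fdeg (χ * henonAut k ^ l) := by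
  have hg : ∀ l : ℤ, Fibred (χ * henonAut k ^ l) := fun l => h.mul (fibred_henonAut_zpow l)
  constructor
  · intro l
    simpa only [zpow_add_one, zpow_sub_one, mul_assoc] using (hg l).fdeg_grow
  · intro l hl
    have h1 := (hg l).fdeg_pos_of_eq_zero hl
    have h2 := (hg l).fdeg_mul_henonAut_le
    simp only [mul_assoc] at h1 h2
    simp only [zpow_add_one, zpow_sub_one]
    omega

lemma Fibred.fdeg_inv {χ : Aut3 k} (h : Fibred χ) : fdeg χ⁻¹ = fdeg χ :=
  le_antisymm (by simpa only [inv_inv, fdeg] using h.inv.degreeOf_X_one_le) h.degreeOf_X_one_le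

lemma fdeg_henonAut_zpow_le (l : ℤ) : fdeg (henonAut k ^ l) ≤ 4 ^ (l.natAbs - 1) := by
  have key : ∀ n : ℕ, fdeg (henonAut k ^ n) ≤ 4 ^ (n - 1) ∧ fdeg (henonAut k ^ (n + 1)) ≤ 4 ^ n := by
    intro n
    induction n with
    | zero =>
      simp [fdeg, degreeOf_X_of_ne (show (0 : Fin 3) ≠ 1 by decide)]
    | succ n ih =>
      refine ⟨ih.2, ?_⟩
      have := (fibred_henonAut_zpow (k := k) (n + 1 : ℕ)).fdeg_mul_henonAut_le
      rw [zpow_natCast, ← pow_succ, pow_succ (henonAut k) n, mul_inv_cancel_right,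
        ← pow_succ (henonAut k) n] at this
      have h2 : 4 ^ (n - 1) ≤ 4 ^ n := Nat.pow_le_pow_right (by norm_num) (Nat.sub_le _ _)
      rw [pow_succ 4]
      have := ih.1
      have := ih.2
      lia
  rcases Int.natAbs_eq l with h | h
  · have := (key l.natAbs).1
    rwa [← zpow_natCast, ← h] at this
  · have := (key l.natAbs).1
    rwa [← zpow_natCast, ← (fibred_henonAut_zpow _).fdeg_inv, ← zpow_neg, ← h] at this

lemma Fibred.mul_degreeOf_zero_le {χ : Aut3 k} (h : Fibred χ) (f : MvPolynomial (Fin 3) k) :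
    degreeOf 0 f * fdeg (χ * henonAut k) ≤
      degreeOf 0 (χ f) + degreeOf 1 f * (fdeg χ + fdeg (χ * henonAut k)) := by
  rcases Nat.eq_zero_or_pos (fdeg (χ * henonAut k)) with h0 | hpos
  · simp [h0]
  have hD := isDegree_degreeOf (k := k) 0
  have hp : ∀ f, degreeOf 0 (χ (pderiv 1 f)) ≤ degreeOf 0 (χ f) + fdeg (χ * henonAut k) := by
    intro f
    rw [← hD.unit_mul (isUnit_jacDet χ), jac_pderiv_one, hD.neg, fdeg_mul_henonAut]
    have hw : ∀ a b, degreeOf 0 (wedge a b (χ (X 0)) (χ (X 2))) ≤ degreeOf 0 (χ (X 0)) := by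
      intro a b
      have hm : ∀ a b, degreeOf 0 (pderiv a (χ (X 0)) * pderiv b (χ (X 2))) ≤
          degreeOf 0 (χ (X 0)) := by
        intro a b
        have h1 := hD.mul_le (pderiv a (χ (X 0))) (pderiv b (χ (X 2)))
        have h2 := degreeOf_pderiv_le 0 a (χ (X 0))
        have h3 := degreeOf_pderiv_le 0 b (χ (X 2))
        rw [h.degreeOf_X_two] at h3
        omega
      exact (hD.sub_le _ _).trans (max_le (hm _ _) (hm _ _))
    have key : ∀ i a b, degreeOf 0 (pderiv i (χ f) * wedge a b (χ (X 0)) (χ (X 2))) ≤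
        degreeOf 0 (χ f) + degreeOf 0 (χ (X 0)) := fun i a b =>
      (hD.mul_le _ _).trans (add_le_add (degreeOf_pderiv_le _ _ _) (hw _ _))
    exact (hD.add_le _ _).trans (max_le ((hD.sub_le _ _).trans (max_le (key _ _ _) (key _ _ _)))
      (key _ _ _))
  have hc : ∀ c, pderiv 1 c = 0 → pderiv 0 c ≠ 0 →
      degreeOf 0 (χ (pderiv 0 c)) + fdeg (χ * henonAut k) ≤ degreeOf 0 (χ c) + 0 := by
    intro c h1 h0
    have hX : pderiv 0 (χ (X 0)) ≠ 0 := by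
      rw [Ne, pderiv_eq_zero_iff, ← fdeg_mul_henonAut]; omega
    have hne : χ (pderiv 0 c) ≠ 0 := (map_ne_zero_iff χ χ.injective).2 h0
    have e : pderiv 0 (χ c) = χ (pderiv 0 c) * pderiv 0 (χ (X 0)) := by
      rw [pderiv_map, Fin.sum_univ_three, h1, pderiv_eq_zero_iff.2 h.degreeOf_X_two]
      simp
    have e' : pderiv 0 (χ c) ≠ 0 := e ▸ mul_ne_zero hne hX
    have h2 := congrArg (degreeOf 0) e
    rw [Ne, pderiv_eq_zero_iff] at e'
    rw [hD.mul hne hX, degreeOf_pderiv_self, degreeOf_pderiv_self, ← fdeg_mul_henonAut] at h2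
    omega
  have := (hD.comp χ).degreeOf_zero_mul_le hp (r := fdeg χ) le_rfl hc f
  rwa [mul_zero, zero_add, add_comm (fdeg (χ * henonAut k))] at this

lemma Fibred.mul_degreeOf_one_le {χ : Aut3 k} (h : Fibred χ) (f : MvPolynomial (Fin 3) k) :
    degreeOf 1 f * fdeg χ ≤
      degreeOf 0 (χ f) + degreeOf 0 f * (fdeg χ + fdeg (χ * henonAut k)) := by
  have := (h.mul (fibred_of_X2 swapAut_X2)).mul_degreeOf_zero_le (swapAut k f)
  rw [fdeg_mul_henonAut] at this ⊢
  simpa [fdeg, add_comm] using this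

end FibreDegree

section Rigidity

variable {k : Type} [Field k]

lemma pderiv_ofNat (i : Fin 3) (n : ℕ) [n.AtLeastTwo] :
    pderiv i (ofNat(n) : MvPolynomial (Fin 3) k) = 0 :=
  (pderiv i).map_natCast n

variable [CharZero k]

lemma henon_rigid {a b c c₀ e : k} (ha : a ≠ 0) (hc₀ : c₀ ≠ 0) {μ ν : MvPolynomial (Fin 3) k}
    (hμ : InBase μ) (hν : InBase ν)
    (h : henon (C c₀ * X 1 + μ) (C a * X 2 + C b) = C c * henon (X 1) (X 2) + C e * X 0 + ν) :
    c₀ = 1 ∧ μ = 0 ∧ b = 0 ∧ c = a ^ 7 ∧ e = 0 := by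
  have hμ1 := hμ.2
  have he : e = 0 := by
    have := congrArg (pderiv 0) h
    simpa [henon, hμ.1, hν.1, pderiv_X] using this.symm
  subst he
  set T : MvPolynomial (Fin 3) k := (C a * X 2 + C b) ^ 7 with hT
  set s : MvPolynomial (Fin 3) k := C c * X 2 ^ 7 with hs
  have hT1 : pderiv 1 T = 0 := by simp [hT, pderiv_X]
  have hs1 : pderiv 1 s = 0 := by simp [hs, pderiv_X]
  have hT0 : T ≠ 0 := by
    apply pow_ne_zero
    intro h
    have := congrArg (pderiv 2) h
    simp [pderiv_X, ha] at this
  set w : MvPolynomial (Fin 3) k := C c₀ with hw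
  have hw0 : w ≠ 0 := by simpa [hw] using hc₀
  have hw1 : pderiv 1 w = 0 := by simp [hw]
  have e0 : T * ((w * X 1 + μ) ^ 4 + (w * X 1 + μ) ^ 3) = s * (X 1 ^ 4 + X 1 ^ 3) + ν := by
    rw [hT, hs]
    simp only [henon, C_0] at h
    linear_combination h
  clear_value T s w
  have h1 : T * (4 * w * (w * X 1 + μ) ^ 3 + 3 * w * (w * X 1 + μ) ^ 2) =
      s * (4 * X 1 ^ 3 + 3 * X 1 ^ 2) := by
    have := congrArg (pderiv 1) e0
    simp only [Derivation.leibniz, Derivation.leibniz_pow, map_add, hT1, hs1, hw1, hμ1, hν.2,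
      pderiv_X_self, smul_eq_mul, nsmul_eq_mul] at this
    push_cast at this
    linear_combination this
  have h2 : T * (12 * w ^ 2 * (w * X 1 + μ) ^ 2 + 6 * w ^ 2 * (w * X 1 + μ)) =
      s * (12 * X 1 ^ 2 + 6 * X 1) := by
    have := congrArg (pderiv 1) h1
    simp only [Derivation.leibniz, Derivation.leibniz_pow, map_add, hT1, hs1, hw1, hμ1,
      pderiv_X_self, smul_eq_mul, nsmul_eq_mul, pderiv_ofNat] at this
    push_cast at this
    linear_combination this
  have h3 : T * (24 * w ^ 3 * (w * X 1 + μ) + 6 * w ^ 3) = s * (24 * X 1 + 6) := by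
    have := congrArg (pderiv 1) h2
    simp only [Derivation.leibniz, Derivation.leibniz_pow, map_add, hT1, hs1, hw1, hμ1,
      pderiv_X_self, smul_eq_mul, nsmul_eq_mul, pderiv_ofNat] at this
    push_cast at this
    linear_combination this
  have h4 : T * w ^ 4 = s := by
    have := congrArg (pderiv 1) h3
    simp only [Derivation.leibniz, Derivation.leibniz_pow, map_add, hT1, hs1, hw1, hμ1,
      pderiv_X_self, smul_eq_mul, nsmul_eq_mul, pderiv_ofNat] at this
    push_cast at this
    have h24 : (24 : MvPolynomial (Fin 3) k) ≠ 0 := by norm_num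
    apply mul_left_cancel₀ h24
    linear_combination this
  have e1 : w = 4 * μ + 1 := by
    have h6 : (6 : MvPolynomial (Fin 3) k) ≠ 0 := by norm_num
    apply mul_left_cancel₀ (mul_ne_zero (mul_ne_zero h6 hT0) (pow_ne_zero 3 hw0))
    linear_combination (24 * X 1 + 6) * h4 - h3
  have e2 : μ * (2 * μ + 1) = 0 := by
    have h6 : (6 : MvPolynomial (Fin 3) k) ≠ 0 := by norm_num
    apply mul_left_cancel₀ (mul_ne_zero (mul_ne_zero h6 hT0) (pow_ne_zero 2 hw0))
    linear_combination h2 - (12 * X 1 ^ 2 + 6 * X 1) * h4 + 6 * T * w ^ 3 * X 1 * e1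
  have e3 : μ ^ 2 * (4 * μ + 3) = 0 := by
    apply mul_left_cancel₀ (mul_ne_zero hT0 hw0)
    linear_combination h1 - (4 * X 1 ^ 3 + 3 * X 1 ^ 2) * h4 + 3 * T * w ^ 3 * X 1 ^ 2 * e1 -
      6 * T * w ^ 2 * X 1 * e2
  have hμ0 : μ = 0 := by
    rcases mul_eq_zero.1 e3 with h | h
    · exact pow_eq_zero_iff two_ne_zero |>.1 h
    · rcases mul_eq_zero.1 e2 with h' | h'
      · exact h'
      · exfalso
        have : (1 : MvPolynomial (Fin 3) k) = 0 := by linear_combination h - 2 * h'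
        exact one_ne_zero this
  have hc1 : c₀ = 1 := by
    rw [hμ0, mul_zero, zero_add, hw, ← C_1] at e1
    exact C_injective _ _ e1
  rw [hw, hc1, C_1, one_pow, mul_one, hT, hs] at h4
  have hb : b = 0 := by
    have := congrArg (eval 0) h4
    simpa using this
  refine ⟨hc1, hμ0, hb, ?_, rfl⟩
  have := congrArg (eval 1) h4
  simpa [hb, eq_comm] using this

section Shift

variable {G : Type*} [Group G] (g ψ : G) (i l : ℤ)

lemma conj_shift : g⁻¹ * (g ^ (-i) * ψ * g ^ l) * g = g ^ (-(i + 1)) * ψ * g ^ (l + 1) := by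
  group

lemma conj_shift_inv : g * (g ^ (-(i + 1)) * ψ * g ^ (l + 1)) * g⁻¹ = g ^ (-i) * ψ * g ^ l := by
  group

lemma mul_shift_mul : g * (g ^ (-(i + 1)) * ψ * g ^ (l - 1)) * g = g ^ (-i) * ψ * g ^ l := by
  group

lemma mul_shift_mul_inv :
    g⁻¹ * (g ^ (-i) * ψ * g ^ l) * g⁻¹ = g ^ (-(i + 1)) * ψ * g ^ (l - 1) := by
  group

end Shift

/-- The fibre degrees of `ψ` between the `i`-th and the `l`-th direction of the axis. -/
noncomputable def fdeg₂ (ψ : Aut3 k) (i l : ℤ) : ℕ := fdeg (henonAut k ^ (-i) * ψ * henonAut k ^ l)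

namespace Fibred

variable {ψ : Aut3 k} (hψ : Fibred ψ)

include hψ

lemma fdeg₂_inv (i l : ℤ) : fdeg₂ ψ⁻¹ i l = fdeg₂ ψ l i := by
  rw [fdeg₂, fdeg₂, ← (hψ.shift l i).fdeg_inv]
  congr 1
  simp only [mul_inv_rev, zpow_neg, inv_inv, mul_assoc]

lemma wave_right (i : ℤ) : Wave fun l => fdeg₂ ψ i l :=
  ((fibred_henonAut_zpow (-i)).mul hψ).wave

lemma wave_left (l : ℤ) : Wave fun i => fdeg₂ ψ i l := by
  have := hψ.inv.wave_right l
  simpa only [hψ.fdeg₂_inv] using this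

lemma exists_fdeg₂_eq_zero {i l₁ l₂ : ℤ} (h₁ : Inc (fdeg₂ ψ · l₁) i) (h₂ : Dec (fdeg₂ ψ · l₂) i) :
    (∃ l, fdeg₂ ψ i l = 0) ∧ ∃ l, fdeg₂ ψ (i + 1) l = 0 := by
  have hne : l₁ ≠ l₂ := by
    rintro rfl
    exact h₁.not_dec h₂
  have key := (hψ.inv.shift l₁ i).mul_degreeOf_zero_le
    ((henonAut k ^ (-i) * ψ * henonAut k ^ l₂) (X 1))
  have e1 : degreeOf 1 ((henonAut k ^ (-i) * ψ * henonAut k ^ l₂) (X 1)) = fdeg₂ ψ (i + 1) l₂ := by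
    rw [← degreeOf_zero_henonAut_inv, ← AlgEquiv.mul_apply, ← mul_assoc, ← mul_assoc,
      ← zpow_neg_one, ← zpow_add, ← neg_add_rev]
    rfl
  have e2 : fdeg (henonAut k ^ (-l₁) * ψ⁻¹ * henonAut k ^ i) = fdeg₂ ψ i l₁ := hψ.fdeg₂_inv l₁ i
  have e3 : fdeg (henonAut k ^ (-l₁) * ψ⁻¹ * henonAut k ^ i * henonAut k) = fdeg₂ ψ (i + 1) l₁ := by
    rw [mul_assoc, ← zpow_add_one]
    exact hψ.fdeg₂_inv l₁ (i + 1)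
  have e4 : degreeOf 0 ((henonAut k ^ (-l₁) * ψ⁻¹ * henonAut k ^ i)
      ((henonAut k ^ (-i) * ψ * henonAut k ^ l₂) (X 1))) ≤ 4 ^ ((l₂ - l₁).natAbs - 1) := by
    rw [← AlgEquiv.mul_apply]
    have : henonAut k ^ (-l₁) * ψ⁻¹ * henonAut k ^ i * (henonAut k ^ (-i) * ψ * henonAut k ^ l₂) =
        henonAut k ^ (l₂ - l₁) := by
      rw [zpow_sub, (Commute.zpow_zpow_self _ _ _).inv_right.eq]
      simp only [zpow_neg]
      group
    rw [this]
    exact fdeg_henonAut_zpow_le _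
  rw [e1, e2, e3] at key
  change fdeg₂ ψ i l₂ * _ ≤ _ at key
  obtain ⟨h₁, h₁'⟩ := h₁
  obtain ⟨h₂, h₂'⟩ := h₂
  constructor
  · by_contra! h0
    have := (hψ.wave_right i).pow_le_mul' h0 hne
    simp only at *
    nlinarith
  · by_contra! h0
    have := (hψ.wave_right (i + 1)).pow_le_mul' h0 hne
    simp only at *
    nlinarith

lemma exists_map_X_one (h : fdeg ψ = 0) :
    ∃ c : k, c ≠ 0 ∧ ∃ μ, InBase μ ∧ ψ (X 1) = C c * X 1 + μ := by
  obtain ⟨a, b, ha, h2⟩ := hψ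
  have hJ := isUnit_jacDet ψ
  rw [fdeg, ← pderiv_eq_zero_iff] at h
  have h2' : ∀ i, pderiv i (ψ (X 2)) = if i = 2 then C a else 0 := by
    intro i
    rw [h2]
    fin_cases i <;> simp [pderiv_X]
  simp only [jacDet_eq, wedge, h, h2'] at hJ
  simp only [Fin.reduceEq, if_true, if_false, mul_zero, zero_mul, sub_zero, add_zero] at hJ
  obtain ⟨c, hc, hc'⟩ := isUnit_iff_eq_C_of_isReduced.1
    (isUnit_of_mul_isUnit_left (isUnit_of_mul_isUnit_right hJ))
  exact ⟨c, hc.ne_zero, ψ (X 1) - C c * X 1, ⟨by simp [h, pderiv_X], by simp [hc', pderiv_X]⟩,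
    by ring⟩

lemma map_of_fdeg_eq_zero (h0 : fdeg ψ = 0) (hm : fdeg (henonAut k * ψ * (henonAut k)⁻¹) = 0)
    (hp : fdeg ((henonAut k)⁻¹ * ψ * henonAut k) = 0) :
    ψ (X 1) = X 1 ∧ ∃ a : k, ψ (X 2) = C a * X 2 ∧
      ∃ μ, InBase μ ∧ ψ (X 0) = C (a ^ 7) * X 0 + μ := by
  have hg : Fibred (henonAut k) := fibred_of_X2 henonAut_X2
  obtain ⟨a, b, ha, h2⟩ := id hψ
  obtain ⟨c₀, hc₀, μ₀, hμ₀, h1⟩ := hψ.exists_map_X_one h0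
  obtain ⟨c, -, μ, hμ, hc⟩ := ((hg.mul hψ).mul hg.inv).exists_map_X_one hm
  obtain ⟨c', -, μ', hμ', hc'⟩ := ((hg.inv.mul hψ).mul hg).exists_map_X_one hp
  have e0 : ψ (X 0) = C c' * X 0 + henonAut k μ' := by
    have := congrArg (henonAut k) hc'
    rw [← AlgEquiv.mul_apply, mul_assoc, mul_inv_cancel_left] at this
    simpa [map_C] using this
  have e1 : henon (ψ (X 1)) (ψ (X 2)) - ψ (X 0) =
      C c * (henon (X 1) (X 2) - X 0) + (henonAut k)⁻¹ μ := by
    have := congrArg ((henonAut k)⁻¹ : Aut3 k) hc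
    rw [← AlgEquiv.mul_apply, mul_assoc, inv_mul_cancel_left] at this
    simpa only [AlgEquiv.mul_apply, map_add, map_mul, map_C, henonAut_inv_X1, map_sub,
      map_henon] using this
  have hν : InBase (henonAut k μ' + (henonAut k)⁻¹ μ) := by
    have i1 := hμ'.of_map (φ := henonAut k) (by simp [pderiv_X]) (by simp [pderiv_X])
    have i2 := hμ.of_map (φ := (henonAut k)⁻¹) (by simp [pderiv_X]) (by simp [pderiv_X])
    exact ⟨by rw [map_add, i1.1, i2.1, add_zero], by rw [map_add, i1.2, i2.2, add_zero]⟩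
  obtain ⟨r1, r2, r3, r4, r5⟩ := henon_rigid (c := c) (e := c' - c) ha hc₀ hμ₀ hν (by
    rw [← h1, ← h2, C_sub]
    linear_combination e0 + e1)
  refine ⟨by simp [h1, r1, r2], a, by simp [h2, r3], _,
    hμ'.of_map (φ := henonAut k) (by simp [pderiv_X]) (by simp [pderiv_X]), ?_⟩
  rw [e0, sub_eq_zero.1 r5, r4]

lemma eq_one_of_fdeg_eq_zero (hJ : jacDet k ψ = 1 ∨ jacDet k ψ = -1) (h0 : fdeg ψ = 0)
    (hm : fdeg (henonAut k * ψ * (henonAut k)⁻¹) = 0)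
    (hp : fdeg ((henonAut k)⁻¹ * ψ * henonAut k) = 0)
    (hpp : fdeg ((henonAut k)⁻¹ * ((henonAut k)⁻¹ * ψ * henonAut k) * henonAut k) = 0) :
    ψ = 1 := by
  have hg : Fibred (henonAut k) := fibred_of_X2 henonAut_X2
  obtain ⟨h1, a, h2, μ, hμ, hX0⟩ := hψ.map_of_fdeg_eq_zero h0 hm hp
  obtain ⟨h1', -⟩ := ((hg.inv.mul hψ).mul hg).map_of_fdeg_eq_zero hp (by
    convert h0 using 2
    group) hpp
  have hX0' : ψ (X 0) = X 0 := by
    have := congrArg (henonAut k) h1'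
    rw [← AlgEquiv.mul_apply, mul_assoc, mul_inv_cancel_left] at this
    simpa using this
  have ha7 : a ^ 7 = 1 := by
    have := congrArg (pderiv 0) hX0
    rw [hX0', map_add, hμ.1] at this
    apply C_injective (Fin 3) k
    simpa [pderiv_X] using this.symm
  have ha : a = 1 ∨ a = -1 := by
    have : jacDet k ψ = C a := by
      simp [jacDet_eq, wedge, hX0', h1, h2, pderiv_X]
    rw [this] at hJ
    refine hJ.imp (fun h => C_injective (Fin 3) k (by simpa using h))
      fun h => C_injective (Fin 3) k (by simpa using h)
  rcases ha with rfl | rfl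
  · apply aut_ext <;> simp [hX0', h1, h2]
  · exfalso
    norm_num at ha7

lemma eq_or_eq_of_fdeg₂_eq_zero {i l l' : ℤ} (h : fdeg₂ ψ i l = 0) (h' : fdeg₂ ψ (i + 1) l' = 0) :
    l' = l + 1 ∨ l' = l - 1 := by
  have hl : fdeg₂ ψ (i + 1) l ≤ 1 := by
    have e : fdeg₂ ψ (i + 1) l = degreeOf 1 ((henonAut k ^ (-i) * ψ * henonAut k ^ l) (X 1)) := by
      rw [← degreeOf_zero_henonAut_inv, ← AlgEquiv.mul_apply, ← mul_assoc, ← mul_assoc,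
        ← zpow_neg_one, ← zpow_add, ← neg_add_rev]
      rfl
    obtain ⟨c, -, μ, hμ, hc⟩ := (hψ.shift i l).exists_map_X_one h
    have hD := isDegree_degreeOf (k := k) 1
    rw [e, hc]
    refine (hD.add_le _ _).trans (max_le ((hD.C_mul_le _ _).trans ?_) ?_)
    · simp
    · rw [pderiv_eq_zero_iff.1 hμ.2]
      exact Nat.zero_le _
  have hne : l ≠ l' := by
    rintro rfl
    have := ((hψ.wave_left l).zero i h).1
    omega
  have h2 := ((hψ.wave_right (i + 1)).pow_le_of_zero' h' hne).trans hl
  have h3 : (l - l').natAbs - 1 = 0 := by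
    by_contra h0
    have := Nat.one_lt_pow h0 (show 1 < 4 by norm_num)
    omega
  omega

lemma ne_of_fdeg₂_eq_zero {i l l' : ℤ} (h : fdeg₂ ψ i l = 0) (h' : fdeg₂ ψ (i + 1 + 1) l' = 0) :
    l' ≠ l := by
  rintro rfl
  have := (hψ.wave_left l').pow_le_of_zero h 1
  simp only [Nat.cast_add, Nat.cast_one, ← add_assoc, h'] at this
  norm_num at this

lemma inc_of_inc (hJ : jacDet k ψ = 1) (hz : ψ ∉ Subgroup.zpowers (henonAut k)) {i l₁ : ℤ}
    (h : Inc (fdeg₂ ψ · l₁) i) (l₂ : ℤ) : Inc (fdeg₂ ψ · l₂) (i + 3) := by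
  by_contra hn
  have hd : Dec (fdeg₂ ψ · l₂) (i + 2) :=
    ((hψ.wave_left l₂).inc_or_dec (i + 2)).resolve_left fun h' => hn (by convert h' using 1; ring)
  obtain ⟨⟨m₀, z₀⟩, m₁, z₁⟩ := hψ.exists_fdeg₂_eq_zero h
    ((hψ.wave_left l₂).dec_of_le hd (by omega : i ≤ i + 2))
  obtain ⟨⟨m₂, z₂⟩, m₃, z₃⟩ := hψ.exists_fdeg₂_eq_zero
    ((hψ.wave_left l₁).inc_of_le h (by omega : i ≤ i + 2)) hd
  rw [show i + 2 = i + 1 + 1 by ring] at z₂ z₃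
  have s₀ := hψ.eq_or_eq_of_fdeg₂_eq_zero z₀ z₁
  have s₁ := hψ.eq_or_eq_of_fdeg₂_eq_zero z₁ z₂
  have s₂ := hψ.eq_or_eq_of_fdeg₂_eq_zero z₂ z₃
  have t₀ := hψ.ne_of_fdeg₂_eq_zero z₀ z₂
  have t₁ := hψ.ne_of_fdeg₂_eq_zero z₁ z₃
  have hχJ : ∀ l : ℤ, jacDet k (henonAut k ^ (-(i + 1)) * ψ * henonAut k ^ l) = 1 := fun l => by
    simp only [jacDet_mul, jacDet_henonAut_zpow, hJ, map_one, mul_one]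
  rcases s₀ with rfl | rfl
  · obtain rfl : m₂ = m₀ + 1 + 1 := by omega
    obtain rfl : m₃ = m₀ + 1 + 1 + 1 := by omega
    have := (hψ.shift (i + 1) (m₀ + 1)).eq_one_of_fdeg_eq_zero (.inl (hχJ _)) z₁
      (by rwa [conj_shift_inv]) (by rwa [conj_shift]) (by rwa [conj_shift, conj_shift])
    refine hz ⟨i - m₀, ?_⟩
    calc henonAut k ^ (i - m₀)
        = henonAut k ^ (i + 1) * 1 * henonAut k ^ (-(m₀ + 1)) := by group
      _ = ψ := by rw [← this]; group
  · obtain rfl : m₂ = m₀ - 1 - 1 := by omega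
    obtain rfl : m₃ = m₀ - 1 - 1 - 1 := by omega
    have hflip : ∀ χ : Aut3 k, fdeg (χ * flipAut k) = fdeg χ := fun χ => by simp [fdeg]
    have hfg : ∀ χ : Aut3 k, (henonAut k)⁻¹ * (χ * flipAut k) * henonAut k =
        (henonAut k)⁻¹ * χ * (henonAut k)⁻¹ * flipAut k := fun χ => by
      simp [henonAut, mul_assoc]
    have hfg' : ∀ χ : Aut3 k, henonAut k * (χ * flipAut k) * (henonAut k)⁻¹ =
        henonAut k * χ * henonAut k * flipAut k := fun χ => by
      simp [henonAut, mul_assoc, ← mul_assoc (flipAut k) (flipAut k)]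
    have hJ' : jacDet k (henonAut k ^ (-(i + 1)) * ψ * henonAut k ^ (m₀ - 1) * flipAut k) = -1 := by
      rw [jacDet_mul, hχJ, jacDet_flipAut]
      simp
    have := ((hψ.shift (i + 1) (m₀ - 1)).mul
      (fibred_of_X2 (flipAut_X2 (k := k)))).eq_one_of_fdeg_eq_zero (.inr hJ')
      (by rwa [hflip])
      (by rwa [hfg', mul_shift_mul, hflip])
      (by rwa [hfg, mul_shift_mul_inv, hflip])
      (by rwa [hfg, mul_shift_mul_inv, hfg, mul_shift_mul_inv, hflip])
    rw [this, jacDet_one] at hJ'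
    have := congrArg (eval 0) hJ'
    norm_num at this

end Fibred

end Rigidity

section Links

variable {k : Type} [Field k]

lemma totalDegree_map_map_inv_X_le (φ : Aut3 k) (i : Fin 3) :
    totalDegree (φ (φ⁻¹ (X i))) ≤ totalDegree (φ (X 2)) := by
  rw [← AlgEquiv.mul_apply, mul_inv_cancel, AlgEquiv.one_apply, totalDegree_X]
  exact totalDegree_map_X_pos φ 2

lemma Fibred.map_inBase {χ : Aut3 k} (h : Fibred χ) {f : MvPolynomial (Fin 3) k} (hf : InBase f) :
    InBase (χ f) := by
  obtain ⟨a, b, -, h⟩ := h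
  exact hf.of_map (by simp [h, pderiv_X]) (by simp [h, pderiv_X])

variable [CharZero k]

lemma InBase.dirDeg {f : MvPolynomial (Fin 3) k} (hf : InBase f) (i : ℤ) : dirDeg i f = 0 :=
  pderiv_eq_zero_iff.1 ((fibred_henonAut_zpow (-i)).map_inBase hf).1

namespace Fibred

variable {ψ : Aut3 k} (hψ : Fibred ψ)

include hψ

lemma not_inBase_map_X_one : ¬ InBase (ψ (X 1)) := by
  intro h
  have := (hψ.inv.map_inBase h).2
  rw [← AlgEquiv.mul_apply, inv_mul_cancel] at this
  simp at this

lemma inc_of_coord_le (hJ : jacDet k ψ = 1) (hz : ψ ∉ Subgroup.zpowers (henonAut k)) {j : ℤ}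
    (hj : coord ψ⁻¹ + 4 ≤ j) (l : ℤ) : Inc (fdeg₂ ψ · l) j := by
  have hlow : totalDegree (ψ⁻¹ (ψ (X 1))) ≤ totalDegree (ψ⁻¹ (X 2)) := by
    simpa only [inv_inv] using totalDegree_map_map_inv_X_le ψ⁻¹ 1
  have h := dirDeg_lt_of_coord_le hlow hψ.not_inBase_map_X_one le_rfl
  have h0 : ∀ i, dirDeg i (ψ (X 1)) = fdeg₂ ψ i 0 := fun i => by simp [fdeg₂, fdeg, dirDeg]
  rw [h0, h0] at h
  have h1 : Inc (fdeg₂ ψ · 0) (coord ψ⁻¹ + 1) :=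
    ((hψ.wave_left 0).inc_or_dec _).resolve_right fun hd => by
      have := hd.1
      simp only at this
      omega
  exact (hψ.wave_left l).inc_of_le (hψ.inc_of_inc hJ hz h1 l) (by omega)

lemma dec_of_le_coord (hJ : jacDet k ψ = 1) (hz : ψ ∉ Subgroup.zpowers (henonAut k)) {j : ℤ}
    (hj : j + 6 ≤ coord ψ⁻¹) (l : ℤ) : Dec (fdeg₂ ψ · l) j := by
  have hlow : totalDegree (ψ⁻¹ (ψ (X 1))) ≤ totalDegree (ψ⁻¹ (X 2)) := by
    simpa only [inv_inv] using totalDegree_map_map_inv_X_le ψ⁻¹ 1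
  have h := dirDeg_lt_of_lt_coord hlow hψ.not_inBase_map_X_one (i := j + 1 + 3 + 1) (by omega)
  have h0 : ∀ i, dirDeg i (ψ (X 1)) = fdeg₂ ψ i 0 := fun i => by simp [fdeg₂, fdeg, dirDeg]
  rw [h0, h0, add_sub_cancel_right] at h
  refine ((hψ.wave_left l).inc_or_dec j).resolve_left fun hi => ?_
  have := (hψ.inc_of_inc hJ hz hi 0).1
  simp only at this
  omega

lemma dirDeg_lt_of_dec {l i : ℤ} {f : MvPolynomial (Fin 3) k}
    (hd : Dec (fdeg₂ ψ · l) (i + 3)) (hf : dirDeg i f < 2 * dirDeg (i + 1) f) :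
    dirDeg (i + 2) f < dirDeg l (ψ⁻¹ f) := by
  have hconv := dirDeg_convex (i + 1) f
  have key := (hψ.inv.shift l (i + 1)).mul_degreeOf_one_le ((henonAut k ^ (-(i + 1))) f)
  rw [mul_assoc _ _ (henonAut k), ← zpow_add_one, ← dirDeg_add_one, ← AlgEquiv.mul_apply,
    mul_assoc _ _ (henonAut k ^ (-(i + 1))), ← zpow_add, add_neg_cancel, zpow_zero, mul_one] at key
  have e0 : fdeg (henonAut k ^ (-l) * ψ⁻¹ * henonAut k ^ (i + 1)) = fdeg₂ ψ (i + 1) l :=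
    hψ.fdeg₂_inv l (i + 1)
  have e1 : fdeg (henonAut k ^ (-l) * ψ⁻¹ * henonAut k ^ (i + 1 + 1)) = fdeg₂ ψ (i + 1 + 1) l :=
    hψ.fdeg₂_inv l (i + 1 + 1)
  rw [e0, e1] at key
  change dirDeg (i + 1 + 1) f * _ ≤ dirDeg l (ψ⁻¹ f) + dirDeg (i + 1) f * _ at key
  have d1 := ((hψ.wave_left l).dec_of_le hd (show i + 1 ≤ i + 3 by omega)).1
  have d2 := ((hψ.wave_left l).dec_of_le hd (show i + 1 + 1 ≤ i + 3 by omega)).1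
  have d3 := hd.2
  rw [show i + 1 + 1 + 1 = i + 3 by ring] at d2
  rw [add_sub_cancel_right] at hconv
  rw [show i + 1 + 1 = i + 2 by ring] at *
  simp only at d1 d2 d3
  generalize fdeg₂ ψ (i + 1) l = A at *
  generalize fdeg₂ ψ (i + 2) l = B at *
  generalize dirDeg (i + 1) f = x at *
  generalize dirDeg (i + 2) f = y at *
  have hA : 16 ≤ A := by omega
  have h1 : 4 * (x * B) ≤ x * A := by nlinarith
  have h2 : 2 * (x * A) ≤ y * A := by nlinarith
  have h3 : 16 * y ≤ y * A := by nlinarith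
  lia

lemma dirDeg_lt_of_inc {l i : ℤ} {f : MvPolynomial (Fin 3) k}
    (hi : Inc (fdeg₂ ψ · l) (i - 4)) (hf : dirDeg i f < 2 * dirDeg (i - 1) f) :
    dirDeg (i - 2) f < dirDeg l (ψ⁻¹ f) := by
  have hconv := dirDeg_convex (i - 1) f
  have key := (hψ.inv.shift l (i - 2)).mul_degreeOf_zero_le ((henonAut k ^ (-(i - 2))) f)
  rw [mul_assoc _ _ (henonAut k), ← zpow_add_one, ← dirDeg_add_one, ← AlgEquiv.mul_apply,
    mul_assoc _ _ (henonAut k ^ (-(i - 2))), ← zpow_add, add_neg_cancel, zpow_zero, mul_one] at key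
  have e0 : fdeg (henonAut k ^ (-l) * ψ⁻¹ * henonAut k ^ (i - 2)) = fdeg₂ ψ (i - 2) l :=
    hψ.fdeg₂_inv l (i - 2)
  have e1 : fdeg (henonAut k ^ (-l) * ψ⁻¹ * henonAut k ^ (i - 2 + 1)) = fdeg₂ ψ (i - 2 + 1) l :=
    hψ.fdeg₂_inv l (i - 2 + 1)
  rw [e0, e1] at key
  change dirDeg (i - 2) f * _ ≤ dirDeg l (ψ⁻¹ f) + _ at key
  have d1 := ((hψ.wave_left l).inc_of_le hi (show i - 4 ≤ i - 2 by omega)).1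
  have d2 := ((hψ.wave_left l).inc_of_le hi (show i - 4 ≤ i - 3 by omega)).1
  have d3 := hi.2
  rw [show i - 3 + 1 = i - 2 by ring] at d2
  rw [show i - 4 + 1 = i - 3 by ring] at d3
  rw [show i - 1 - 1 = i - 2 by ring, sub_add_cancel] at hconv
  rw [show i - 2 + 1 = i - 1 by ring] at *
  simp only at d1 d2 d3
  generalize fdeg₂ ψ (i - 2) l = A at *
  generalize fdeg₂ ψ (i - 1) l = B at *
  generalize dirDeg (i - 1) f = x at *
  generalize dirDeg (i - 2) f = y at *
  have hB : 16 ≤ B := by omega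
  have h1 : 4 * (x * A) ≤ x * B := by nlinarith
  have h2 : 2 * (x * B) ≤ y * B := by nlinarith
  have h3 : 16 * y ≤ y * B := by nlinarith
  lia

end Fibred

end Links

section Rank

variable {k : Type} [Field k]

/-- The least total degree of the three coordinates over all directions of the axis. -/
noncomputable def spread (τ : Aut3 k) : ℕ := ⨅ i : ℤ, ∑ x, dirDeg i (τ⁻¹ (X x))

/-- Automorphisms are compared by the degree of the image of `x₃` first. -/
noncomputable def rank (τ : Aut3 k) : ℕ ×ₗ ℕ := toLex (totalDegree (τ (X 2)), spread τ)

lemma spread_mul_henonAut (τ : Aut3 k) : spread (τ * henonAut k) = spread τ := by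
  rw [spread, ← (Equiv.subRight (1 : ℤ)).iInf_comp, spread]
  refine iInf_congr fun i => Finset.sum_congr rfl fun x _ => ?_
  rw [dirDeg, dirDeg, mul_inv_rev, AlgEquiv.mul_apply, ← AlgEquiv.mul_apply, ← zpow_neg_one,
    ← zpow_add]
  congr 3
  simp only [Equiv.subRight_apply, neg_sub]
  ring

lemma rank_mul_henonAut (τ : Aut3 k) : rank (τ * henonAut k) = rank τ := by
  rw [rank, rank, spread_mul_henonAut, AlgEquiv.mul_apply, henonAut_X2]

variable [CharZero k]

lemma exists_not_inBase (τ : Aut3 k) : ∃ x, ¬ InBase (τ (X x)) := by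
  by_contra! h
  have := isUnit_jacDet τ
  simp [jacDet, Matrix.det_fin_three, (h _).1] at this

lemma fibred_of_inBase {ψ : Aut3 k} (h : InBase (ψ (X 2))) : Fibred ψ := by
  have hJ := isUnit_jacDet ψ
  have : jacDet k ψ = pderiv 2 (ψ (X 2)) * wedge 0 1 (ψ (X 0)) (ψ (X 1)) := by
    simp only [jacDet_eq, wedge, h.1, h.2]
    ring
  rw [this] at hJ
  obtain ⟨a, ha, ha'⟩ := isUnit_iff_eq_C_of_isReduced.1 (isUnit_of_mul_isUnit_left hJ)
  have hd : ∀ i, degreeOf i (ψ (X 2) - C a * X 2) = 0 := by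
    intro i
    rw [← pderiv_eq_zero_iff]
    fin_cases i
    · simp [h.1, pderiv_X]
    · simp [h.2, pderiv_X]
    · simp [ha', pderiv_X]
  have h0 : totalDegree (ψ (X 2) - C a * X 2) = 0 := by
    rw [totalDegree_eq_zero_iff]
    intro m hm i
    have := monomial_le_degreeOf i hm
    rw [hd] at this
    omega
  exact ⟨a, _, ha.ne_zero, by rw [← totalDegree_eq_zero_iff_eq_C.1 h0]; ring⟩

lemma spread_lt_of_forall {τ ψ : Aut3 k} {i : ℤ} (h : ∀ l x, ¬ InBase (τ⁻¹ (X x)) →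
    dirDeg i (τ⁻¹ (X x)) < dirDeg l (ψ⁻¹ (τ⁻¹ (X x)))) : spread τ < spread (τ * ψ) := by
  obtain ⟨l, hl⟩ := Nat.sInf_mem (Set.range_nonempty fun l : ℤ =>
    ∑ x, dirDeg l ((τ * ψ)⁻¹ (X x : MvPolynomial (Fin 3) k)))
  rw [spread, spread, iInf, iInf, ← hl]
  refine (Nat.sInf_le (Set.mem_range_self i)).trans_lt ?_
  simp only [mul_inv_rev, AlgEquiv.mul_apply]
  obtain ⟨x, hx⟩ := exists_not_inBase τ⁻¹
  refine Finset.sum_lt_sum (fun y _ => ?_) ⟨x, Finset.mem_univ x, h l x hx⟩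
  by_cases hy : InBase (τ⁻¹ (X y))
  · rw [hy.dirDeg]
    exact Nat.zero_le _
  · exact (h l y hy).le

lemma rank_lt_rank {τ τ' : Aut3 k} (hJ : jacDet k τ = 1) (hJ' : jacDet k τ' = 1)
    (hz : τ⁻¹ * τ' ∉ Subgroup.zpowers (henonAut k))
    (hc : 10 < (coord τ - coord (τ'⁻¹ * τ)).natAbs) : rank τ < rank τ' := by
  obtain ⟨ψ, rfl⟩ : ∃ ψ, τ' = τ * ψ := ⟨τ⁻¹ * τ', by simp⟩
  rw [inv_mul_cancel_left] at hz
  rw [mul_inv_rev, inv_mul_cancel_right] at hc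
  rw [jacDet_mul, hJ, mul_one] at hJ'
  have hψJ : jacDet k ψ = 1 := τ.injective (hJ'.trans (map_one τ).symm)
  rw [rank, rank, Prod.Lex.toLex_lt_toLex]
  by_cases hB : InBase (ψ (X 2))
  · right
    have hψ := fibred_of_inBase hB
    constructor
    · obtain ⟨a, b, ha, h⟩ := hψ
      simp only [AlgEquiv.mul_apply]
      rw [h]
      exact ((isDegree_totalDegree.comp τ).affine ha b (X 2)).symm
    · have hlow := totalDegree_map_map_inv_X_le τ
      rcases lt_or_ge (coord τ) (coord ψ⁻¹) with hlt | hge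
      · exact spread_lt_of_forall fun l x hx => hψ.dirDeg_lt_of_dec (i := coord τ)
          (hψ.dec_of_le_coord hψJ hz (by omega) l) (dirDeg_lt_of_coord_le (hlow x) hx le_rfl)
      · exact spread_lt_of_forall fun l x hx => hψ.dirDeg_lt_of_inc (i := coord τ - 1)
          (hψ.inc_of_coord_le hψJ hz (by omega) l)
          (dirDeg_lt_of_lt_coord (hlow x) hx (by omega))
  · left
    by_contra hle
    have h1 : totalDegree (τ (ψ (X 2))) ≤ totalDegree (τ (X 2)) := not_lt.1 hle
    have h2 : totalDegree (ψ⁻¹ (ψ (X 2))) ≤ totalDegree (ψ⁻¹ (X 2)) := by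
      simpa only [inv_inv] using totalDegree_map_map_inv_X_le ψ⁻¹ 2
    have := coord_le_coord_add_two hB h1 h2
    have := coord_le_coord_add_two hB h2 h1
    omega

end Rank

section Invariance

variable {k : Type} [Field k] (e : Equiv.Perm (Fin 3))

lemma wedge_renameEquiv (a b : Fin 3) (p q : MvPolynomial (Fin 3) k) :
    wedge (e a) (e b) (renameEquiv k e p) (renameEquiv k e q) = renameEquiv k e (wedge a b p q) := by
  simp [wedge, pderiv_rename e.injective]

lemma wdeg_renameEquiv (p q : MvPolynomial (Fin 3) k) :
    wdeg (renameEquiv k e p) (renameEquiv k e q) = wdeg p q := by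
  have h : ∀ a b, totalDegree (wedge (e a) (e b) (renameEquiv k e p) (renameEquiv k e q)) =
      totalDegree (wedge a b p q) := fun a b => by
    rw [wedge_renameEquiv, totalDegree_renameEquiv]
  apply le_antisymm
  · refine Finset.sup_le fun ab _ => ?_
    have := h (e.symm ab.1) (e.symm ab.2)
    rw [e.apply_symm_apply, e.apply_symm_apply] at this
    exact this.trans_le (le_wdeg _ _ _ _)
  · exact Finset.sup_le fun ab _ => (h ab.1 ab.2).symm.trans_le (le_wdeg _ _ _ _)

lemma coord_renameEquiv_mul [CharZero k] (φ : Aut3 k) :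
    coord ((renameEquiv k e : Aut3 k) * φ) = coord φ := by
  apply coord_eq_of
  intro i
  rw [← fwd_iff φ i, Fwd, Fwd]
  simp only [kdeg, mul_assoc, AlgEquiv.mul_apply (renameEquiv k e : Aut3 k), wdeg_renameEquiv]

end Invariance

section TameGroup

variable (k : Type) [Field k]

/-- Tame automorphisms of Jacobian determinant one. -/
noncomputable def STame : Subgroup (Aut3 k) where
  carrier := {σ | σ ∈ Tame k ∧ jacDet k σ = 1}
  one_mem' := ⟨one_mem _, jacDet_one⟩
  mul_mem' := fun {σ τ} hσ hτ => ⟨mul_mem hσ.1 hτ.1, by rw [jacDet_mul, hσ.2, hτ.2]; simp⟩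
  inv_mem' := fun {σ} hσ => ⟨inv_mem hσ.1, by
    have := jacDet_mul σ σ⁻¹
    rw [mul_inv_cancel, jacDet_one, hσ.2, mul_one] at this
    exact σ.injective (this.symm.trans (map_one σ).symm)⟩

variable {k}

lemma renameEquiv_mem_tame (e : Equiv.Perm (Fin 3)) : (renameEquiv k e : Aut3 k) ∈ Tame k := by
  refine Subgroup.subset_closure (.inl ⟨e.permMatrix k, 0, ?_, fun i => ?_⟩)
  · rw [Matrix.isUnit_iff_isUnit_det, Matrix.det_permutation]
    rcases Int.units_eq_one_or (Equiv.Perm.sign e) with h | h <;> simp [h]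
  · simp [Equiv.Perm.permMatrix, PEquiv.toMatrix_apply, Equiv.toPEquiv]

/-- The involution `x₁ ↦ -x₁`, as an algebra homomorphism. -/
noncomputable def negHom (k : Type) [Field k] :
    MvPolynomial (Fin 3) k →ₐ[k] MvPolynomial (Fin 3) k :=
  aeval ![-X 0, X 1, X 2]

lemma negHom_comp : (negHom k).comp (negHom k) = AlgHom.id k _ := by
  apply MvPolynomial.algHom_ext
  intro i
  fin_cases i <;> simp [negHom]

/-- The involution `x₁ ↦ -x₁`. -/
noncomputable def negAut (k : Type) [Field k] : Aut3 k :=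
  AlgEquiv.ofAlgHom (negHom k) (negHom k) negHom_comp negHom_comp

@[simp] lemma negAut_X0 : negAut k (X 0) = -X 0 := by simp [negAut, negHom]
@[simp] lemma negAut_X1 : negAut k (X 1) = X 1 := by simp [negAut, negHom]
@[simp] lemma negAut_X2 : negAut k (X 2) = X 2 := by simp [negAut, negHom]

lemma negAut_mem_tame : negAut k ∈ Tame k := by
  refine Subgroup.subset_closure (.inl ⟨Matrix.diagonal ![-1, 1, 1], 0, ?_, fun i => ?_⟩)
  · rw [Matrix.isUnit_iff_isUnit_det, Matrix.det_diagonal]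
    simp [Fin.prod_univ_three]
  · fin_cases i <;> simp [Matrix.diagonal_apply, Fin.sum_univ_three]

lemma flipAut_mem_tame : flipAut k ∈ Tame k := by
  have h : flipAut k * negAut k ∈ Tame k := by
    refine Subgroup.subset_closure (.inr ⟨-henon (X 1) (X 2), ?_, ?_, ?_, ?_⟩)
    · have h1 : (X 1 : MvPolynomial (Fin 3) k) ∈ supported k ({1, 2} : Set (Fin 3)) :=
        X_mem_supported.2 (by simp)
      have h2 : (X 2 : MvPolynomial (Fin 3) k) ∈ supported k ({1, 2} : Set (Fin 3)) :=
        X_mem_supported.2 (by simp)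
      exact neg_mem (mul_mem (pow_mem h2 7) (add_mem (pow_mem h1 4) (pow_mem h1 3)))
    · simp
      ring
    · simp
    · simp
  have := mul_mem h (inv_mem (negAut_mem_tame (k := k)))
  rwa [mul_inv_cancel_right] at this

lemma henonAut_mem_stame : henonAut k ∈ STame k :=
  ⟨mul_mem (renameEquiv_mem_tame _) flipAut_mem_tame, jacDet_henonAut⟩

lemma rotate_mem_stame : (renameEquiv k (finRotate 3) : Aut3 k) ∈ STame k := by
  refine ⟨renameEquiv_mem_tame _, ?_⟩
  simp [jacDet, Matrix.det_fin_three, pderiv_X]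

variable (k) [CharZero k]

/-- The special tame group acting on the conjugates of the Hénon automorphism. -/
noncomputable def axisSystem : AxisSystem (STame k) (ℕ ×ₗ ℕ) where
  g := ⟨henonAut k, henonAut_mem_stame⟩
  c φ := coord φ.1
  μ φ := rank φ.1
  θ := 10
  c_mul φ := coord_mul φ.1
  μ_mul φ := rank_mul_henonAut φ.1
  lt_of_far φ φ' h hc := rank_lt_rank φ.2.2 φ'.2.2 (fun ⟨i, hi⟩ => h ⟨i, Subtype.ext hi⟩) hc

end TameGroup

end SpecialTame

open SpecialTame in
/-- `STame(k^3)` is not simple: there is a normal-in-`STame` subgroup `N` of `Aut(R)`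
consisting of special tame automorphisms, which is nontrivial and proper in `STame(k^3)`. -/
theorem stame_not_simple (k : Type) [Field k] [CharZero k] :
    ∃ N : Subgroup (Aut3 k),
      (∀ τ ∈ N, τ ∈ Tame k ∧ jacDet k τ = 1) ∧
      (∃ τ ∈ N, τ ≠ 1) ∧
      (∃ σ ∈ Tame k, jacDet k σ = 1 ∧ σ ∉ N) ∧
      (∀ σ ∈ Tame k, jacDet k σ = 1 → ∀ τ ∈ N, σ * τ * σ⁻¹ ∈ N) := by
  set S := axisSystem k
  refine ⟨(Subgroup.normalClosure {S.g ^ S.len}).map (STame k).subtype, ?_, ?_, ?_, ?_⟩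
  · rintro _ ⟨τ, -, rfl⟩
    exact τ.2
  · refine ⟨_, ⟨S.g ^ S.len, Subgroup.subset_normalClosure rfl, rfl⟩, fun h => ?_⟩
    have h1 : S.g ^ S.len = 1 := Subtype.ext h
    have h2 := S.c_mul_zpow 1 S.len
    rw [zpow_natCast, h1, mul_one] at h2
    simp only [AxisSystem.len] at h2
    omega
  · refine ⟨_, rotate_mem_stame.1, rotate_mem_stame.2, ?_⟩
    rintro ⟨τ, hτ, h⟩
    obtain ⟨Z, hZ⟩ := S.exists_ne_of_mem_normalClosure hτ (by
      rintro rfl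
      have := congrArg (fun σ : Aut3 k => σ (X 0)) h
      simp [X_injective.eq_iff] at this)
    apply hZ
    have : Z = τ * (τ⁻¹ * Z) := by simp
    change coord Z.1 = coord (τ⁻¹ * Z).1
    conv_lhs => rw [this]
    rw [Subgroup.coe_mul, show τ.1 = _ from h, coord_renameEquiv_mul]
  · rintro σ hσ hJ _ ⟨τ, hτ, rfl⟩
    exact ⟨_, Subgroup.normalClosure_normal.conj_mem τ hτ ⟨σ, hσ, hJ⟩, rfl⟩
end

section
/- The canonical homomorphism from the amalgamated free product K1 *_{K1∩K2} K2 (the pushout of the two inclusion homomorphisms K1∩K2 ↪ K1 and K1∩K2 ↪ K2) to Aut(R), induced by the inclusions of K1 and K2 into Aut(R), is injective, and its image equals H2. -/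
open MvPolynomial

/-- Membership in `H2`: `σ(x1) = a(x3)·x1 + b(x3)·x2 + t(x3)`,
`σ(x2) = c(x3)·x1 + d(x3)·x2 + t'(x3)`, `σ(x3) = α·x3 + β` with
`a·d − b·c` a nonzero constant and `α ∈ k^*`. -/
def MemH2 (k : Type) [Field k] (σ : Aut3 k) : Prop :=
  ∃ (a b c d t t' : MvPolynomial (Fin 3) k) (α β : k),
    a ∈ supported k ({2} : Set (Fin 3)) ∧ b ∈ supported k ({2} : Set (Fin 3)) ∧
    c ∈ supported k ({2} : Set (Fin 3)) ∧ d ∈ supported k ({2} : Set (Fin 3)) ∧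
    t ∈ supported k ({2} : Set (Fin 3)) ∧ t' ∈ supported k ({2} : Set (Fin 3)) ∧
    (∃ u : k, u ≠ 0 ∧ a * d - b * c = C u) ∧ α ≠ 0 ∧
    σ (X 0) = a * X 0 + b * X 1 + t ∧ σ (X 1) = c * X 0 + d * X 1 + t' ∧
    σ (X 2) = C α * X 2 + C β

/-- Membership in `K1`: `σ(x1) = a·x1 + t(x3)`, `σ(x2) = c(x3)·x1 + d·x2 + t'(x3)`,
`σ(x3) = α·x3 + β` with `a, d, α ∈ k^*`, `c ∈ k[x3]`. -/
def MemK1 (k : Type) [Field k] (σ : Aut3 k) : Prop :=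
  ∃ (a d α β : k) (c t t' : MvPolynomial (Fin 3) k),
    a ≠ 0 ∧ d ≠ 0 ∧ α ≠ 0 ∧
    c ∈ supported k ({2} : Set (Fin 3)) ∧
    t ∈ supported k ({2} : Set (Fin 3)) ∧ t' ∈ supported k ({2} : Set (Fin 3)) ∧
    σ (X 0) = C a * X 0 + t ∧ σ (X 1) = c * X 0 + C d * X 1 + t' ∧
    σ (X 2) = C α * X 2 + C β

/-- Membership in `K2`: `σ(x1) = a·x1 + b·x2 + t(x3)`, `σ(x2) = c·x1 + d·x2 + t'(x3)`,
`σ(x3) = α·x3 + β` with `(a b; c d) ∈ GL_2(k)`, `α ∈ k^*`. -/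
def MemK2 (k : Type) [Field k] (σ : Aut3 k) : Prop :=
  ∃ (a b c d α β : k) (t t' : MvPolynomial (Fin 3) k),
    a * d - b * c ≠ 0 ∧ α ≠ 0 ∧
    t ∈ supported k ({2} : Set (Fin 3)) ∧ t' ∈ supported k ({2} : Set (Fin 3)) ∧
    σ (X 0) = C a * X 0 + C b * X 1 + t ∧ σ (X 1) = C c * X 0 + C d * X 1 + t' ∧
    σ (X 2) = C α * X 2 + C β
/-- The two-element family of groups `{↥A, ↥B}` associated to subgroups `A B ≤ G`. -/
def amalgFam {G : Type*} [Group G] (A B : Subgroup G) : Bool → Type _ :=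
  fun i => Bool.rec (motive := fun _ => Type _) ↥B ↥A i

instance {G : Type*} [Group G] (A B : Subgroup G) : ∀ i, Group (amalgFam A B i) :=
  fun i => by cases i <;> dsimp [amalgFam] <;> infer_instance

/-- The inclusions of `A ⊓ B` into `A` and `B`. -/
def amalgIncl {G : Type*} [Group G] (A B : Subgroup G) :
    ∀ i, ↥(A ⊓ B) →* amalgFam A B i :=
  fun i => by
    cases i
    · exact Subgroup.inclusion inf_le_right
    · exact Subgroup.inclusion inf_le_left

/-- The amalgamated free product `A *_{A ⊓ B} B`, i.e. the pushout of the two inclusion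
homomorphisms `A ⊓ B ↪ A` and `A ⊓ B ↪ B`. -/
def AmalgProd {G : Type*} [Group G] (A B : Subgroup G) : Type _ :=
  Monoid.PushoutI (amalgIncl A B)

noncomputable instance {G : Type*} [Group G] (A B : Subgroup G) : Group (AmalgProd A B) := by
  unfold AmalgProd; infer_instance

/-- The canonical homomorphism `A *_{A ⊓ B} B →* G` induced by the inclusions of `A` and `B`
into `G`. -/
noncomputable def amalgToGroup {G : Type*} [Group G] (A B : Subgroup G) :
    AmalgProd A B →* G :=
  Monoid.PushoutI.lift
    (fun i => by cases i; exacts [B.subtype, A.subtype])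
    (A ⊓ B).subtype
    (by intro i; cases i <;> rfl)

/-- The inclusions of `A` and `B` into `G`, as a family. -/
def amalgFamHom {G : Type*} [Group G] (A B : Subgroup G) : ∀ i, amalgFam A B i →* G :=
  fun i => by cases i; exacts [B.subtype, A.subtype]

/-- The homomorphism `amalgToGroup`, with its domain presented as `Monoid.PushoutI`. -/
noncomputable def amalgHom {G : Type*} [Group G] (A B : Subgroup G) :
    Monoid.PushoutI (amalgIncl A B) →* G :=
  Monoid.PushoutI.lift (amalgFamHom A B) (A ⊓ B).subtype (by intro i; cases i <;> rfl)

theorem amalgHom_of {G : Type*} [Group G] (A B : Subgroup G) (i : Bool) (g : amalgFam A B i) :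
    amalgHom A B (Monoid.PushoutI.of i g) = amalgFamHom A B i g :=
  Monoid.PushoutI.lift_of _ _ _ g

theorem amalgHom_base {G : Type*} [Group G] (A B : Subgroup G) (h : ↥(A ⊓ B)) :
    amalgHom A B (Monoid.PushoutI.base (amalgIncl A B) h) = h :=
  Monoid.PushoutI.lift_base _ _ _ h

/-- If `S true` and `S false` avoid `A ⊓ B` and play ping-pong for `A` and `B`, the canonical
homomorphism from the amalgamated product of `A` and `B` is injective. -/
theorem amalgToGroup_injective_of_pingPong {G : Type*} [Group G] (A B : Subgroup G)
    (S : Bool → Set G) (hS : ∀ i, ∀ g ∈ S i, g ∉ A ⊓ B)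
    (hA : ∀ g ∈ A, g ∉ B → g ∈ S true) (hB : ∀ g ∈ B, g ∉ A → g ∈ S false)
    (hAB : ∀ g ∈ A, g ∉ B → ∀ s ∈ S false, g * s ∈ S true)
    (hBA : ∀ g ∈ B, g ∉ A → ∀ s ∈ S true, g * s ∈ S false) :
    Function.Injective (amalgToGroup A B) := by
  classical
  have hφ : ∀ i, Function.Injective (amalgIncl A B i) := by
    intro i
    cases i
    · exact Subgroup.inclusion_injective (inf_le_right : A ⊓ B ≤ B)
    · exact Subgroup.inclusion_injective (inf_le_left : A ⊓ B ≤ A)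
  obtain ⟨d⟩ := Monoid.PushoutI.NormalWord.transversal_nonempty _ hφ
  suffices hF : Function.Injective (amalgHom A B) from hF
  have hlist : ∀ (l : List (Σ i, amalgFam A B i)) (x : Σ i, amalgFam A B i),
      (x :: l).IsChain (fun l l' => l.1 ≠ l'.1) →
      (∀ y ∈ x :: l, y.2 ∉ (amalgIncl A B y.1).range) →
      ((x :: l).map fun y => amalgFamHom A B y.1 y.2).prod ∈ S x.1 := by
    intro l
    induction l with
    | nil =>
      rintro ⟨_ | _, g⟩ - hr
      · have hg := hr _ (List.mem_cons_self ..)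
        rw [List.map_singleton, List.prod_singleton]
        exact hB _ (Subtype.prop (p := (· ∈ B)) g)
          fun h => hg ⟨⟨g.1, h, g.2⟩, rfl⟩
      · have hg := hr _ (List.mem_cons_self ..)
        rw [List.map_singleton, List.prod_singleton]
        exact hA _ (Subtype.prop (p := (· ∈ A)) g)
          fun h => hg ⟨⟨g.1, g.2, h⟩, rfl⟩
    | cons y l ih =>
      intro x hc hr
      rw [List.isChain_cons_cons] at hc
      have hy := ih y hc.2 fun z hz => hr z (List.mem_cons_of_mem _ hz)
      have hg := hr _ (List.mem_cons_self ..)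
      rw [List.map_cons, List.prod_cons]
      obtain ⟨_ | _, g⟩ := x
      · have hy1 : y.1 = true := by simpa using hc.1.symm
        rw [hy1] at hy
        exact hBA _ (Subtype.prop (p := (· ∈ B)) g)
          (fun h => hg ⟨⟨g.1, h, g.2⟩, rfl⟩) _ hy
      · have hy1 : y.1 = false := by simpa using hc.1.symm
        rw [hy1] at hy
        exact hAB _ (Subtype.prop (p := (· ∈ A)) g)
          (fun h => hg ⟨⟨g.1, g.2, h⟩, rfl⟩) _ hy
  rw [injective_iff_map_eq_one]
  intro g hg
  obtain ⟨w, rfl⟩ := (Monoid.PushoutI.NormalWord.equiv (d := d)).symm.surjective g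
  have hred : ∀ y ∈ w.toList, y.2 ∉ (amalgIncl A B y.1).range := by
    rintro ⟨i, y⟩ hy hmem
    have h := (d.compl i).1 (a₁ := (⟨y, hmem⟩, ⟨1, d.one_mem i⟩))
      (a₂ := (1, ⟨y, w.normalized i y hy⟩)) (by simp)
    exact w.ne_one _ hy (congrArg (fun z => (z.1 : amalgFam A B i)) h)
  change amalgHom A B w.prod = 1 at hg
  change w.prod = 1
  have hw : amalgHom A B w.prod =
      w.head * (w.toList.map fun y => amalgFamHom A B y.1 y.2).prod := by
    rw [Monoid.PushoutI.NormalWord.prod, map_mul, amalgHom_base, Monoid.CoprodI.Word.prod,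
      map_list_prod, map_list_prod, List.map_map, List.map_map]
    congr 2
  rw [hw] at hg
  cases hl : w.toList with
  | nil =>
    rw [hl, List.map_nil, List.prod_nil, mul_one] at hg
    have hh : w.head = 1 := Subtype.ext hg
    simp [Monoid.PushoutI.NormalWord.prod, Monoid.CoprodI.Word.prod, hl, hh]
  | cons x l =>
    have hc := w.chain_ne
    rw [hl] at hc hred hg
    refine (hS _ _ (hlist l x hc hred) ?_).elim
    rw [← inv_eq_of_mul_eq_one_right hg]
    exact inv_mem w.head.2

/-- The image of the canonical homomorphism is the subgroup generated by the two factors. -/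
theorem mem_range_amalgToGroup {G : Type*} [Group G] (A B : Subgroup G) (g : G) :
    g ∈ (amalgToGroup A B).range ↔ g ∈ A ⊔ B := by
  change g ∈ (amalgHom A B).range ↔ g ∈ A ⊔ B
  revert g
  refine SetLike.ext_iff.1 (le_antisymm ?_ (sup_le (fun a ha => ?_) fun b hb => ?_))
  · rintro _ ⟨x, rfl⟩
    induction x using Monoid.PushoutI.induction_on with
    | of i g =>
      rw [amalgHom_of]
      cases i
      · exact Subgroup.mem_sup_right (Subtype.prop (p := (· ∈ B)) g)
      · exact Subgroup.mem_sup_left (Subtype.prop (p := (· ∈ A)) g)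
    | base h =>
      rw [amalgHom_base]
      exact Subgroup.mem_sup_left h.2.1
    | mul x y hx hy =>
      rw [map_mul]
      exact mul_mem hx hy
  · exact ⟨_, amalgHom_of A B true (⟨a, ha⟩ : A)⟩
  · exact ⟨_, amalgHom_of A B false (⟨b, hb⟩ : B)⟩

section Affine

variable {k : Type} [Field k]

/-- The embedding of `k[x3]` into `k[x1,x2,x3]`. -/
noncomputable def ofX3 (k : Type) [Field k] : Polynomial k →ₐ[k] MvPolynomial (Fin 3) k :=
  Polynomial.aeval (X 2)

/-- The polynomial `p(x3)·x1 + q(x3)·x2 + r(x3)`. -/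
noncomputable def affineForm (p q r : Polynomial k) : MvPolynomial (Fin 3) k :=
  ofX3 k p * X 0 + ofX3 k q * X 1 + ofX3 k r

@[simp]
theorem ofX3_C (a : k) : ofX3 k (Polynomial.C a) = C a := by
  simp [ofX3, MvPolynomial.algebraMap_eq]

@[simp]
theorem ofX3_X : ofX3 k Polynomial.X = X 2 := by
  simp [ofX3]

theorem mem_supported_iff_ofX3 {p : MvPolynomial (Fin 3) k} :
    p ∈ supported k ({2} : Set (Fin 3)) ↔ ∃ P, ofX3 k P = p := by
  rw [supported, Set.image_singleton, Algebra.adjoin_singleton_eq_range_aeval]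
  exact AlgHom.mem_range _

theorem affineForm_inj {p q r p' q' r' : Polynomial k}
    (h : affineForm p q r = affineForm p' q' r') : p = p' ∧ q = q' := by
  have key : ∀ u v : Polynomial k, p * u + q * v + r = p' * u + q' * v + r' := by
    intro u v
    have hcomp : ∀ P, aeval ![u, v, Polynomial.X] (ofX3 k P) = P := by
      intro P
      have : ((aeval ![u, v, Polynomial.X]).comp (ofX3 k)) = AlgHom.id k (Polynomial k) :=
        Polynomial.algHom_ext (by simp)
      exact DFunLike.congr_fun this P
    simpa [affineForm, hcomp] using congrArg (aeval (R := k) ![u, v, Polynomial.X]) h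
  have h00 := key 0 0
  have h10 := key 1 0
  have h01 := key 0 1
  constructor
  · linear_combination h10 - h00
  · linear_combination h01 - h00

theorem map_ofX3 {σ : Aut3 k} {α β : k} (h : σ (X 2) = C α * X 2 + C β) (P : Polynomial k) :
    σ (ofX3 k P) = ofX3 k (P.comp (Polynomial.C α * Polynomial.X + Polynomial.C β)) := by
  have : (σ : MvPolynomial (Fin 3) k →ₐ[k] MvPolynomial (Fin 3) k).comp (ofX3 k) =
      (ofX3 k).comp (Polynomial.aeval (Polynomial.C α * Polynomial.X + Polynomial.C β)) :=
    Polynomial.algHom_ext (by simp [h])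
  simpa [Polynomial.comp_eq_aeval] using DFunLike.congr_fun this P

theorem map_affineForm {σ : Aut3 k} {a b t c d t' : Polynomial k} {α β : k}
    (h0 : σ (X 0) = affineForm a b t) (h1 : σ (X 1) = affineForm c d t')
    (h2 : σ (X 2) = C α * X 2 + C β) (p q r : Polynomial k) :
    ∃ s, σ (affineForm p q r) = affineForm
      (p.comp (Polynomial.C α * Polynomial.X + Polynomial.C β) * a +
        q.comp (Polynomial.C α * Polynomial.X + Polynomial.C β) * c)
      (p.comp (Polynomial.C α * Polynomial.X + Polynomial.C β) * b +
        q.comp (Polynomial.C α * Polynomial.X + Polynomial.C β) * d) s := by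
  refine ⟨p.comp (Polynomial.C α * Polynomial.X + Polynomial.C β) * t +
    q.comp (Polynomial.C α * Polynomial.X + Polynomial.C β) * t' +
    r.comp (Polynomial.C α * Polynomial.X + Polynomial.C β), ?_⟩
  conv_lhs => rw [affineForm]
  simp only [map_add, map_mul, h0, h1, map_ofX3 h2]
  simp only [affineForm, map_add, map_mul]
  ring

theorem memH2_iff {σ : Aut3 k} : MemH2 k σ ↔
    ∃ (a b t c d t' : Polynomial k) (α β u : k), u ≠ 0 ∧ a * d - b * c = Polynomial.C u ∧ α ≠ 0 ∧
      σ (X 0) = affineForm a b t ∧ σ (X 1) = affineForm c d t' ∧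
      σ (X 2) = C α * X 2 + C β := by
  constructor
  · rintro ⟨_, _, _, _, _, _, α, β, ha, hb, hc, hd, ht, ht', ⟨u, hu, hdet⟩, hα, h0, h1, h2⟩
    obtain ⟨a, rfl⟩ := mem_supported_iff_ofX3.1 ha
    obtain ⟨b, rfl⟩ := mem_supported_iff_ofX3.1 hb
    obtain ⟨c, rfl⟩ := mem_supported_iff_ofX3.1 hc
    obtain ⟨d, rfl⟩ := mem_supported_iff_ofX3.1 hd
    obtain ⟨t, rfl⟩ := mem_supported_iff_ofX3.1 ht
    obtain ⟨t', rfl⟩ := mem_supported_iff_ofX3.1 ht'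
    refine ⟨a, b, t, c, d, t', α, β, u, hu, ?_, hα, h0, h1, h2⟩
    refine (affineForm_inj (q := 0) (r := 0) (q' := 0) (r' := 0) ?_).1
    simp [affineForm, ← hdet]
  · rintro ⟨a, b, t, c, d, t', α, β, u, hu, hdet, hα, h0, h1, h2⟩
    refine ⟨_, _, _, _, _, _, α, β, mem_supported_iff_ofX3.2 ⟨a, rfl⟩,
      mem_supported_iff_ofX3.2 ⟨b, rfl⟩, mem_supported_iff_ofX3.2 ⟨c, rfl⟩,
      mem_supported_iff_ofX3.2 ⟨d, rfl⟩, mem_supported_iff_ofX3.2 ⟨t, rfl⟩,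
      mem_supported_iff_ofX3.2 ⟨t', rfl⟩, ⟨u, hu, ?_⟩, hα, h0, h1, h2⟩
    rw [← ofX3_C, ← hdet, map_sub, map_mul, map_mul]

theorem memK1_iff {σ : Aut3 k} : MemK1 k σ ↔
    ∃ (a d α β : k) (t c t' : Polynomial k), a ≠ 0 ∧ d ≠ 0 ∧ α ≠ 0 ∧
      σ (X 0) = affineForm (Polynomial.C a) 0 t ∧ σ (X 1) = affineForm c (Polynomial.C d) t' ∧
      σ (X 2) = C α * X 2 + C β := by
  constructor
  · rintro ⟨a, d, α, β, _, _, _, ha, hd, hα, hc, ht, ht', h0, h1, h2⟩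
    obtain ⟨c, rfl⟩ := mem_supported_iff_ofX3.1 hc
    obtain ⟨t, rfl⟩ := mem_supported_iff_ofX3.1 ht
    obtain ⟨t', rfl⟩ := mem_supported_iff_ofX3.1 ht'
    exact ⟨a, d, α, β, t, c, t', ha, hd, hα, by simp [affineForm, h0],
      by simp [affineForm, h1], h2⟩
  · rintro ⟨a, d, α, β, t, c, t', ha, hd, hα, h0, h1, h2⟩
    exact ⟨a, d, α, β, _, _, _, ha, hd, hα, mem_supported_iff_ofX3.2 ⟨c, rfl⟩,
      mem_supported_iff_ofX3.2 ⟨t, rfl⟩, mem_supported_iff_ofX3.2 ⟨t', rfl⟩,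
      by simp [affineForm, h0], by simp [affineForm, h1], h2⟩

theorem memK2_iff {σ : Aut3 k} : MemK2 k σ ↔
    ∃ (a b c d α β : k) (t t' : Polynomial k), a * d - b * c ≠ 0 ∧ α ≠ 0 ∧
      σ (X 0) = affineForm (Polynomial.C a) (Polynomial.C b) t ∧
      σ (X 1) = affineForm (Polynomial.C c) (Polynomial.C d) t' ∧
      σ (X 2) = C α * X 2 + C β := by
  constructor
  · rintro ⟨a, b, c, d, α, β, _, _, hdet, hα, ht, ht', h0, h1, h2⟩
    obtain ⟨t, rfl⟩ := mem_supported_iff_ofX3.1 ht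
    obtain ⟨t', rfl⟩ := mem_supported_iff_ofX3.1 ht'
    exact ⟨a, b, c, d, α, β, t, t', hdet, hα, by simp [affineForm, h0],
      by simp [affineForm, h1], h2⟩
  · rintro ⟨a, b, c, d, α, β, t, t', hdet, hα, h0, h1, h2⟩
    exact ⟨a, b, c, d, α, β, _, _, hdet, hα, mem_supported_iff_ofX3.2 ⟨t, rfl⟩,
      mem_supported_iff_ofX3.2 ⟨t', rfl⟩, by simp [affineForm, h0], by simp [affineForm, h1], h2⟩

theorem MemK1.memH2 {σ : Aut3 k} (h : MemK1 k σ) : MemH2 k σ := by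
  obtain ⟨a, d, α, β, t, c, t', ha, hd, hα, h0, h1, h2⟩ := memK1_iff.1 h
  exact memH2_iff.2 ⟨_, _, t, _, _, t', α, β, a * d, mul_ne_zero ha hd, by simp, hα, h0, h1, h2⟩

theorem MemK2.memH2 {σ : Aut3 k} (h : MemK2 k σ) : MemH2 k σ := by
  obtain ⟨a, b, c, d, α, β, t, t', hdet, hα, h0, h1, h2⟩ := memK2_iff.1 h
  exact memH2_iff.2 ⟨_, _, t, _, _, t', α, β, _, hdet, by simp, hα, h0, h1, h2⟩

theorem MemH2.mul {σ τ : Aut3 k} (hσ : MemH2 k σ) (hτ : MemH2 k τ) : MemH2 k (σ * τ) := by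
  obtain ⟨a, b, t, c, d, t', α, β, u, hu, hdet, hα, h0, h1, h2⟩ := memH2_iff.1 hσ
  obtain ⟨p, q, r, p', q', r', γ, δ, v, hv, hdet', hγ, g0, g1, g2⟩ := memH2_iff.1 hτ
  obtain ⟨s, hs⟩ := map_affineForm h0 h1 h2 p q r
  obtain ⟨s', hs'⟩ := map_affineForm h0 h1 h2 p' q' r'
  have hd := congrArg (Polynomial.comp · (Polynomial.C α * Polynomial.X + Polynomial.C β)) hdet'
  simp only [Polynomial.sub_comp, Polynomial.mul_comp, Polynomial.C_comp] at hd
  have hC : ∀ x : k, σ (C x) = C x := fun x => σ.commutes x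
  refine memH2_iff.2 ⟨_, _, s, _, _, s', γ * α, γ * β + δ, v * u, mul_ne_zero hv hu, ?_,
    mul_ne_zero hγ hα, (congrArg σ g0).trans hs, (congrArg σ g1).trans hs', ?_⟩
  · rw [Polynomial.C_mul]
    linear_combination (a * d - b * c) * hd + Polynomial.C v * hdet
  · rw [AlgEquiv.mul_apply, g2, map_add, map_mul, hC, hC, h2]
    simp only [map_add, map_mul]
    ring

/-- The automorphism fixing `x1` and `x3` and sending `x2` to `c(x3)·x1 + x2`. -/
noncomputable def transvection (c : Polynomial k) : Aut3 k :=
  AlgEquiv.ofAlgHom (aeval ![X 0, ofX3 k c * X 0 + X 1, X 2])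
    (aeval ![X 0, -(ofX3 k c * X 0) + X 1, X 2])
    (by
      have h : (aeval ![X 0, ofX3 k c * X 0 + X 1, X 2]).comp (ofX3 k) = ofX3 k :=
        Polynomial.algHom_ext (by simp)
      have h' := DFunLike.congr_fun h c
      rw [AlgHom.comp_apply, aeval_eq_bind₁] at h'
      ext1 i
      fin_cases i <;> simp [h'])
    (by
      have h : (aeval ![X 0, -(ofX3 k c * X 0) + X 1, X 2]).comp (ofX3 k) = ofX3 k :=
        Polynomial.algHom_ext (by simp)
      have h' := DFunLike.congr_fun h c
      rw [AlgHom.comp_apply, aeval_eq_bind₁] at h'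
      ext1 i
      fin_cases i <;> simp [h'])

theorem transvection_X_zero (c : Polynomial k) :
    transvection c (X 0) = affineForm (Polynomial.C 1) 0 0 := by
  simp [transvection, affineForm]

theorem transvection_X_one (c : Polynomial k) :
    transvection c (X 1) = affineForm c (Polynomial.C 1) 0 := by
  simp [transvection, affineForm]

theorem transvection_X_two (c : Polynomial k) :
    transvection c (X 2) = C 1 * X 2 + C 0 := by
  simp [transvection]

theorem memK1_transvection (c : Polynomial k) : MemK1 k (transvection c) :=
  memK1_iff.2 ⟨1, 1, 1, 0, _, _, _, one_ne_zero, one_ne_zero, one_ne_zero,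
    transvection_X_zero c, transvection_X_one c, transvection_X_two c⟩

/-- The automorphism exchanging `x1` and `x2`. -/
noncomputable def swapX1X2 (k : Type) [Field k] : Aut3 k :=
  renameEquiv k (Equiv.swap 0 1)

theorem swapX1X2_X_zero : swapX1X2 k (X 0) = affineForm (Polynomial.C 0) (Polynomial.C 1) 0 := by
  simp [swapX1X2, affineForm]

theorem swapX1X2_X_one : swapX1X2 k (X 1) = affineForm (Polynomial.C 1) (Polynomial.C 0) 0 := by
  simp [swapX1X2, affineForm]

theorem swapX1X2_X_two : swapX1X2 k (X 2) = C 1 * X 2 + C 0 := by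
  have : Equiv.swap (0 : Fin 3) 1 2 = 2 := by decide
  simp [swapX1X2, this]

theorem memK2_swapX1X2 : MemK2 k (swapX1X2 k) :=
  memK2_iff.2 ⟨0, 1, 1, 0, 1, 0, _, _, by simp, one_ne_zero,
    swapX1X2_X_zero, swapX1X2_X_one, swapX1X2_X_two⟩

/-- A subgroup containing the elements of `K1` and `K2` contains those of `H2`. The proof runs
the Euclidean algorithm on the coefficients of `σ(x1)`. -/
theorem MemH2.mem_of_memK1_of_memK2 {L : Subgroup (Aut3 k)} (h₁ : ∀ σ, MemK1 k σ → σ ∈ L)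
    (h₂ : ∀ σ, MemK2 k σ → σ ∈ L) {σ : Aut3 k} (hσ : MemH2 k σ) : σ ∈ L := by
  obtain ⟨a, b, t, c, d, t', α, β, u, hu, hdet, hα, hσ0, hσ1, hσ2⟩ := memH2_iff.1 hσ
  clear hσ
  induction hn : b.degree using WellFoundedLT.induction generalizing σ a b t c d t' u with
  | ind n ih =>
    subst hn
    by_cases hb : b = 0
    · subst hb
      rw [zero_mul, sub_zero] at hdet
      have hunit : IsUnit (a * d) := hdet ▸ Polynomial.isUnit_C.2 (isUnit_iff_ne_zero.2 hu)
      obtain ⟨a, ha, rfl⟩ := Polynomial.isUnit_iff.1 (isUnit_of_mul_isUnit_left hunit)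
      obtain ⟨d, hd, rfl⟩ := Polynomial.isUnit_iff.1 (isUnit_of_mul_isUnit_right hunit)
      exact h₁ _ (memK1_iff.2 ⟨a, d, α, β, t, c, t', ha.ne_zero, hd.ne_zero, hα, hσ0, hσ1, hσ2⟩)
    · set e := swapX1X2 k * transvection (-(a / b)) with he
      have heL : e ∈ L := mul_mem (h₂ _ memK2_swapX1X2) (h₁ _ (memK1_transvection _))
      have hstep : ∀ p q r, ∃ s, e (affineForm p q r) = affineForm q (p - q * (a / b)) s := by
        intro p q r
        obtain ⟨s, hs⟩ := map_affineForm (transvection_X_zero (-(a / b))) (transvection_X_one _)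
          (transvection_X_two _) p q r
        obtain ⟨s', hs'⟩ := map_affineForm swapX1X2_X_zero swapX1X2_X_one
          swapX1X2_X_two (p - q * (a / b)) q s
        refine ⟨s', ?_⟩
        rw [he, AlgEquiv.mul_apply, hs]
        simpa [sub_eq_add_neg] using hs'
      obtain ⟨s, hs⟩ := hstep a b t
      obtain ⟨s', hs'⟩ := hstep c d t'
      have hmod : a - b * (a / b) = a % b := by
        rw [sub_eq_iff_eq_add', EuclideanDomain.div_add_mod]
      rw [hmod] at hs
      refine (mul_mem_cancel_left heL).1 (ih _ (Polynomial.degree_mod_lt a hb) b (a % b) s d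
        (c - d * (a / b)) s' (-u) (neg_ne_zero.2 hu) ?_ ?_ ?_ ?_ rfl)
      · rw [← hmod, Polynomial.C_neg, ← hdet]
        ring
      · rw [AlgEquiv.mul_apply, hσ0, hs]
      · rw [AlgEquiv.mul_apply, hσ1, hs']
      · have hC : ∀ x : k, e (C x) = C x := fun x => e.commutes x
        have he2 : e (X 2) = X 2 := by
          simp [he, AlgEquiv.mul_apply, transvection_X_two, swapX1X2_X_two]
        rw [AlgEquiv.mul_apply, hσ2, map_add, map_mul, hC, hC, he2]

theorem degree_comp_linear {α : k} (hα : α ≠ 0) (β : k) (p : Polynomial k) :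
    (p.comp (Polynomial.C α * Polynomial.X + Polynomial.C β)).degree = p.degree := by
  by_cases hp : p = 0
  · simp [hp]
  have hnat : (p.comp (Polynomial.C α * Polynomial.X + Polynomial.C β)).natDegree =
      p.natDegree := by
    rw [Polynomial.natDegree_comp, Polynomial.natDegree_linear hα, mul_one]
  have hne : p.comp (Polynomial.C α * Polynomial.X + Polynomial.C β) ≠ 0 := by
    intro h
    rcases Polynomial.comp_eq_zero_iff.1 h with h | ⟨-, h⟩
    · exact hp h
    · have := congrArg Polynomial.natDegree h
      rw [Polynomial.natDegree_linear hα, Polynomial.natDegree_C] at this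
      exact one_ne_zero this
  rw [Polynomial.degree_eq_natDegree hp, Polynomial.degree_eq_natDegree hne, hnat]

theorem exists_of_memK1_of_not_memK2 {σ : Aut3 k} (h₁ : MemK1 k σ) (h₂ : ¬ MemK2 k σ) :
    ∃ (a d α β : k) (t c t' : Polynomial k), a ≠ 0 ∧ d ≠ 0 ∧ α ≠ 0 ∧ 0 < c.degree ∧
      σ (X 0) = affineForm (Polynomial.C a) 0 t ∧ σ (X 1) = affineForm c (Polynomial.C d) t' ∧
      σ (X 2) = C α * X 2 + C β := by
  obtain ⟨a, d, α, β, t, c, t', ha, hd, hα, h0, h1, h2⟩ := memK1_iff.1 h₁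
  refine ⟨a, d, α, β, t, c, t', ha, hd, hα, ?_, h0, h1, h2⟩
  by_contra! hc
  rw [Polynomial.eq_C_of_degree_le_zero hc] at h1
  exact h₂ (memK2_iff.2 ⟨a, 0, _, d, α, β, t, t', by simp [ha, hd], hα, by simpa using h0, h1, h2⟩)

theorem exists_of_memK2_of_not_memK1 {σ : Aut3 k} (h₂ : MemK2 k σ) (h₁ : ¬ MemK1 k σ) :
    ∃ (a b c d α β : k) (t t' : Polynomial k), b ≠ 0 ∧ α ≠ 0 ∧
      σ (X 0) = affineForm (Polynomial.C a) (Polynomial.C b) t ∧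
      σ (X 1) = affineForm (Polynomial.C c) (Polynomial.C d) t' ∧
      σ (X 2) = C α * X 2 + C β := by
  obtain ⟨a, b, c, d, α, β, t, t', hdet, hα, h0, h1, h2⟩ := memK2_iff.1 h₂
  refine ⟨a, b, c, d, α, β, t, t', ?_, hα, h0, h1, h2⟩
  rintro rfl
  rw [zero_mul, sub_zero] at hdet
  exact h₁ (memK1_iff.2 ⟨a, d, α, β, t, _, t', left_ne_zero_of_mul hdet,
    right_ne_zero_of_mul hdet, hα, by simpa using h0, h1, h2⟩)

/-- Ping-pong sets for `K1` (index `true`) and `K2` (index `false`), comparing the degrees of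
the coefficients of `σ(x1)`. -/
def pingPongSet (k : Type) [Field k] : Bool → Set (Aut3 k)
  | true => {σ | ∃ p q r : Polynomial k, σ (X 0) = affineForm p q r ∧ q.degree < p.degree ∧
      (0 < p.degree ∨ ¬ MemK2 k σ)}
  | false => {σ | ∃ p q r : Polynomial k, σ (X 0) = affineForm p q r ∧ p.degree ≤ q.degree ∧
      q ≠ 0}

theorem not_memK1_and_memK2_of_mem_pingPongSet (i : Bool) {σ : Aut3 k}
    (hσ : σ ∈ pingPongSet k i) : ¬ (MemK1 k σ ∧ MemK2 k σ) := by
  rintro ⟨h₁, h₂⟩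
  obtain ⟨a, d, α, β, t, c, t', ha, hd, hα, h0, -⟩ := memK1_iff.1 h₁
  cases i with
  | true =>
    obtain ⟨p, q, r, h0', -, hp | hp⟩ := hσ
    · obtain ⟨rfl, -⟩ := affineForm_inj (h0'.symm.trans h0)
      exact hp.not_ge Polynomial.degree_C_le
    · exact hp h₂
  | false =>
    obtain ⟨p, q, r, h0', -, hq⟩ := hσ
    exact hq (affineForm_inj (h0'.symm.trans h0)).2

theorem mem_pingPongSet_true {σ : Aut3 k} (h₁ : MemK1 k σ) (h₂ : ¬ MemK2 k σ) :
    σ ∈ pingPongSet k true := by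
  obtain ⟨a, d, α, β, t, c, t', ha, hd, hα, hc, h0, h1, h2⟩ := exists_of_memK1_of_not_memK2 h₁ h₂
  exact ⟨_, _, _, h0, by simp [Polynomial.degree_C ha], Or.inr h₂⟩

theorem mem_pingPongSet_false {σ : Aut3 k} (h₂ : MemK2 k σ) (h₁ : ¬ MemK1 k σ) :
    σ ∈ pingPongSet k false := by
  obtain ⟨a, b, c, d, α, β, t, t', hb, hα, h0, h1, h2⟩ := exists_of_memK2_of_not_memK1 h₂ h₁
  exact ⟨_, _, _, h0, by simpa [Polynomial.degree_C hb] using Polynomial.degree_C_le, by simpa⟩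

theorem mul_mem_pingPongSet_true {σ τ : Aut3 k} (h₁ : MemK1 k σ) (h₂ : ¬ MemK2 k σ)
    (hτ : τ ∈ pingPongSet k false) : σ * τ ∈ pingPongSet k true := by
  obtain ⟨a, d, α, β, t, c, t', ha, hd, hα, hc, h0, h1, h2⟩ := exists_of_memK1_of_not_memK2 h₁ h₂
  obtain ⟨p, q, r, hpqr, hpq, hq⟩ := hτ
  obtain ⟨s, hs⟩ := map_affineForm h0 h1 h2 p q r
  have hlt : q.degree < q.degree + c.degree := by
    rw [Polynomial.degree_eq_natDegree hq, Polynomial.degree_eq_natDegree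
      (Polynomial.ne_zero_of_degree_gt hc)]
    have := Polynomial.natDegree_pos_iff_degree_pos.2 hc
    exact_mod_cast Nat.lt_add_of_pos_right this
  have hdeg : (p.comp (Polynomial.C α * Polynomial.X + Polynomial.C β) * Polynomial.C a +
      q.comp (Polynomial.C α * Polynomial.X + Polynomial.C β) * c).degree =
      q.degree + c.degree := by
    rw [Polynomial.degree_add_eq_right_of_degree_lt] <;>
      simp only [Polynomial.degree_mul, degree_comp_linear hα, Polynomial.degree_C ha, add_zero]
    exact hpq.trans_lt hlt
  refine ⟨_, _, s, (congrArg σ hpqr).trans hs, ?_, Or.inl ?_⟩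
  · rw [hdeg]
    simpa [degree_comp_linear hα, Polynomial.degree_C hd] using hlt
  · rw [hdeg]
    exact (Polynomial.zero_le_degree_iff.2 hq).trans_lt hlt

theorem mul_mem_pingPongSet_false {σ τ : Aut3 k} (h₂ : MemK2 k σ) (h₁ : ¬ MemK1 k σ)
    (hτ : τ ∈ pingPongSet k true) : σ * τ ∈ pingPongSet k false := by
  obtain ⟨a, b, c, d, α, β, t, t', hb, hα, h0, h1, h2⟩ := exists_of_memK2_of_not_memK1 h₂ h₁
  obtain ⟨p, q, r, hpqr, hqp, -⟩ := hτ
  obtain ⟨s, hs⟩ := map_affineForm h0 h1 h2 p q r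
  have hle : ∀ (f : Polynomial k) (x : k),
      (f.comp (Polynomial.C α * Polynomial.X + Polynomial.C β) * Polynomial.C x).degree ≤
        f.degree := by
    intro f x
    rw [Polynomial.degree_mul, degree_comp_linear hα]
    exact add_le_of_nonpos_right Polynomial.degree_C_le
  have hdeg : (p.comp (Polynomial.C α * Polynomial.X + Polynomial.C β) * Polynomial.C b +
      q.comp (Polynomial.C α * Polynomial.X + Polynomial.C β) * Polynomial.C d).degree =
      p.degree := by
    rw [Polynomial.degree_add_eq_left_of_degree_lt] <;>
      rw [Polynomial.degree_mul_C hb, degree_comp_linear hα]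
    exact (hle q d).trans_lt hqp
  refine ⟨_, _, s, (congrArg σ hpqr).trans hs, ?_, ?_⟩
  · rw [hdeg]
    exact (Polynomial.degree_add_le _ _).trans (max_le (hle p a) ((hle q c).trans hqp.le))
  · rw [← Polynomial.degree_ne_bot, hdeg, Polynomial.degree_ne_bot]
    exact Polynomial.ne_zero_of_degree_gt hqp

end Affine

/-- `H2 = K1 *_{K1 ∩ K2} K2`: the canonical homomorphism from the amalgamated product
of `K1` and `K2` over their intersection to `Aut(R)` is injective, with image `H2`. -/
theorem H2_eq_amalgam_K1_K2 (k : Type) [Field k] [CharZero k]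
    (K1 K2 : Subgroup (Aut3 k))
    (hK1 : ∀ σ, σ ∈ K1 ↔ MemK1 k σ) (hK2 : ∀ σ, σ ∈ K2 ↔ MemK2 k σ) :
    Function.Injective (amalgToGroup K1 K2) ∧
    ∀ σ : Aut3 k, σ ∈ (amalgToGroup K1 K2).range ↔ MemH2 k σ := by
  constructor
  · refine amalgToGroup_injective_of_pingPong K1 K2 (pingPongSet k) ?_ ?_ ?_ ?_ ?_
    · intro i g hg hmem
      exact not_memK1_and_memK2_of_mem_pingPongSet i hg ⟨(hK1 g).1 hmem.1, (hK2 g).1 hmem.2⟩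
    all_goals simp only [hK1, hK2]
    · exact fun g => mem_pingPongSet_true
    · exact fun g => mem_pingPongSet_false
    · exact fun g h₁ h₂ s => mul_mem_pingPongSet_true h₁ h₂
    · exact fun g h₂ h₁ s => mul_mem_pingPongSet_false h₂ h₁
  · intro σ
    rw [mem_range_amalgToGroup]
    constructor
    · intro h
      rw [Subgroup.sup_eq_closure] at h
      have hgen : ∀ τ : Aut3 k, τ ∈ (K1 : Set (Aut3 k)) ∪ K2 → MemH2 k τ := by
        rintro τ (hτ | hτ)
        · exact ((hK1 τ).1 hτ).memH2
        · exact ((hK2 τ).1 hτ).memH2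
      induction h using Subgroup.closure_induction_left with
      | one => exact hgen 1 (Or.inl (one_mem K1))
      | mul_left x hx y _ hy => exact (hgen x hx).mul hy
      | inv_mul_cancel x hx y _ hy =>
        exact (hgen x⁻¹ (hx.imp inv_mem inv_mem)).mul hy
    · exact fun h => h.mem_of_memK1_of_memK2
        (fun τ hτ => Subgroup.mem_sup_left ((hK1 τ).2 hτ))
        (fun τ hτ => Subgroup.mem_sup_right ((hK2 τ).2 hτ))
end

section
/- Let a, t ∈ k[x3] (viewed inside k[x1,x2,x3]), let f1 = a·x1 + t, and let f2 ∈ k[x1,x2,x3]. If the determinant of the Jacobian matrix (∂f_i/∂x_j)_{i,j} of the triple (f1, f2, x3) is a nonzero constant polynomial, then a is a nonzero constant, i.e. a ∈ k^*. -/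
open MvPolynomial

theorem pderiv_eq_zero_of_mem_supported {σ R : Type*} [CommSemiring R] {s : Set σ} {i : σ}
    {p : MvPolynomial σ R} (hp : p ∈ supported R s) (hi : i ∉ s) : pderiv i p = 0 :=
  pderiv_eq_zero_of_notMem_vars fun h => hi (mem_supported.1 hp h)

/-- If `f1 = a·x1 + t` with `a, t ∈ k[x3]`, `f2 ∈ k[x1,x2,x3]`, and the Jacobian
determinant of `(f1, f2, x3)` is a nonzero constant, then `a` is a nonzero constant. -/
theorem jacobian_constant_of_triple (k : Type) [Field k] [CharZero k]
    (a t f2 : MvPolynomial (Fin 3) k)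
    (ha : a ∈ supported k ({2} : Set (Fin 3)))
    (ht : t ∈ supported k ({2} : Set (Fin 3)))
    (hdet : ∃ u : k, u ≠ 0 ∧
      (Matrix.of fun i j : Fin 3 =>
        pderiv j (![a * X 0 + t, f2, X 2] i)).det = C u) :
    ∃ u : k, u ≠ 0 ∧ a = C u := by
  obtain ⟨u, hu, hdet⟩ := hdet
  have ha0 : pderiv 0 a = 0 := pderiv_eq_zero_of_mem_supported ha (by decide)
  have ha1 : pderiv 1 a = 0 := pderiv_eq_zero_of_mem_supported ha (by decide)
  have ht0 : pderiv 0 t = 0 := pderiv_eq_zero_of_mem_supported ht (by decide)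
  have ht1 : pderiv 1 t = 0 := pderiv_eq_zero_of_mem_supported ht (by decide)
  have hmul : a * pderiv 1 f2 = C u := by
    rw [← hdet, Matrix.det_fin_three]
    simp [pderiv_X, ha0, ha1, ht0, ht1]
  have hunit : IsUnit a :=
    isUnit_of_mul_isUnit_left (hmul ▸ (isUnit_iff_ne_zero.2 hu).map C)
  obtain ⟨c, hc, rfl⟩ := isUnit_iff_eq_C_of_isReduced.1 hunit
  exact ⟨c, hc.ne_zero, rfl⟩
end

section
/- Let a, α ∈ k^*, β ∈ k, t ∈ k[x3], and h2 ∈ k[x1,x2,x3]. Set h1 = a·x1 + t(x3) and h3 = α·x3 + β. If the determinant of the Jacobian matrix (∂h_i/∂x_j)_{i,j} of (h1, h2, h3) is a nonzero constant polynomial, then there exist d ∈ k^* and P ∈ k[x1,x3] such that h2 = d·x2 + P(x1,x3). -/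
open MvPolynomial

/-- In characteristic zero, a variable whose partial derivative kills `p` does not occur in `p`. -/
theorem MvPolynomial.notMem_vars_of_pderiv_eq_zero {σ R : Type*} [CommRing R] [NoZeroDivisors R]
    [CharZero R] {i : σ} {p : MvPolynomial σ R} (h : pderiv i p = 0) : i ∉ p.vars := by
  intro hi
  obtain ⟨m, hm, him⟩ := (mem_vars_iff_mem_support i).1 hi
  have hmi : m i ≠ 0 := Finsupp.mem_support_iff.1 him
  have hle : Finsupp.single i 1 ≤ m := Finsupp.single_le_iff.2 (Nat.one_le_iff_ne_zero.2 hmi)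
  have hc := coeff_pderiv (i := i) p (m - Finsupp.single i 1)
  rw [h, coeff_zero, tsub_add_cancel_of_le hle] at hc
  rcases mul_eq_zero.1 hc.symm with h0 | h0
  · exact mem_support_iff.1 hm h0
  · exact Nat.cast_add_one_ne_zero _ h0

/-- If `h1 = a·x1 + t(x3)`, `h3 = α·x3 + β` with `a, α ∈ k^*`, and the Jacobian
determinant of `(h1, h2, h3)` is a nonzero constant, then `h2 = d·x2 + P(x1,x3)`
for some `d ∈ k^*` and `P ∈ k[x1,x3]`. -/
theorem h2_form_of_jacobian_constant (k : Type) [Field k] [CharZero k]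
    (a α β : k) (ha : a ≠ 0) (hα : α ≠ 0)
    (t h2 : MvPolynomial (Fin 3) k)
    (ht : t ∈ supported k ({2} : Set (Fin 3)))
    (hdet : ∃ u : k, u ≠ 0 ∧
      (Matrix.of fun i j : Fin 3 =>
        pderiv j (![C a * X 0 + t, h2, C α * X 2 + C β] i)).det = C u) :
    ∃ (d : k) (P : MvPolynomial (Fin 3) k), d ≠ 0 ∧
      P ∈ supported k ({0, 2} : Set (Fin 3)) ∧ h2 = C d * X 1 + P := by
  obtain ⟨u, hu, hdet⟩ := hdet
  have hpt : ∀ i : Fin 3, i ≠ 2 → pderiv i t = 0 := fun i hi =>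
    pderiv_eq_zero_of_notMem_vars fun h => hi (mem_supported.1 ht h)
  have hmul : C (a * α) * pderiv 1 h2 = C u := by
    rw [← hdet, Matrix.det_fin_three]
    simp [hpt 0 (by decide), hpt 1 (by decide), pderiv_X]
    ring
  have haα : a * α ≠ 0 := mul_ne_zero ha hα
  have hpd : pderiv 1 h2 = C (u / (a * α)) := by
    refine mul_left_cancel₀ (C_ne_zero.2 haα) ?_
    rw [hmul, ← C_mul, mul_div_cancel₀ _ haα]
  refine ⟨u / (a * α), h2 - C (u / (a * α)) * X 1, div_ne_zero hu haα, ?_, by ring⟩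
  have hvars : (1 : Fin 3) ∉ (h2 - C (u / (a * α)) * X 1).vars :=
    notMem_vars_of_pderiv_eq_zero (by
      rw [map_sub, hpd, pderiv_C_mul, pderiv_X_self, mul_one, sub_self])
  refine mem_supported.2 fun i hi => ?_
  have hi1 : i ≠ 1 := fun h => hvars (h ▸ hi)
  fin_cases i <;> simp at hi1 ⊢
end

section
/- For every integer n ≥ 1, the automorphism τ^n satisfies τ^n(x1) = P_{n-2}(x3)·x1 + P_{n-1}(x3)·x2, τ^n(x2) = P_{n-1}(x3)·x1 + P_n(x3)·x2, and τ^n(x3) = x3. -/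
open MvPolynomial

/-- `Pseq k n` is the polynomial `P_{n-1}`: `P_{-1} = 0`, `P_0 = 1`,
`P_n = X·P_{n-1} + P_{n-2}` for `n ≥ 1`. -/
noncomputable def Pseq (k : Type) [Field k] : ℕ → Polynomial k
  | 0 => 0
  | 1 => 1
  | (n + 2) => Polynomial.X * Pseq k (n + 1) + Pseq k n

/-- `Qseq k n` is the polynomial `Q_{n-1}`: `Q_{-1} = 0`, `Q_0 = 1`,
`Q_n = -X·Q_{n-1} + Q_{n-2}` for `n ≥ 1`. -/
noncomputable def Qseq (k : Type) [Field k] : ℕ → Polynomial k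
  | 0 => 0
  | 1 => 1
  | (n + 2) => -Polynomial.X * Qseq k (n + 1) + Qseq k n

/-- For `n ≥ 1`, the automorphism `τ^n` (where `τ(x1) = x2`, `τ(x2) = x1 + x2·x3`,
`τ(x3) = x3`) satisfies `τ^n(x1) = P_{n-2}(x3)·x1 + P_{n-1}(x3)·x2`,
`τ^n(x2) = P_{n-1}(x3)·x1 + P_n(x3)·x2`, `τ^n(x3) = x3`.
Here `P_m = Pseq k (m+1)`. -/
theorem tau_pow_n (k : Type) [Field k] [CharZero k]
    (τ : MvPolynomial (Fin 3) k ≃ₐ[k] MvPolynomial (Fin 3) k)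
    (hτ1 : τ (X 0) = X 1) (hτ2 : τ (X 1) = X 0 + X 1 * X 2) (hτ3 : τ (X 2) = X 2)
    (n : ℕ) (hn : 1 ≤ n) :
    (τ ^ n) (X 0) = Polynomial.aeval (X 2 : MvPolynomial (Fin 3) k) (Pseq k (n - 1)) * X 0
        + Polynomial.aeval (X 2 : MvPolynomial (Fin 3) k) (Pseq k n) * X 1 ∧
    (τ ^ n) (X 1) = Polynomial.aeval (X 2 : MvPolynomial (Fin 3) k) (Pseq k n) * X 0
        + Polynomial.aeval (X 2 : MvPolynomial (Fin 3) k) (Pseq k (n + 1)) * X 1 ∧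
    (τ ^ n) (X 2) = X 2 := by
  have hP (p : Polynomial k) :
      τ (Polynomial.aeval (X 2 : MvPolynomial (Fin 3) k) p) = Polynomial.aeval (X 2) p := by
    rw [← Polynomial.aeval_algHom_apply, hτ3]
  induction n, hn using Nat.le_induction with
  | base => simp [Pseq, hτ1, hτ2, hτ3, mul_comm]
  | succ n hn ih =>
    obtain ⟨m, rfl⟩ := Nat.exists_eq_add_of_le' hn
    obtain ⟨h1, h2, h3⟩ := ih
    simp only [Nat.add_sub_cancel] at h1 ⊢
    rw [pow_succ', AlgEquiv.mul_apply, AlgEquiv.mul_apply, AlgEquiv.mul_apply, h1, h2, h3]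
    simp only [map_add, map_mul, hP, hτ1, hτ2, hτ3]
    refine ⟨?_, ?_, trivial⟩
    · rw [Pseq, map_add, map_mul, Polynomial.aeval_X]
      ring
    · rw [show Pseq k (m + 1 + 1 + 1) = Polynomial.X * Pseq k (m + 1 + 1) + Pseq k (m + 1) from rfl,
        map_add, map_mul, Polynomial.aeval_X]
      ring
end

section
/- For every integer n ≥ 1, the automorphism τ^{-n} satisfies τ^{-n}(x1) = Q_n(x3)·x1 + Q_{n-1}(x3)·x2, τ^{-n}(x2) = Q_{n-1}(x3)·x1 + Q_{n-2}(x3)·x2, and τ^{-n}(x3) = x3. -/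
open MvPolynomial

theorem Qseq_add_two (k : Type) [Field k] (n : ℕ) :
    Qseq k (n + 2) = -Polynomial.X * Qseq k (n + 1) + Qseq k n := by
  rw [Qseq]

/-- The powers of the automorphism `X 0 ↦ X 1 - X 0 * X 2`, `X 1 ↦ X 0`, `X 2 ↦ X 2`. -/
theorem pow_succ_apply_X_eq_Qseq (k : Type) [Field k]
    (σ : MvPolynomial (Fin 3) k ≃ₐ[k] MvPolynomial (Fin 3) k)
    (h0 : σ (X 0) = X 1 - X 0 * X 2) (h1 : σ (X 1) = X 0) (h2 : σ (X 2) = X 2) (n : ℕ) :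
    (σ ^ (n + 1)) (X 0)
        = Polynomial.aeval (X 2 : MvPolynomial (Fin 3) k) (Qseq k (n + 2)) * X 0
        + Polynomial.aeval (X 2 : MvPolynomial (Fin 3) k) (Qseq k (n + 1)) * X 1 ∧
    (σ ^ (n + 1)) (X 1)
        = Polynomial.aeval (X 2 : MvPolynomial (Fin 3) k) (Qseq k (n + 1)) * X 0
        + Polynomial.aeval (X 2 : MvPolynomial (Fin 3) k) (Qseq k n) * X 1 ∧
    (σ ^ (n + 1)) (X 2) = X 2 := by
  induction n with
  | zero =>
    simp only [zero_add, pow_one, h0, h1, h2, Qseq, map_add, map_mul, map_neg, map_zero, map_one,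
      Polynomial.aeval_X, and_true]
    constructor <;> ring
  | succ n ih =>
    obtain ⟨ih0, ih1, ih2⟩ := ih
    refine ⟨?_, ?_, ?_⟩
    · rw [pow_succ, AlgEquiv.mul_apply, h0, map_sub, map_mul, ih0, ih1, ih2,
        Qseq_add_two k (n + 1), Qseq_add_two k n]
      simp only [map_add, map_mul, map_neg, Polynomial.aeval_X]
      ring
    · rw [pow_succ, AlgEquiv.mul_apply, h1, ih0]
    · rw [pow_succ, AlgEquiv.mul_apply, h2, ih2]

/-- For `n ≥ 1`, the automorphism `τ^{-n}` (where `τ(x1) = x2`, `τ(x2) = x1 + x2·x3`,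
`τ(x3) = x3`) satisfies `τ^{-n}(x1) = Q_n(x3)·x1 + Q_{n-1}(x3)·x2`,
`τ^{-n}(x2) = Q_{n-1}(x3)·x1 + Q_{n-2}(x3)·x2`, `τ^{-n}(x3) = x3`.
Here `Q_m = Qseq k (m+1)`. -/
theorem tau_pow_neg_n (k : Type) [Field k] [CharZero k]
    (τ : MvPolynomial (Fin 3) k ≃ₐ[k] MvPolynomial (Fin 3) k)
    (hτ1 : τ (X 0) = X 1) (hτ2 : τ (X 1) = X 0 + X 1 * X 2) (hτ3 : τ (X 2) = X 2)
    (n : ℕ) (hn : 1 ≤ n) :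
    (τ ^ (-(n : ℤ))) (X 0)
        = Polynomial.aeval (X 2 : MvPolynomial (Fin 3) k) (Qseq k (n + 1)) * X 0
        + Polynomial.aeval (X 2 : MvPolynomial (Fin 3) k) (Qseq k n) * X 1 ∧
    (τ ^ (-(n : ℤ))) (X 1)
        = Polynomial.aeval (X 2 : MvPolynomial (Fin 3) k) (Qseq k n) * X 0
        + Polynomial.aeval (X 2 : MvPolynomial (Fin 3) k) (Qseq k (n - 1)) * X 1 ∧
    (τ ^ (-(n : ℤ))) (X 2) = X 2 := by
  have h0 : τ⁻¹ (X 0) = X 1 - X 0 * X 2 := by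
    rw [AlgEquiv.aut_inv, AlgEquiv.symm_apply_eq, map_sub, map_mul, hτ1, hτ2, hτ3]
    ring
  have h1 : τ⁻¹ (X 1) = X 0 := by
    rw [AlgEquiv.aut_inv, AlgEquiv.symm_apply_eq, hτ1]
  have h2 : τ⁻¹ (X 2) = X 2 := by
    rw [AlgEquiv.aut_inv, AlgEquiv.symm_apply_eq, hτ3]
  obtain ⟨m, rfl⟩ := Nat.exists_eq_add_of_le' hn
  rw [zpow_neg, zpow_natCast, ← inv_pow, Nat.add_sub_cancel]
  exact pow_succ_apply_X_eq_Qseq k τ⁻¹ h0 h1 h2 m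
end
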